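/- arXiv:2303.07658 — 2 statements merged into one kernel-verified Lean document; each statement's English description precedes it below -/
import Mathlib

section
/- Let I ⊆ [n-1] (so 0 ∉ I) with connected components I_1,…,I_s, let m = Σ_k ⌊(|I_k|+1)/2⌋, and let C_I be the q-multinomial coefficient [m choose ⌊(|I_1|+1)/2⌋,…,⌊(|I_s|+1)/2⌋] evaluated at q = x^2. Then Σ_{σ ∈ D_n^I} (-1)^{ℓ(σ)} x^{L(σ)} = C_I · ∏_{i=2}^{n} (1 + (-1)^{i-1} x^{⌊i/2⌋}) · ∏_{i=2m+2}^{n} (1 + (-1)^{i-1} x^{⌊i/2⌋}). -/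
open Polynomial Finset

namespace OddLength

/-- A signed permutation of degree `n`, encoded as an underlying permutation of
`Fin n` together with a sign vector. -/
abbrev SP (n : ℕ) := Equiv.Perm (Fin n) × (Fin n → Bool)

/-- The one-line value `σ(i)` of a signed permutation, for `i ∈ [1,n]` (and `0` elsewhere). -/
def sval {n : ℕ} (σ : SP n) (i : ℕ) : ℤ :=
  if h : 1 ≤ i ∧ i ≤ n then
    (if σ.2 ⟨i - 1, by omega⟩ then (-1 : ℤ) else 1) *
      (((σ.1 ⟨i - 1, by omega⟩ : Fin n) : ℕ) + 1 : ℤ)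
  else 0

/-- A signed permutation is *even* (lies in the Weyl group `D_n`) if it has an even
number of negative entries in its one-line notation. -/
def IsEvenSP {n : ℕ} (σ : SP n) : Prop :=
  Even ((Finset.univ.filter (fun i => σ.2 i = true)).card)

instance {n : ℕ} (σ : SP n) : Decidable (IsEvenSP σ) := by
  unfold IsEvenSP; infer_instance

/-- Pairs `1 ≤ i < j ≤ n` of positions. -/
def pairs (n : ℕ) : Finset (ℕ × ℕ) :=
  (Finset.Icc 1 n ×ˢ Finset.Icc 1 n).filter (fun p => p.1 < p.2)

/-- Number of inversions. -/
def invSP {n : ℕ} (σ : SP n) : ℕ :=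
  ((pairs n).filter (fun p => sval σ p.2 < sval σ p.1)).card

/-- Number of negative sum pairs. -/
def nspSP {n : ℕ} (σ : SP n) : ℕ :=
  ((pairs n).filter (fun p => sval σ p.1 + sval σ p.2 < 0)).card

/-- Number of odd inversions (positions of different parity). -/
def oinvSP {n : ℕ} (σ : SP n) : ℕ :=
  ((pairs n).filter (fun p => sval σ p.2 < sval σ p.1 ∧ p.1 % 2 ≠ p.2 % 2)).card

/-- Number of odd negative sum pairs (positions of different parity). -/
def onspSP {n : ℕ} (σ : SP n) : ℕ :=
  ((pairs n).filter (fun p => sval σ p.1 + sval σ p.2 < 0 ∧ p.1 % 2 ≠ p.2 % 2)).card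

/-- The type-`D` Coxeter length `ℓ(σ) = inv(σ) + nsp(σ)`. -/
def ellD {n : ℕ} (σ : SP n) : ℕ := invSP σ + nspSP σ

/-- The type-`D` odd length `L(σ) = oinv(σ) + onsp(σ)`. -/
def LD {n : ℕ} (σ : SP n) : ℕ := oinvSP σ + onspSP σ

/-- The descent value at position `i`, with the type-`D` convention `σ(0) := -σ(2)`. -/
def dval {n : ℕ} (σ : SP n) (i : ℕ) : ℤ := if i = 0 then -sval σ 2 else sval σ i

/-- Membership in the parabolic quotient `D_n^I`: `σ(i) < σ(i+1)` for all `i ∈ I`,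
with the convention `σ(0) = -σ(2)`. -/
def InQuot {n : ℕ} (σ : SP n) (I : Finset ℕ) : Prop :=
  ∀ i ∈ I, dval σ i < dval σ (i + 1)

instance {n : ℕ} (σ : SP n) (I : Finset ℕ) : Decidable (InQuot σ I) := by
  unfold InQuot; infer_instance

/-- `σ` is ascending: `σ(1) < σ(2) < ⋯ < σ(n)`. -/
def Ascending {n : ℕ} (σ : SP n) : Prop :=
  ∀ i, 1 ≤ i → i < n → sval σ i < sval σ (i + 1)

/-- `σ` is a chessboard element: `σ(i) ≢ σ(i+1) (mod 2)` for all `i ∈ [n-1]`. -/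
def Chessboard {n : ℕ} (σ : SP n) : Prop :=
  ∀ i ∈ Finset.Icc 1 (n - 1), sval σ i % 2 ≠ sval σ (i + 1) % 2

instance {n : ℕ} (σ : SP n) : Decidable (Chessboard σ) := by
  unfold Chessboard; infer_instance

/-- The sign-twisted generating function of the odd length over `D_n^I`. -/
noncomputable def genD (n : ℕ) (I : Finset ℕ) : Polynomial ℤ :=
  ∑ σ ∈ Finset.univ.filter (fun σ : SP n => IsEvenSP σ ∧ InQuot σ I),
    (-1 : Polynomial ℤ) ^ ellD σ * X ^ LD σ


/-- The `q`-factorial `[k]_q! = ∏_{i=1}^{k} (1 + q + ⋯ + q^{i-1})`, for `q` a polynomial. -/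
noncomputable def qfact (q : Polynomial ℤ) (k : ℕ) : Polynomial ℤ :=
  ∏ i ∈ Finset.Icc 1 k, (∑ j ∈ Finset.range i, q ^ j)

/-- The one-line value, indexed by `Fin n`. -/
def vv {n : ℕ} (σ : SP n) (i : Fin n) : ℤ :=
  (if σ.2 i then (-1 : ℤ) else 1) * (((σ.1 i : Fin n) : ℕ) + 1 : ℤ)

/-- `x` if the parities differ, `1` otherwise. -/
def yy (x : ℝ) (p q : ℕ) : ℝ := if p % 2 = q % 2 then 1 else x

/-- Weight of a pair of positions `p < q` carrying values `s, t`. -/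
def kern (x : ℝ) (lk : ℕ → ℕ → Bool) (p q : ℕ) (s t : ℤ) : ℝ :=
  (if lk p q = true ∧ t < s then 0 else 1) * (if t < s then -(yy x p q) else 1) *
    (if s + t < 0 then -(yy x p q) else 1)

/-- Weighted sum over all signed permutations. -/
def Fsum (x z : ℝ) (lk : ℕ → ℕ → Bool) (n : ℕ) (e : Fin n → ℕ) : ℝ :=
  ∑ σ : SP n, (∏ i, if σ.2 i then z else 1) *
    ∏ i, ∏ j, if i < j then kern x lk (e i) (e j) (vv σ i) (vv σ j) else 1

/-- Insert the largest value at position `p`. -/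
def insP {n : ℕ} (p : Fin (n + 1)) (π : Equiv.Perm (Fin n)) : Equiv.Perm (Fin (n + 1)) :=
  (finSuccEquiv' p).trans ((Equiv.optionCongr π).trans (finSuccEquiv' (Fin.last n)).symm)

lemma insP_self {n : ℕ} (p : Fin (n + 1)) (π : Equiv.Perm (Fin n)) :
    insP p π p = Fin.last n := by
  simp [insP]

lemma insP_succAbove {n : ℕ} (p : Fin (n + 1)) (π : Equiv.Perm (Fin n)) (i : Fin n) :
    insP p π (p.succAbove i) = (π i).castSucc := by
  simp [insP]

/-- Insert a signed largest value at position `p`. -/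
def ins {n : ℕ} (t : Fin (n + 1) × Bool × SP n) : SP (n + 1) :=
  (insP t.1 t.2.2.1, Fin.insertNth (α := fun _ => Bool) t.1 t.2.1 t.2.2.2)

lemma ins_bij {n : ℕ} : Function.Bijective (ins (n := n)) := by
  rw [Fintype.bijective_iff_injective_and_card]
  constructor
  · rintro ⟨p, s, π, f⟩ ⟨p', s', π', f'⟩ h
    simp only [ins, Prod.mk.injEq] at h
    obtain ⟨h1, h2⟩ := h
    have hp : p = p' := by
      have e1 := insP_self p π
      rw [h1, ← insP_self p' π'] at e1
      exact (insP p' π').injective e1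
    subst hp
    have hs : s = s' := by
      have := congrFun h2 p
      simpa using this
    have hf : f = f' := by
      funext i
      have := congrFun h2 (p.succAbove i)
      simpa using this
    have hπ : π = π' := by
      ext i
      have := congrArg (fun g => g (p.succAbove i)) h1
      simp only [insP_succAbove] at this
      have := Fin.castSucc_injective _ this
      rw [this]
    subst hs hf hπ
    rfl
  · simp only [SP, Fintype.card_prod, Fintype.card_fin, Fintype.card_bool, Fintype.card_perm,
      Fintype.card_fun, Nat.factorial_succ, pow_succ]
    ring

lemma vv_ins_pos {n : ℕ} (p : Fin (n + 1)) (σ : SP n) :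
    vv (ins (p, false, σ)) p = (n : ℤ) + 1 := by
  simp [vv, ins, insP_self]

lemma vv_ins_neg {n : ℕ} (p : Fin (n + 1)) (σ : SP n) :
    vv (ins (p, true, σ)) p = -((n : ℤ) + 1) := by
  simp [vv, ins, insP_self]

lemma vv_ins_succAbove {n : ℕ} (p : Fin (n + 1)) (s : Bool) (σ : SP n) (i : Fin n) :
    vv (ins (p, s, σ)) (p.succAbove i) = vv σ i := by
  simp [vv, ins, insP_succAbove]

lemma vv_bound {n : ℕ} (σ : SP n) (i : Fin n) : - (n : ℤ) ≤ vv σ i ∧ vv σ i ≤ n := by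
  have := (σ.1 i).isLt
  unfold vv
  split_ifs <;> constructor <;> omega

/-- factor for a positive maximal value -/
def k1 (x : ℝ) (lk : ℕ → ℕ → Bool) (p q : ℕ) : ℝ := (if lk p q = true then 0 else 1) * -(yy x p q)

/-- factor for a negative maximal value -/
def k2 (x : ℝ) (lk : ℕ → ℕ → Bool) (p q : ℕ) : ℝ :=
  (if lk p q = true then 0 else 1) * (yy x p q) ^ 2

/-- weight of removing a positive maximal value at `q` -/
def w1 (x : ℝ) (lk : ℕ → ℕ → Bool) (T : Finset ℕ) (q : ℕ) : ℝ :=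
  ∏ q' ∈ T, (if q < q' then k1 x lk q q' else 1)

/-- weight of removing a negative maximal value at `q` -/
def w2 (x : ℝ) (lk : ℕ → ℕ → Bool) (T : Finset ℕ) (q : ℕ) : ℝ :=
  ∏ q' ∈ T, (if q' < q then k2 x lk q' q else if q < q' then -(yy x q q') else 1)

/-- The recursion solved by `Fsum`. -/
def FT (x z : ℝ) (lk : ℕ → ℕ → Bool) : ℕ → Finset ℕ → ℝ
  | 0, _ => 1
  | n + 1, T => ∑ q ∈ T, (w1 x lk T q + z * w2 x lk T q) * FT x z lk n (T.erase q)

lemma pair_split {n : ℕ} (p : Fin (n + 1)) (G : Fin (n + 1) → Fin (n + 1) → ℝ) (h : G p p = 1) :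
    ∏ i, ∏ j, G i j = (∏ j, (G p (p.succAbove j) * G (p.succAbove j) p)) *
      ∏ i, ∏ j, G (p.succAbove i) (p.succAbove j) := by
  rw [Fin.prod_univ_succAbove _ p, Fin.prod_univ_succAbove _ p, h, one_mul]
  simp_rw [fun i => Fin.prod_univ_succAbove (fun j => G (p.succAbove i) j) p]
  rw [Finset.prod_mul_distrib, Finset.prod_mul_distrib, mul_assoc]

lemma Fsum_eq (x z : ℝ) (lk : ℕ → ℕ → Bool) (n : ℕ) (e : Fin n → ℕ) (he : StrictMono e) :
    Fsum x z lk n e = FT x z lk n (Finset.univ.image e) := by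
  induction n with
  | zero => simp [Fsum, FT]
  | succ n ih =>
    unfold Fsum
    rw [← (ins_bij (n := n)).sum_comp, Fintype.sum_prod_type, FT,
      Finset.sum_image (fun a _ b _ h => he.injective h)]
    refine Finset.sum_congr rfl fun p _ => ?_
    have her : (Finset.univ.image e).erase (e p) = Finset.univ.image (e ∘ p.succAbove) := by
      ext q
      simp only [mem_erase, mem_image, mem_univ, true_and, Function.comp]
      constructor
      · rintro ⟨h1, i, rfl⟩
        have : i ≠ p := fun h => h1 (by rw [h])
        obtain ⟨j, rfl⟩ := Fin.exists_succAbove_eq this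
        exact ⟨j, rfl⟩
      · rintro ⟨j, rfl⟩
        exact ⟨fun h => Fin.succAbove_ne p j (he.injective h), _, rfl⟩
    have hW1 : w1 x lk (Finset.univ.image e) (e p) =
        ∏ j, (if p < p.succAbove j then k1 x lk (e p) (e (p.succAbove j)) else 1) := by
      unfold w1
      rw [Finset.prod_image (fun a _ b _ h => he.injective h), Fin.prod_univ_succAbove _ p]
      simp [he.lt_iff_lt]
    have hW2 : w2 x lk (Finset.univ.image e) (e p) =
        ∏ j, (if p.succAbove j < p then k2 x lk (e (p.succAbove j)) (e p)
          else if p < p.succAbove j then -(yy x (e p) (e (p.succAbove j))) else 1) := by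
      unfold w2
      rw [Finset.prod_image (fun a _ b _ h => he.injective h), Fin.prod_univ_succAbove _ p]
      simp [he.lt_iff_lt]
    rw [her, ← ih _ (he.comp (Fin.strictMono_succAbove p)), hW1, hW2, Fintype.sum_prod_type,
      Fintype.sum_bool, add_mul, add_comm]
    unfold Fsum
    congr 1
    · rw [Finset.mul_sum]
      refine Finset.sum_congr rfl fun σ _ => ?_
      rw [pair_split p _ (by simp), Fin.prod_univ_succAbove _ p]
      simp only [vv_ins_pos, vv_ins_neg, vv_ins_succAbove, (Fin.strictMono_succAbove p).lt_iff_lt]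
      have : (∏ j, ((if p < p.succAbove j then kern x lk (e p) (e (p.succAbove j))
          ((n : ℤ) + 1) (vv σ j) else 1) *
          (if p.succAbove j < p then kern x lk (e (p.succAbove j)) (e p) (vv σ j)
          ((n : ℤ) + 1) else 1))) =
          ∏ j, (if p < p.succAbove j then k1 x lk (e p) (e (p.succAbove j)) else 1) := by
        refine Finset.prod_congr rfl fun j _ => ?_
        have hb := vv_bound σ j
        rcases lt_or_gt_of_ne (Fin.succAbove_ne p j) with h | h
        · rw [if_neg (not_lt.2 h.le), if_neg (not_lt.2 h.le), if_pos h]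
          have h1 : ¬ (n : ℤ) + 1 < vv σ j := by omega
          have h2 : ¬ vv σ j + ((n : ℤ) + 1) < 0 := by omega
          simp only [kern, h1, h2, and_false, if_false, mul_one, if_pos h]
        · rw [if_pos h, if_pos h, if_neg (not_lt.2 h.le)]
          have h1 : vv σ j < (n : ℤ) + 1 := by omega
          have h2 : ¬ (n : ℤ) + 1 + vv σ j < 0 := by omega
          simp only [kern, k1, h1, h2, and_true, if_true, if_false, mul_one]
      rw [this]
      simp [ins]
      ring
    · rw [Finset.mul_sum]
      refine Finset.sum_congr rfl fun σ _ => ?_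
      rw [pair_split p _ (by simp), Fin.prod_univ_succAbove _ p]
      simp only [vv_ins_pos, vv_ins_neg, vv_ins_succAbove, (Fin.strictMono_succAbove p).lt_iff_lt]
      have : (∏ j, ((if p < p.succAbove j then kern x lk (e p) (e (p.succAbove j))
          (-((n : ℤ) + 1)) (vv σ j) else 1) *
          (if p.succAbove j < p then kern x lk (e (p.succAbove j)) (e p) (vv σ j)
          (-((n : ℤ) + 1)) else 1))) =
          ∏ j, (if p.succAbove j < p then k2 x lk (e (p.succAbove j)) (e p)
          else if p < p.succAbove j then -(yy x (e p) (e (p.succAbove j))) else 1) := by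
        refine Finset.prod_congr rfl fun j _ => ?_
        have hb := vv_bound σ j
        rcases lt_or_gt_of_ne (Fin.succAbove_ne p j) with h | h
        · rw [if_neg (not_lt.2 h.le), if_pos h, if_pos h, one_mul]
          have h1 : -((n : ℤ) + 1) < vv σ j := by
            omega
          have h2 : vv σ j + -((n : ℤ) + 1) < 0 := by
            omega
          simp only [kern, k2, h1, h2, and_true, if_true]
          ring
        · rw [if_pos h, if_neg (not_lt.2 h.le), if_neg (not_lt.2 h.le), if_pos h, mul_one]
          have h1 : ¬ vv σ j < -((n : ℤ) + 1) := by
            omega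
          have h2 : -((n : ℤ) + 1) + vv σ j < 0 := by
            omega
          simp only [kern, h1, h2, and_false, if_true, if_false, one_mul]
      rw [this]
      simp [ins]
      ring
/-- two by two real matrices -/
abbrev Mt := Matrix (Fin 2) (Fin 2) ℝ

/-- `∏_{i=1}^k (1 - x^{2i})` -/
def dd (x : ℝ) (k : ℕ) : ℝ := ∏ i ∈ Finset.range k, (1 - x ^ (2 * (i + 1)))

lemma dd_succ (x : ℝ) (k : ℕ) : dd x (k + 1) = dd x k * (1 - x ^ (2 * (k + 1))) := by
  simp [dd, Finset.prod_range_succ]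

lemma fac_ne {x : ℝ} (hx : 1 < x) (k : ℕ) : 1 - x ^ (2 * (k + 1)) ≠ 0 := by
  have : 1 < x ^ (2 * (k + 1)) := one_lt_pow₀ hx (by omega)
  linarith

lemma dd_ne {x : ℝ} (hx : 1 < x) (k : ℕ) : dd x k ≠ 0 := by
  unfold dd
  exact Finset.prod_ne_zero_iff.2 fun i _ => fac_ne hx i

/-- matrix of an ascending block starting at `lo` of length `c` -/
noncomputable def Mb (x : ℝ) (lo c : ℕ) : Mt :=
  (dd x (c / 2))⁻¹ • (if c % 2 = 0 then
    (if lo % 2 = 0 then !![1, 0; 0, x ^ (c / 2)] else !![x ^ (c / 2), 0; 0, 1])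
    else if lo % 2 = 0 then !![0, 1; 0, 0] else !![0, 0; 1, 0])

/-- the matrix implementing removal of a letter of type `t` -/
def Zm (t : ℕ) : Mt := if t % 2 = 0 then !![0, 0; 1, 0] else !![0, 1; 0, 0]

/-- number of even positions -/
def cA (lo c : ℕ) : ℕ := (c + (if lo % 2 = 0 then 1 else 0)) / 2

/-- number of odd positions -/
def cB (lo c : ℕ) : ℕ := (c + (if lo % 2 = 0 then 0 else 1)) / 2

/-- twist of a block -/
def tw (x : ℝ) (t lo c : ℕ) : ℝ := ∏ q ∈ Finset.Ico lo (lo + c), -(yy x t q)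

lemma tw_zero (x : ℝ) (lo c : ℕ) : tw x 0 lo c = (-1) ^ c * x ^ cB lo c := by
  induction c with
  | zero => simp [tw, cB]; split_ifs <;> simp
  | succ c ih =>
    have : tw x 0 lo (c + 1) = tw x 0 lo c * -(yy x 0 (lo + c)) := by
      unfold tw; rw [← add_assoc, Finset.prod_Ico_succ_top (by omega)]
    rw [this, ih, yy]
    by_cases h : (lo + c) % 2 = 0
    · have : cB lo (c + 1) = cB lo c := by unfold cB; split_ifs <;> omega
      rw [if_pos (by omega), this]; ring
    · have : cB lo (c + 1) = cB lo c + 1 := by unfold cB; split_ifs <;> omega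
      rw [if_neg (by omega), this]; ring

lemma tw_one (x : ℝ) (lo c : ℕ) : tw x 1 lo c = (-1) ^ c * x ^ cA lo c := by
  induction c with
  | zero => simp [tw, cA]; split_ifs <;> simp
  | succ c ih =>
    have : tw x 1 lo (c + 1) = tw x 1 lo c * -(yy x 1 (lo + c)) := by
      unfold tw; rw [← add_assoc, Finset.prod_Ico_succ_top (by omega)]
    rw [this, ih, yy]
    by_cases h : (lo + c) % 2 = 1
    · have : cA lo (c + 1) = cA lo c := by unfold cA; split_ifs <;> omega
      rw [if_pos (by omega), this]; ring
    · have : cA lo (c + 1) = cA lo c + 1 := by unfold cA; split_ifs <;> omega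
      rw [if_neg (by omega), this]; ring

lemma Mb_even (x : ℝ) (lo k : ℕ) : Mb x lo (2 * k) = (dd x k)⁻¹ •
    (if lo % 2 = 0 then !![1, 0; 0, x ^ k] else !![x ^ k, 0; 0, 1]) := by
  unfold Mb
  rw [show 2 * k / 2 = k by omega, if_pos (by omega)]

lemma Mb_odd (x : ℝ) (lo k : ℕ) : Mb x lo (2 * k + 1) = (dd x k)⁻¹ •
    (if lo % 2 = 0 then !![0, 1; 0, 0] else !![0, 0; 1, 0]) := by
  unfold Mb
  rw [show (2 * k + 1) / 2 = k by omega, if_neg (by omega)]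

lemma dd_inv {x : ℝ} (hx : 1 < x) (k : ℕ) :
    (dd x k)⁻¹ = (dd x (k + 1))⁻¹ * (1 - x ^ (2 * (k + 1))) := by
  rw [dd_succ]
  have := fac_ne hx k
  have := dd_ne hx k
  field_simp

lemma block1 {x : ℝ} (hx : 1 < x) (t lo c : ℕ) (ht : t < 2) :
    Mb x lo c * Zm t - tw x t lo c • (Zm t * Mb x lo c) =
      if 0 < c ∧ (lo + c - 1) % 2 = t then Mb x lo (c - 1) else 0 := by
  have h1 := dd_inv hx
  obtain ⟨k, rfl | rfl⟩ : ∃ k, c = 2 * k ∨ c = 2 * k + 1 := ⟨c / 2, by omega⟩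
  · rcases k with _ | k
    · interval_cases t <;> by_cases h : lo % 2 = 0 <;>
        ext i j <;> fin_cases i <;> fin_cases j <;> simp [tw_zero, tw_one, cA, cB, h, Mb, Zm]
    · have e1 : 2 * (k + 1) - 1 = 2 * k + 1 := by omega
      have e2 : (2 * (k + 1) + 1) / 2 = k + 1 := by omega
      interval_cases t <;> by_cases h : lo % 2 = 0 <;>
        [rw [if_neg (by omega)]; rw [if_pos (by omega)]; rw [if_pos (by omega)]; rw [if_neg (by omega)]] <;>
        simp only [tw_zero, tw_one, cA, cB, h, e1, Mb_even, Mb_odd, Zm, h1 k, e2] <;>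
        ext i j <;> fin_cases i <;> fin_cases j <;> simp [e2] <;> ring
  · have e2 : (2 * k + 1 + 1) / 2 = k + 1 := by omega
    have e3 : (2 * k + 1) / 2 = k := by omega
    interval_cases t <;> by_cases h : lo % 2 = 0 <;>
        [rw [if_pos (by omega)]; rw [if_neg (by omega)]; rw [if_neg (by omega)]; rw [if_pos (by omega)]] <;>
        simp only [tw_zero, tw_one, cA, cB, h, Nat.add_sub_cancel, Mb_even, Mb_odd, Zm] <;>
        ext i j <;> fin_cases i <;> fin_cases j <;> simp [e2, e3, pow_succ, pow_mul] <;> ring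

lemma block2 {x : ℝ} (hx : 1 < x) (t lo c : ℕ) (ht : t < 2) :
    Zm t * Mb x lo c - tw x t lo c • (Mb x lo c * Zm t) =
      if 0 < c ∧ lo % 2 = t then Mb x (lo + 1) (c - 1) else 0 := by
  have h1 := dd_inv hx
  obtain ⟨k, rfl | rfl⟩ : ∃ k, c = 2 * k ∨ c = 2 * k + 1 := ⟨c / 2, by omega⟩
  · rcases k with _ | k
    · interval_cases t <;> by_cases h : lo % 2 = 0 <;>
        ext i j <;> fin_cases i <;> fin_cases j <;> simp [tw_zero, tw_one, cA, cB, h, Mb, Zm]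
    · have e1 : 2 * (k + 1) - 1 = 2 * k + 1 := by omega
      have e2 : (2 * (k + 1) + 1) / 2 = k + 1 := by omega
      interval_cases t <;> by_cases h : lo % 2 = 0 <;>
        [(rw [if_pos (by omega)]; have h' : ¬ (lo + 1) % 2 = 0 := by omega);
         (rw [if_neg (by omega)]; have h' : (lo + 1) % 2 = 0 := by omega);
         (rw [if_neg (by omega)]; have h' : ¬ (lo + 1) % 2 = 0 := by omega);
         (rw [if_pos (by omega)]; have h' : (lo + 1) % 2 = 0 := by omega)] <;>
        simp only [tw_zero, tw_one, cA, cB, h, h', e1, Mb_even, Mb_odd, Zm, h1 k, e2] <;>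
        ext i j <;> fin_cases i <;> fin_cases j <;> simp [e2] <;> ring
  · have e2 : (2 * k + 1 + 1) / 2 = k + 1 := by omega
    have e3 : (2 * k + 1) / 2 = k := by omega
    interval_cases t <;> by_cases h : lo % 2 = 0 <;>
        [(rw [if_pos (by omega)]; have h' : ¬ (lo + 1) % 2 = 0 := by omega);
         (rw [if_neg (by omega)]; have h' : (lo + 1) % 2 = 0 := by omega);
         (rw [if_neg (by omega)]; have h' : ¬ (lo + 1) % 2 = 0 := by omega);
         (rw [if_pos (by omega)]; have h' : (lo + 1) % 2 = 0 := by omega)] <;>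
        simp only [tw_zero, tw_one, cA, cB, h, h', Nat.add_sub_cancel, Mb_even, Mb_odd, Zm] <;>
        ext i j <;> fin_cases i <;> fin_cases j <;> simp [e2, e3, pow_succ, pow_mul] <;> ring

/-- ordered product of matrices -/
def pref (M : ℕ → Mt) : ℕ → Mt
  | 0 => 1
  | r + 1 => pref M r * M r

lemma pref_congr {M N : ℕ → Mt} {r : ℕ} (h : ∀ k < r, M k = N k) : pref M r = pref N r := by
  induction r with
  | zero => rfl
  | succ r ih => rw [pref, pref, ih fun k hk => h k (by omega), h r (by omega)]

lemma leib1 (M M' : ℕ → Mt) (Z : Mt) (w : ℕ → ℝ) (r : ℕ)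
    (h : ∀ k, M k * Z - w k • (Z * M k) = M' k) :
    ∑ k ∈ Finset.range r, (∏ j ∈ Finset.range r, if k < j then w j else 1) •
      pref (Function.update M k (M' k)) r =
    pref M r * Z - (∏ j ∈ Finset.range r, w j) • (Z * pref M r) := by
  induction r with
  | zero => simp [pref]
  | succ r ih =>
    rw [Finset.sum_range_succ]
    have e1 : ∑ k ∈ Finset.range r, (∏ j ∈ Finset.range (r + 1), if k < j then w j else 1) •
        pref (Function.update M k (M' k)) (r + 1) =
        w r • ((∑ k ∈ Finset.range r, (∏ j ∈ Finset.range r, if k < j then w j else 1) •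
      pref (Function.update M k (M' k)) r) * M r) := by
      rw [Finset.sum_mul, Finset.smul_sum]
      refine Finset.sum_congr rfl fun k hk => ?_
      have hk := Finset.mem_range.1 hk
      rw [Finset.prod_range_succ, if_pos hk, pref, Function.update_of_ne (by omega), smul_mul_assoc,
        smul_smul, mul_comm]
    have e2 : (∏ j ∈ Finset.range (r + 1), if r < j then w j else 1) = 1 :=
      Finset.prod_eq_one fun j hj => if_neg (by have := Finset.mem_range.1 hj; omega)
    have e3 : pref (Function.update M r (M' r)) r = pref M r :=
      pref_congr fun k hk => Function.update_of_ne (by omega) _ _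
    rw [e1, ih, e2, one_smul, pref, e3, Function.update_self, ← h r, pref, Finset.prod_range_succ]
    simp only [mul_sub, sub_mul, smul_sub, mul_assoc, smul_mul_assoc, mul_smul_comm, smul_smul]
    rw [mul_comm (w r)]
    abel

lemma leib2 (M M' : ℕ → Mt) (Z : Mt) (w : ℕ → ℝ) (r : ℕ)
    (h : ∀ k, Z * M k - w k • (M k * Z) = M' k) :
    ∑ k ∈ Finset.range r, (∏ j ∈ Finset.range r, if j < k then w j else 1) •
      pref (Function.update M k (M' k)) r =
    Z * pref M r - (∏ j ∈ Finset.range r, w j) • (pref M r * Z) := by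
  induction r with
  | zero => simp [pref]
  | succ r ih =>
    rw [Finset.sum_range_succ]
    have e1 : ∑ k ∈ Finset.range r, (∏ j ∈ Finset.range (r + 1), if j < k then w j else 1) •
        pref (Function.update M k (M' k)) (r + 1) =
        ((∑ k ∈ Finset.range r, (∏ j ∈ Finset.range r, if j < k then w j else 1) •
      pref (Function.update M k (M' k)) r) * M r) := by
      rw [Finset.sum_mul]
      refine Finset.sum_congr rfl fun k hk => ?_
      have hk := Finset.mem_range.1 hk
      rw [Finset.prod_range_succ, if_neg (by omega), pref, Function.update_of_ne (by omega),
        smul_mul_assoc, mul_one]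
    have e2 : (∏ j ∈ Finset.range (r + 1), if j < r then w j else 1) =
        ∏ j ∈ Finset.range r, w j := by
      rw [Finset.prod_range_succ, if_neg (by omega), mul_one]
      exact Finset.prod_congr rfl fun j hj => if_pos (Finset.mem_range.1 hj)
    have e3 : pref (Function.update M r (M' r)) r = pref M r :=
      pref_congr fun k hk => Function.update_of_ne (by omega) _ _
    rw [e1, ih, e2, pref, e3, Function.update_self, ← h r, pref, Finset.prod_range_succ]
    simp only [mul_sub, sub_mul, smul_sub, mul_assoc, smul_mul_assoc, mul_smul_comm, smul_smul]
    abel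

/-- bihomogeneity -/
def Hom (M : Mt) (a b : ℕ) : Prop :=
  (a ≠ b → M 0 0 = 0 ∧ M 1 1 = 0) ∧ (a ≠ b + 1 → M 0 1 = 0) ∧ (b ≠ a + 1 → M 1 0 = 0)

lemma Hom.mul {M N : Mt} {a b c d : ℕ} (h : Hom M a b) (h' : Hom N c d) :
    Hom (M * N) (a + c) (b + d) := by
  obtain ⟨h1, h2, h3⟩ := h
  obtain ⟨g1, g2, g3⟩ := h'
  have aux : ∀ (P Q : Prop) (u v : ℝ), (¬ P → u = 0) → (¬ Q → v = 0) → ¬ (P ∧ Q) → u * v = 0 := by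
    intro P Q u v hu hv hn
    by_cases hP : P
    · rw [hv fun q => hn ⟨hP, q⟩, mul_zero]
    · rw [hu hP, zero_mul]
  refine ⟨fun hh => ⟨?_, ?_⟩, fun hh => ?_, fun hh => ?_⟩ <;>
    simp only [Matrix.mul_apply, Fin.sum_univ_two] 
  · rw [aux _ _ _ _ (fun h => (h1 h).1) (fun h => (g1 h).1) (by omega),
      aux _ _ _ _ h2 g3 (by omega), add_zero]
  · rw [aux _ _ _ _ (fun h => (h1 h).2) (fun h => (g1 h).2) (by omega),
      aux _ _ _ _ h3 g2 (by omega), add_zero]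
  · rw [aux _ _ _ _ (fun h => (h1 h).1) g2 (by omega),
      aux _ _ _ _ h2 (fun h => (g1 h).2) (by omega), add_zero]
  · rw [aux _ _ _ _ (fun h => (h1 h).2) g3 (by omega),
      aux _ _ _ _ h3 (fun h => (g1 h).1) (by omega), add_zero]

lemma Mb_hom (x : ℝ) (lo c : ℕ) : Hom (Mb x lo c) (cA lo c) (cB lo c) := by
  unfold Hom cA cB
  obtain ⟨k, rfl | rfl⟩ : ∃ k, c = 2 * k ∨ c = 2 * k + 1 := ⟨c / 2, by omega⟩
  · rw [Mb_even]
    by_cases h : lo % 2 = 0 <;> simp [h] <;> omega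
  · rw [Mb_odd]
    by_cases h : lo % 2 = 0 <;> simp [h] <;> omega

lemma pref_hom (x : ℝ) (lo c : ℕ → ℕ) (r : ℕ) : Hom (pref (fun k => Mb x (lo k) (c k)) r)
    (∑ k ∈ Finset.range r, cA (lo k) (c k)) (∑ k ∈ Finset.range r, cB (lo k) (c k)) := by
  induction r with
  | zero => simp [pref, Hom]
  | succ r ih =>
    rw [Finset.sum_range_succ, Finset.sum_range_succ]
    exact ih.mul (Mb_hom _ _ _)

/-- the product `∏_{i=1}^n (1 + (-1)^{i-1} x^{⌊i/2⌋})` -/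
def En (x : ℝ) (n : ℕ) : ℝ := ∏ i ∈ Finset.range n, (1 + (-1) ^ i * x ^ ((i + 1) / 2))

/-- the evaluation functional in degree `n` -/
noncomputable def phi (x : ℝ) (n : ℕ) (M : Mt) : ℝ :=
  En x n * (if n % 2 = 0 then dd x (n / 2) / (1 + x ^ (n / 2)) * (M 0 0 + M 1 1)
    else dd x (n / 2) * (M 0 1 + M 1 0))

lemma phi_add (x : ℝ) (n : ℕ) (M N : Mt) : phi x n (M + N) = phi x n M + phi x n N := by
  unfold phi; split_ifs <;> simp <;> ring

lemma phi_smul (x : ℝ) (n : ℕ) (a : ℝ) (M : Mt) : phi x n (a • M) = a * phi x n M := by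
  unfold phi; split_ifs <;> simp <;> ring

lemma phi_zero (x : ℝ) (n : ℕ) : phi x n 0 = 0 := by
  unfold phi; split_ifs <;> simp

lemma phi_rec {x : ℝ} (hx : 1 < x) (n a b : ℕ) (hn : a + b = n + 1) (M : Mt) (h : Hom M a b) :
    phi x (n + 1) M =
      phi x n (M * Zm 0 - ((-1) ^ (a + b) * x ^ b) • (Zm 0 * M)) +
      phi x n (M * Zm 1 - ((-1) ^ (a + b) * x ^ a) • (Zm 1 * M)) +
      (-((-1) ^ (a + b) * x ^ b) * phi x n (Zm 0 * M - ((-1) ^ (a + b) * x ^ b) • (M * Zm 0)) +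
      -((-1) ^ (a + b) * x ^ a) * phi x n (Zm 1 * M - ((-1) ^ (a + b) * x ^ a) • (M * Zm 1))) := by
  obtain ⟨h1, h2, h3⟩ := h
  have hpos : ∀ k : ℕ, 1 + x ^ k ≠ 0 := fun k => by positivity
  obtain ⟨k, rfl | rfl⟩ : ∃ k, n = 2 * k ∨ n = 2 * k + 1 := ⟨n / 2, by omega⟩
  · rw [hn]
    unfold phi
    rw [if_neg (by omega), if_pos (by omega), if_pos (by omega), if_pos (by omega),
      if_pos (by omega), show (2 * k + 1) / 2 = k by omega, show 2 * k / 2 = k by omega,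
      show En x (2 * k + 1) = En x (2 * k) * (1 + x ^ k) by
        unfold En; rw [Finset.prod_range_succ, show (2 * k + 1) / 2 = k by omega]; simp]
    have := hpos k
    simp only [Matrix.mul_apply, Fin.sum_univ_two, Matrix.sub_apply, Matrix.smul_apply]
    simp [Zm, pow_succ, pow_mul]
    field_simp
    by_cases ha : a = k + 1
    · obtain rfl : b = k := by omega
      rw [h3 (by omega)]
      subst ha
      ring
    · by_cases hb : b = k + 1
      · obtain rfl : a = k := by omega
        rw [h2 (by omega)]
        subst hb
        ring
      · rw [h3 (by omega), h2 (by omega)]; simp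
  · rw [hn]
    unfold phi
    rw [if_pos (by omega), if_neg (by omega), if_neg (by omega), if_neg (by omega),
      if_neg (by omega), show (2 * k + 1 + 1) / 2 = k + 1 by omega,
      show (2 * k + 1) / 2 = k by omega,
      show En x (2 * k + 1 + 1) = En x (2 * k + 1) * (1 - x ^ (k + 1)) by
        unfold En; rw [Finset.prod_range_succ, show (2 * k + 1 + 1) / 2 = k + 1 by omega]
        simp [pow_succ, pow_mul]; left; ring, dd_succ,
      show (1 - x ^ (2 * (k + 1))) = (1 - x ^ (k + 1)) * (1 + x ^ (k + 1)) by ring]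
    have := hpos (k + 1)
    by_cases ha : a = k + 1
    · obtain rfl : b = k + 1 := by omega
      subst ha
      simp only [Matrix.mul_apply, Fin.sum_univ_two, Matrix.sub_apply, Matrix.smul_apply]
      simp [Zm]
      rw [show (-1 : ℝ) ^ (2 * k + 1 + 1) = 1 by simp [pow_succ, pow_mul]]
      field_simp
      ring
    · have := h1 (by omega)
      simp only [Matrix.mul_apply, Fin.sum_univ_two, Matrix.sub_apply, Matrix.smul_apply]
      simp [Zm, this]
/-- the set of positions covered by the blocks -/
def Bset (lo c : ℕ → ℕ) (r : ℕ) : Finset ℕ :=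
  (Finset.range r).biUnion fun k => Finset.Ico (lo k) (lo k + c k)

/-- compatibility of blocks with the link relation -/
def Good (lk : ℕ → ℕ → Bool) (r : ℕ) (lo c : ℕ → ℕ) : Prop :=
  (∀ k < r, ∀ q q', lo k ≤ q → q < q' → q' < lo k + c k → lk q q' = true) ∧
  (∀ j k, j < k → k < r → ∀ q q', lo j ≤ q → q < lo j + c j → lo k ≤ q' → q' < lo k + c k →
    q < q' ∧ lk q q' = false)

lemma Good.shrink {lk : ℕ → ℕ → Bool} {r : ℕ} {lo c lo' c' : ℕ → ℕ} (h : Good lk r lo c)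
    (h' : ∀ k q, lo' k ≤ q → q < lo' k + c' k → lo k ≤ q ∧ q < lo k + c k) :
    Good lk r lo' c' := by
  refine ⟨fun k hk q q' h1 h2 h3 => ?_, fun j k hj hk q q' h1 h2 h3 h4 => ?_⟩
  · exact h.1 k hk q q' (h' k q h1 (by omega)).1 h2 (h' k q' (by omega) h3).2
  · exact h.2 j k hj hk q q' (h' j q h1 h2).1 (h' j q h1 h2).2 (h' k q' h3 h4).1 (h' k q' h3 h4).2

lemma mem_Bset {lo c : ℕ → ℕ} {r q : ℕ} :
    q ∈ Bset lo c r ↔ ∃ k < r, lo k ≤ q ∧ q < lo k + c k := by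
  simp [Bset]

lemma Good.disj {lk : ℕ → ℕ → Bool} {r : ℕ} {lo c : ℕ → ℕ} (h : Good lk r lo c) :
    ((Finset.range r : Finset ℕ) : Set ℕ).PairwiseDisjoint
      (fun k => Finset.Ico (lo k) (lo k + c k)) := by
  intro j hj k hk hjk
  simp only [coe_range, Set.mem_Iio] at hj hk
  rw [Function.onFun, Finset.disjoint_left]
  intro q h1 h2
  rw [Finset.mem_Ico] at h1 h2
  rcases lt_or_gt_of_ne hjk with hlt | hlt
  · exact lt_irrefl _ (h.2 j k hlt hk q q h1.1 h1.2 h2.1 h2.2).1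
  · exact lt_irrefl _ (h.2 k j hlt hj q q h2.1 h2.2 h1.1 h1.2).1

lemma Good.prod {lk : ℕ → ℕ → Bool} {r : ℕ} {lo c : ℕ → ℕ} (h : Good lk r lo c) (f : ℕ → ℝ) :
    ∏ q ∈ Bset lo c r, f q = ∏ k ∈ Finset.range r, ∏ q ∈ Finset.Ico (lo k) (lo k + c k), f q :=
  Finset.prod_biUnion h.disj

lemma Good.sum {lk : ℕ → ℕ → Bool} {r : ℕ} {lo c : ℕ → ℕ} (h : Good lk r lo c) (f : ℕ → ℝ) :
    ∑ q ∈ Bset lo c r, f q = ∑ k ∈ Finset.range r, ∑ q ∈ Finset.Ico (lo k) (lo k + c k), f q :=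
  Finset.sum_biUnion h.disj

lemma yy_mod (x : ℝ) (p q : ℕ) : yy x (p % 2) q = yy x p q := by simp [yy]

lemma yy_comm (x : ℝ) (p q : ℕ) : yy x p q = yy x q p := by simp [yy, eq_comm]

lemma w1_last {x : ℝ} {lk : ℕ → ℕ → Bool} {r : ℕ} {lo c : ℕ → ℕ} (h : Good lk r lo c) {k : ℕ}
    (hk : k < r) (hc : 0 < c k) : w1 x lk (Bset lo c r) (lo k + c k - 1) =
      ∏ j ∈ Finset.range r, if k < j then tw x ((lo k + c k - 1) % 2) (lo j) (c j) else 1 := by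
  unfold w1
  rw [h.prod]
  refine Finset.prod_congr rfl fun j hj => ?_
  have hj := Finset.mem_range.1 hj
  split_ifs with hkj
  · unfold tw
    refine Finset.prod_congr rfl fun q hq => ?_
    rw [Finset.mem_Ico] at hq
    have := h.2 k j hkj hj (lo k + c k - 1) q (by omega) (by omega) hq.1 hq.2
    rw [if_pos this.1, k1, this.2, yy_mod]; simp
  · refine Finset.prod_eq_one fun q hq => ?_
    rw [Finset.mem_Ico] at hq
    rcases Nat.lt_or_ge j k with hlt | hge
    · have := (h.2 j k hlt hk q (lo k + c k - 1) hq.1 hq.2 (by omega) (by omega)).1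
      rw [if_neg (by omega)]
    · obtain rfl : j = k := by omega
      rw [if_neg (by omega)]

lemma w1_zero {x : ℝ} {lk : ℕ → ℕ → Bool} {r : ℕ} {lo c : ℕ → ℕ} (h : Good lk r lo c) {k q : ℕ}
    (hk : k < r) (h1 : lo k ≤ q) (h2 : q < lo k + c k) (h3 : q ≠ lo k + c k - 1) :
    w1 x lk (Bset lo c r) q = 0 := by
  unfold w1
  refine Finset.prod_eq_zero (i := q + 1) (mem_Bset.2 ⟨k, hk, by omega, by omega⟩) ?_
  rw [if_pos (by omega), k1, h.1 k hk q (q + 1) h1 (by omega) (by omega)]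
  simp

lemma w2_zero {x : ℝ} {lk : ℕ → ℕ → Bool} {r : ℕ} {lo c : ℕ → ℕ} (h : Good lk r lo c) {k q : ℕ}
    (hk : k < r) (h1 : lo k ≤ q) (h2 : q < lo k + c k) (h3 : q ≠ lo k) :
    w2 x lk (Bset lo c r) q = 0 := by
  unfold w2
  refine Finset.prod_eq_zero (i := q - 1) (mem_Bset.2 ⟨k, hk, by omega, by omega⟩) ?_
  rw [if_pos (by omega), k2, h.1 k hk (q - 1) q (by omega) (by omega) (by omega)]
  simp

lemma w2_first {x : ℝ} {lk : ℕ → ℕ → Bool} {r : ℕ} {lo c : ℕ → ℕ} (h : Good lk r lo c) {k : ℕ}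
    (hk : k < r) (hc : 0 < c k) : w2 x lk (Bset lo c r) (lo k) =
      -(∏ j ∈ Finset.range r, tw x (lo k % 2) (lo j) (c j)) *
      ∏ j ∈ Finset.range r, if j < k then tw x (lo k % 2) (lo j) (c j) else 1 := by
  have hmem : lo k ∈ Bset lo c r := mem_Bset.2 ⟨k, hk, le_refl _, by omega⟩
  have e1 : ∏ j ∈ Finset.range r, tw x (lo k % 2) (lo j) (c j) =
      ∏ q ∈ Bset lo c r, -(yy x (lo k) q) := by
    rw [h.prod]
    simp only [tw, yy_mod]
  have e2 : (∏ j ∈ Finset.range r, if j < k then tw x (lo k % 2) (lo j) (c j) else 1) =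
      ∏ q ∈ Bset lo c r, if q < lo k then -(yy x (lo k) q) else 1 := by
    rw [h.prod]
    refine Finset.prod_congr rfl fun j hj => ?_
    have hj := Finset.mem_range.1 hj
    split_ifs with hjk
    · unfold tw
      refine Finset.prod_congr rfl fun q hq => ?_
      rw [Finset.mem_Ico] at hq
      have := h.2 j k hjk hk q (lo k) hq.1 hq.2 (by omega) (by omega)
      rw [if_pos this.1, yy_mod]
    · refine (Finset.prod_eq_one fun q hq => ?_).symm
      rw [Finset.mem_Ico] at hq
      rcases Nat.lt_or_ge k j with hlt | hge
      · have := (h.2 k j hlt hj (lo k) q (by omega) (by omega) hq.1 hq.2).1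
        rw [if_neg (by omega)]
      · obtain rfl : j = k := by omega
        rw [if_neg (by omega)]
  rw [e1, e2, neg_mul, ← Finset.prod_mul_distrib]
  unfold w2
  rw [← Finset.mul_prod_erase _ _ hmem, ← Finset.mul_prod_erase _ _ hmem]
  have e3 : yy x (lo k) (lo k) = 1 := by simp [yy]
  simp only [lt_irrefl, if_false, e3, one_mul, mul_one, neg_mul, neg_neg]
  refine Finset.prod_congr rfl fun q hq => ?_
  obtain ⟨hne, hq⟩ := Finset.mem_erase.1 hq
  obtain ⟨j, hj, hq1, hq2⟩ := mem_Bset.1 hq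
  rcases lt_or_gt_of_ne hne with hlt | hgt
  · rw [if_pos hlt, if_pos hlt]
    have hjk : j < k := by
      by_contra hcon
      rcases Nat.lt_or_ge k j with hlt' | hge
      · have := (h.2 k j hlt' hj (lo k) q (by omega) (by omega) hq1 hq2).1
        omega
      · obtain rfl : j = k := by omega
        omega
    rw [k2, (h.2 j k hjk hk q (lo k) hq1 hq2 (by omega) (by omega)).2, yy_comm]
    simp [sq]
  · rw [if_neg (by omega), if_pos hgt, if_neg (by omega), mul_one]

lemma Good.uniq {lk : ℕ → ℕ → Bool} {r : ℕ} {lo c : ℕ → ℕ} (h : Good lk r lo c) {j k q : ℕ}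
    (hj : j < r) (hk : k < r) (h1 : lo j ≤ q) (h2 : q < lo j + c j) (h3 : lo k ≤ q)
    (h4 : q < lo k + c k) : j = k := by
  by_contra hjk
  rcases lt_or_gt_of_ne hjk with hlt | hlt
  · exact lt_irrefl _ (h.2 j k hlt hk q q h1 h2 h3 h4).1
  · exact lt_irrefl _ (h.2 k j hlt hj q q h3 h4 h1 h2).1

lemma erase_last {lk : ℕ → ℕ → Bool} {r : ℕ} {lo c : ℕ → ℕ} (h : Good lk r lo c) {k : ℕ}
    (hk : k < r) (hc : 0 < c k) : (Bset lo c r).erase (lo k + c k - 1) =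
      Bset lo (Function.update c k (c k - 1)) r := by
  ext q
  rw [Finset.mem_erase, mem_Bset, mem_Bset]
  constructor
  · rintro ⟨hne, j, hj, h1, h2⟩
    refine ⟨j, hj, h1, ?_⟩
    by_cases hjk : j = k
    · subst hjk; rw [Function.update_self]; omega
    · rw [Function.update_of_ne hjk]; exact h2
  · rintro ⟨j, hj, h1, h2⟩
    by_cases hjk : j = k
    · subst hjk; rw [Function.update_self] at h2
      exact ⟨by omega, j, hj, h1, by omega⟩
    · rw [Function.update_of_ne hjk] at h2
      refine ⟨?_, j, hj, h1, h2⟩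
      rintro rfl
      exact hjk (h.uniq hj hk h1 h2 (by omega) (by omega))

lemma erase_first {lk : ℕ → ℕ → Bool} {r : ℕ} {lo c : ℕ → ℕ} (h : Good lk r lo c) {k : ℕ}
    (hk : k < r) (hc : 0 < c k) : (Bset lo c r).erase (lo k) =
      Bset (Function.update lo k (lo k + 1)) (Function.update c k (c k - 1)) r := by
  ext q
  rw [Finset.mem_erase, mem_Bset, mem_Bset]
  constructor
  · rintro ⟨hne, j, hj, h1, h2⟩
    refine ⟨j, hj, ?_⟩
    by_cases hjk : j = k
    · subst hjk; rw [Function.update_self, Function.update_self]; omega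
    · rw [Function.update_of_ne hjk, Function.update_of_ne hjk]; exact ⟨h1, h2⟩
  · rintro ⟨j, hj, h1, h2⟩
    by_cases hjk : j = k
    · subst hjk; rw [Function.update_self] at h1 h2; rw [Function.update_self] at h2
      exact ⟨by omega, j, hj, by omega, by omega⟩
    · rw [Function.update_of_ne hjk] at h1 h2; rw [Function.update_of_ne hjk] at h2
      refine ⟨?_, j, hj, h1, h2⟩
      rintro rfl
      exact hjk (h.uniq hj hk h1 h2 (by omega) (by omega))

lemma pref_zero (M : ℕ → Mt) {k r : ℕ} (hk : k < r) (h : M k = 0) : pref M r = 0 := by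
  induction r with
  | zero => omega
  | succ r ih =>
    rw [pref]
    by_cases hkr : k = r
    · subst hkr; rw [h, mul_zero]
    · rw [ih (by omega), zero_mul]

lemma phi_sum (x : ℝ) (n r : ℕ) (w : ℕ → ℝ) (M : ℕ → Mt) :
    ∑ k ∈ Finset.range r, w k * phi x n (M k) = phi x n (∑ k ∈ Finset.range r, w k • M k) := by
  induction r with
  | zero => simp [phi_zero]
  | succ r ih => rw [Finset.sum_range_succ, Finset.sum_range_succ, phi_add, phi_smul, ih]

lemma sum_update {r k : ℕ} (hk : k < r) (c : ℕ → ℕ) (hc : 0 < c k) {n : ℕ}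
    (h : ∑ j ∈ Finset.range r, c j = n + 1) :
    ∑ j ∈ Finset.range r, Function.update c k (c k - 1) j = n := by
  have hm := Finset.mem_range.2 hk
  rw [Finset.sum_update_of_mem hm]
  rw [← Finset.add_sum_erase _ _ hm, Finset.erase_eq] at h
  omega

lemma tw_prod_zero (x : ℝ) (lo c : ℕ → ℕ) (r : ℕ) : ∏ j ∈ Finset.range r, tw x 0 (lo j) (c j) =
    (-1) ^ ((∑ k ∈ Finset.range r, cA (lo k) (c k)) + ∑ k ∈ Finset.range r, cB (lo k) (c k)) *
      x ^ (∑ k ∈ Finset.range r, cB (lo k) (c k)) := by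
  simp only [tw_zero, Finset.prod_mul_distrib, Finset.prod_pow_eq_pow_sum,
    ← Finset.sum_add_distrib]
  congr 3
  funext k
  unfold cA cB; split_ifs <;> omega

lemma tw_prod_one (x : ℝ) (lo c : ℕ → ℕ) (r : ℕ) : ∏ j ∈ Finset.range r, tw x 1 (lo j) (c j) =
    (-1) ^ ((∑ k ∈ Finset.range r, cA (lo k) (c k)) + ∑ k ∈ Finset.range r, cB (lo k) (c k)) *
      x ^ (∑ k ∈ Finset.range r, cA (lo k) (c k)) := by
  simp only [tw_one, Finset.prod_mul_distrib, Finset.prod_pow_eq_pow_sum,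
    ← Finset.sum_add_distrib]
  congr 3
  funext k
  unfold cA cB; split_ifs <;> omega

theorem FT_block {x : ℝ} (hx : 1 < x) (lk : ℕ → ℕ → Bool) (r : ℕ) (n : ℕ) : ∀ (lo c : ℕ → ℕ),
    Good lk r lo c → ∑ k ∈ Finset.range r, c k = n →
    FT x 1 lk n (Bset lo c r) = phi x n (pref (fun k => Mb x (lo k) (c k)) r) := by
  induction n with
  | zero =>
    intro lo c h hs
    have : pref (fun k => Mb x (lo k) (c k)) r = 1 := by
      have h0 : ∀ k < r, Mb x (lo k) (c k) = (fun _ => (1 : Mt)) k := by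
        intro k hk
        rw [(Finset.sum_eq_zero_iff.1 hs) k (Finset.mem_range.2 hk)]
        ext i j
        fin_cases i <;> fin_cases j <;> simp [Mb, dd] <;> split_ifs <;> simp
      rw [pref_congr h0]
      clear h0 hs h
      induction r with
      | zero => rfl
      | succ r ih => rw [pref, ih, one_mul]
    rw [this]
    simp [FT, phi, En, dd]
  | succ n ih =>
    intro lo c h hs
    set M : ℕ → Mt := fun k => Mb x (lo k) (c k) with hM
    set L : ℕ → ℕ → Mt := fun t k =>
      if 0 < c k ∧ (lo k + c k - 1) % 2 = t then Mb x (lo k) (c k - 1) else 0 with hL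
    set R : ℕ → ℕ → Mt := fun t k =>
      if 0 < c k ∧ lo k % 2 = t then Mb x (lo k + 1) (c k - 1) else 0 with hR
    have key1 : ∀ k ∈ Finset.range r, ∑ q ∈ Finset.Ico (lo k) (lo k + c k),
        w1 x lk (Bset lo c r) q * FT x 1 lk n ((Bset lo c r).erase q) =
        (∏ j ∈ Finset.range r, if k < j then tw x 0 (lo j) (c j) else 1) *
          phi x n (pref (Function.update M k (L 0 k)) r) +
        (∏ j ∈ Finset.range r, if k < j then tw x 1 (lo j) (c j) else 1) *
          phi x n (pref (Function.update M k (L 1 k)) r) := by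
      intro k hk
      have hk := Finset.mem_range.1 hk
      have hz : ∀ t, L t k = 0 → phi x n (pref (Function.update M k (L t k)) r) = 0 := by
        intro t ht
        rw [pref_zero _ hk (by rw [Function.update_self, ht]), phi_zero]
      by_cases hc : 0 < c k
      · rw [Finset.sum_eq_single (lo k + c k - 1)]
        · rw [w1_last h hk hc, erase_last h hk hc, ih _ _ (h.shrink ?_) (sum_update hk c hc hs)]
          · have hMu : (fun j => Mb x (lo j) (Function.update c k (c k - 1) j)) =
                Function.update M k (Mb x (lo k) (c k - 1)) := by
              funext j
              by_cases hj : j = k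
              · subst hj; simp
              · simp [hM, hj]
            rw [hMu]
            rcases Nat.mod_two_eq_zero_or_one (lo k + c k - 1) with hp | hp
            · rw [hz 1 (if_neg (by omega)), show L 0 k = Mb x (lo k) (c k - 1) from if_pos ⟨hc, hp⟩,
                hp, mul_zero, add_zero]
            · rw [hz 0 (if_neg (by omega)), show L 1 k = Mb x (lo k) (c k - 1) from if_pos ⟨hc, hp⟩,
                hp, mul_zero, zero_add]
          · intro j q h1 h2
            by_cases hj : j = k
            · subst hj; rw [Function.update_self] at h2; omega
            · rw [Function.update_of_ne hj] at h2; omega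
        · intro q hq hne
          rw [Finset.mem_Ico] at hq
          rw [w1_zero h hk hq.1 hq.2 hne, zero_mul]
        · intro hq
          exact absurd (Finset.mem_Ico.2 ⟨by omega, by omega⟩) hq
      · rw [hz 0 (if_neg (by omega)), hz 1 (if_neg (by omega)), show c k = 0 by omega]
        simp
    have key2 : ∀ k ∈ Finset.range r, ∑ q ∈ Finset.Ico (lo k) (lo k + c k),
        w2 x lk (Bset lo c r) q * FT x 1 lk n ((Bset lo c r).erase q) =
        -(∏ j ∈ Finset.range r, tw x 0 (lo j) (c j)) *
        ((∏ j ∈ Finset.range r, if j < k then tw x 0 (lo j) (c j) else 1) *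
          phi x n (pref (Function.update M k (R 0 k)) r)) +
        -(∏ j ∈ Finset.range r, tw x 1 (lo j) (c j)) *
        ((∏ j ∈ Finset.range r, if j < k then tw x 1 (lo j) (c j) else 1) *
          phi x n (pref (Function.update M k (R 1 k)) r)) := by
      intro k hk
      have hk := Finset.mem_range.1 hk
      have hz : ∀ t, R t k = 0 → phi x n (pref (Function.update M k (R t k)) r) = 0 := by
        intro t ht
        rw [pref_zero _ hk (by rw [Function.update_self, ht]), phi_zero]
      by_cases hc : 0 < c k
      · rw [Finset.sum_eq_single (lo k)]
        · rw [w2_first h hk hc, erase_first h hk hc, ih _ _ (h.shrink ?_) (sum_update hk c hc hs)]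
          · have hMu : (fun j => Mb x (Function.update lo k (lo k + 1) j)
                  (Function.update c k (c k - 1) j)) =
                Function.update M k (Mb x (lo k + 1) (c k - 1)) := by
              funext j
              by_cases hj : j = k
              · subst hj; simp
              · simp [hM, hj]
            rw [hMu]
            rcases Nat.mod_two_eq_zero_or_one (lo k) with hp | hp
            · rw [hz 1 (if_neg (by omega)),
                show R 0 k = Mb x (lo k + 1) (c k - 1) from if_pos ⟨hc, hp⟩, hp]
              ring
            · rw [hz 0 (if_neg (by omega)),
                show R 1 k = Mb x (lo k + 1) (c k - 1) from if_pos ⟨hc, hp⟩, hp]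
              ring
          · intro j q h1 h2
            by_cases hj : j = k
            · subst hj; rw [Function.update_self] at h1 h2; rw [Function.update_self] at h2; omega
            · rw [Function.update_of_ne hj] at h1 h2; rw [Function.update_of_ne hj] at h2; omega
        · intro q hq hne
          rw [Finset.mem_Ico] at hq
          rw [w2_zero h hk hq.1 hq.2 hne, zero_mul]
        · intro hq
          exact absurd (Finset.mem_Ico.2 ⟨by omega, by omega⟩) hq
      · rw [hz 0 (if_neg (by omega)), hz 1 (if_neg (by omega)), show c k = 0 by omega]
        simp
    rw [FT]
    simp only [one_mul, add_mul, Finset.sum_add_distrib]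
    rw [h.sum, h.sum, Finset.sum_congr rfl key1, Finset.sum_congr rfl key2, Finset.sum_add_distrib,
      Finset.sum_add_distrib, ← Finset.mul_sum, ← Finset.mul_sum, phi_sum, phi_sum, phi_sum, phi_sum,
      leib1 M (L 0) (Zm 0) (fun j => tw x 0 (lo j) (c j)) r (fun k => block1 hx 0 _ _ (by omega)),
      leib1 M (L 1) (Zm 1) (fun j => tw x 1 (lo j) (c j)) r (fun k => block1 hx 1 _ _ (by omega)),
      leib2 M (R 0) (Zm 0) (fun j => tw x 0 (lo j) (c j)) r (fun k => block2 hx 0 _ _ (by omega)),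
      leib2 M (R 1) (Zm 1) (fun j => tw x 1 (lo j) (c j)) r (fun k => block2 hx 1 _ _ (by omega)),
      tw_prod_zero, tw_prod_one]
    refine (phi_rec hx n _ _ ?_ _ (pref_hom x lo c r)).symm
    rw [← Finset.sum_add_distrib, ← hs]
    refine Finset.sum_congr rfl fun k _ => ?_
    unfold cA cB; split_ifs <;> omega
lemma FT_neg (x : ℝ) (lk : ℕ → ℕ → Bool) (n : ℕ) :
    ∀ T : Finset ℕ, T.card = n + 1 → FT x (-1) lk (n + 1) T = 0 := by
  induction n with
  | zero =>
    intro T hT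
    obtain ⟨q, rfl⟩ := Finset.card_eq_one.1 hT
    simp [FT, w1, w2]
  | succ n ih =>
    intro T hT
    rw [FT]
    refine Finset.sum_eq_zero fun q hq => ?_
    rw [ih (T.erase q) (by rw [Finset.card_erase_of_mem hq]; omega), mul_zero]

/-- link relation attached to `I` -/
def lkI (I : Finset ℕ) (p q : ℕ) : Bool := decide (Finset.Icc (p + 1) q ⊆ I)

lemma sval_succ {n : ℕ} (σ : SP n) (i : Fin n) : sval σ (i.val + 1) = vv σ i := by
  unfold sval vv
  rw [dif_pos ⟨by omega, by omega⟩]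
  simp

lemma prod_Icc_fin (n : ℕ) (f : ℕ → ℝ) : ∏ i ∈ Finset.Icc 1 n, f i = ∏ i : Fin n, f (i.val + 1) := by
  rw [Fin.prod_univ_eq_prod_range (fun i => f (i + 1)) n, Finset.prod_bij (fun i _ => i - 1)]
  · intro i hi; simp at hi ⊢; omega
  · intro i hi j hj h; simp at hi hj; omega
  · intro i hi; exact ⟨i + 1, by simp at hi ⊢; omega, by simp⟩
  · intro i hi; simp at hi; congr 1; omega

lemma prod_pairs (n : ℕ) (g : ℕ → ℕ → ℝ) : ∏ p ∈ pairs n, g p.1 p.2 =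
    ∏ i : Fin n, ∏ j : Fin n, if i < j then g (i.val + 1) (j.val + 1) else 1 := by
  unfold pairs
  rw [Finset.prod_filter, Finset.prod_product, prod_Icc_fin]
  refine Finset.prod_congr rfl fun i _ => ?_
  rw [prod_Icc_fin]
  refine Finset.prod_congr rfl fun j _ => ?_
  simp only [add_lt_add_iff_right, Fin.val_fin_lt]

lemma prod_neg_filter {α : Type*} (s : Finset α) (x : ℝ) (A P : α → Prop) [DecidablePred A]
    [DecidablePred P] : ∏ p ∈ s, (if A p then -(if P p then 1 else x) else 1) =
      (-1) ^ (s.filter A).card * x ^ (s.filter fun p => A p ∧ ¬ P p).card := by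
  classical
  induction s using Finset.induction_on with
  | empty => simp
  | insert a s ha ih =>
    rw [Finset.prod_insert ha, ih, Finset.filter_insert, Finset.filter_insert]
    by_cases hA : A a <;> by_cases hP : P a <;> simp [hA, hP, ha, pow_succ] <;> ring

lemma vv_inj {n : ℕ} (σ : SP n) {i j : Fin n} (h : vv σ i = vv σ j) : i = j := by
  unfold vv at h
  apply σ.1.injective
  ext
  split_ifs at h <;> omega

lemma chain {n : ℕ} (σ : SP n) (I : Finset ℕ) (h0 : 0 ∉ I) (h : InQuot σ I) (p : ℕ) :
    ∀ d, (∀ i ∈ Finset.Icc p (p + d), i ∈ I) → sval σ p < sval σ (p + d + 1) := by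
  intro d
  have step : ∀ i ∈ I, sval σ i < sval σ (i + 1) := by
    intro i hi
    have := h i hi
    have h1 : i ≠ 0 := fun h => h0 (h ▸ hi)
    simpa [dval, h1] using this
  induction d with
  | zero => intro hd; exact step p (hd p (by simp))
  | succ d ih =>
    intro hd
    refine (ih fun i hi => hd i ?_).trans (step _ (hd _ ?_))
    · simp at hi ⊢; omega
    · simp; omega

lemma weight_eq {n : ℕ} (x : ℝ) (σ : SP n) (I : Finset ℕ) (hI : ∀ i ∈ I, 1 ≤ i ∧ i + 1 ≤ n) :
    ∏ i : Fin n, ∏ j : Fin n,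
      (if i < j then kern x (lkI I) i.val j.val (vv σ i) (vv σ j) else 1) =
    if InQuot σ I then (-1) ^ ellD σ * x ^ LD σ else 0 := by
  have h0 : 0 ∉ I := fun h => by have := hI 0 h; omega
  have e1 : ∏ i : Fin n, ∏ j : Fin n,
      (if i < j then kern x (lkI I) i.val j.val (vv σ i) (vv σ j) else 1) =
      ∏ p ∈ pairs n, kern x (lkI I) (p.1 - 1) (p.2 - 1) (sval σ p.1) (sval σ p.2) := by
    rw [prod_pairs n (fun p q => kern x (lkI I) (p - 1) (q - 1) (sval σ p) (sval σ q))]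
    simp only [sval_succ, Nat.add_sub_cancel]
  have e2 : ∀ p ∈ pairs n, kern x (lkI I) (p.1 - 1) (p.2 - 1) (sval σ p.1) (sval σ p.2) =
      (if lkI I (p.1 - 1) (p.2 - 1) = true ∧ sval σ p.2 < sval σ p.1 then 0 else 1) *
      (if sval σ p.2 < sval σ p.1 then -(if p.1 % 2 = p.2 % 2 then 1 else x) else 1) *
      (if sval σ p.1 + sval σ p.2 < 0 then -(if p.1 % 2 = p.2 % 2 then 1 else x) else 1) := by
    intro p hp
    have : yy x (p.1 - 1) (p.2 - 1) = if p.1 % 2 = p.2 % 2 then 1 else x := by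
      unfold yy
      simp only [pairs, Finset.mem_filter, Finset.mem_product, Finset.mem_Icc] at hp
      congr 1
      apply propext
      omega
    rw [kern, this]
  rw [e1, Finset.prod_congr rfl e2, Finset.prod_mul_distrib, Finset.prod_mul_distrib,
    prod_neg_filter, prod_neg_filter]
  have e3 : ∏ p ∈ pairs n, (if lkI I (p.1 - 1) (p.2 - 1) = true ∧ sval σ p.2 < sval σ p.1
      then (0 : ℝ) else 1) = if InQuot σ I then 1 else 0 := by
    split_ifs with h
    · refine Finset.prod_eq_one fun p hp => ?_
      simp only [pairs, Finset.mem_filter, Finset.mem_product, Finset.mem_Icc] at hp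
      refine if_neg ?_
      rintro ⟨h1, h2⟩
      simp only [lkI, decide_eq_true_eq] at h1
      have := chain σ I h0 h p.1 (p.2 - p.1 - 1) fun i hi => h1 (by simp at hi ⊢; omega)
      rw [show p.1 + (p.2 - p.1 - 1) + 1 = p.2 by omega] at this
      omega
    · unfold InQuot at h
      push Not at h
      obtain ⟨i, hi, h2⟩ := h
      have hb := hI i hi
      have h3 : sval σ (i + 1) ≤ sval σ i := by
        simpa [dval, show i ≠ 0 by omega] using h2
      have h4 : sval σ (i + 1) ≠ sval σ i := by
        intro h
        have h5 := sval_succ σ ⟨i, by omega⟩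
        have h6 := sval_succ σ ⟨i - 1, by omega⟩
        simp only [show i - 1 + 1 = i by omega] at h5 h6
        rw [h5, h6] at h
        have := vv_inj σ h
        simp at this
        omega
      refine Finset.prod_eq_zero (i := (i, i + 1)) ?_ (if_pos ⟨?_, ?_⟩)
      · simp [pairs]; omega
      · simp only [lkI, decide_eq_true_eq]
        intro j hj
        simp at hj
        rwa [show j = i by omega]
      · show sval σ (i + 1) < sval σ i
        omega
  rw [e3]
  unfold ellD LD invSP nspSP oinvSP onspSP
  split_ifs
  · simp only [ne_eq]; ring
  · ring

lemma genD_eval (n : ℕ) (I : Finset ℕ) (hI : ∀ i ∈ I, 1 ≤ i ∧ i + 1 ≤ n) (x : ℝ) (hn : 0 < n) :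
    2 * ((genD n I).map (Int.castRingHom ℝ)).eval x =
      FT x 1 (lkI I) n (Finset.range n) := by
  have himg : (Finset.univ : Finset (Fin n)).image Fin.val = Finset.range n := by
    ext i; simp [Fin.exists_iff]
  have h1 := Fsum_eq x 1 (lkI I) n Fin.val Fin.val_strictMono
  have h2 := Fsum_eq x (-1) (lkI I) n Fin.val Fin.val_strictMono
  rw [himg] at h1 h2
  have h3 : FT x (-1) (lkI I) n (Finset.range n) = 0 := by
    obtain ⟨k, rfl⟩ : ∃ k, n = k + 1 := ⟨n - 1, by omega⟩
    exact FT_neg x _ k _ (by simp)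
  rw [h3] at h2
  rw [← h1, ← add_zero (Fsum x 1 _ _ _), ← h2]
  unfold Fsum genD
  simp only [weight_eq x _ I hI]
  rw [← Finset.sum_add_distrib, Finset.sum_filter, Polynomial.map_sum, Polynomial.eval_finsetSum,
    Finset.mul_sum]
  refine Finset.sum_congr rfl fun σ _ => ?_
  have hs : ∏ i : Fin n, (if σ.2 i = true then (-1 : ℝ) else 1) =
      (-1) ^ (Finset.univ.filter (fun i => σ.2 i = true)).card := by
    rw [← Finset.prod_filter, Finset.prod_const]
  rw [hs]
  by_cases hE : IsEvenSP σ
  · have hE2 := hE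
    unfold IsEvenSP at hE2
    rw [hE2.neg_one_pow]
    by_cases hq : InQuot σ I <;> simp [hE, hq]
    ring
  · have hE2 := hE
    unfold IsEvenSP at hE2
    rw [(Nat.not_even_iff_odd.1 hE2).neg_one_pow]
    by_cases hq : InQuot σ I <;> simp [hE, hq]
lemma ex_not_mem (I : Finset ℕ) (k : ℕ) : ∃ i, k ≤ i ∧ i ∉ I := by
  refine ⟨k + I.sup id + 1, by omega, fun h => ?_⟩
  have := Finset.le_sup (f := id) h
  simp only [id] at this
  omega

/-- first element at least `k` outside `I` -/
def ee (I : Finset ℕ) (k : ℕ) : ℕ := Nat.find (ex_not_mem I k)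

lemma ee_le (I : Finset ℕ) (k : ℕ) : k ≤ ee I k := (Nat.find_spec (ex_not_mem I k)).1

lemma ee_not (I : Finset ℕ) (k : ℕ) : ee I k ∉ I := (Nat.find_spec (ex_not_mem I k)).2

lemma ee_min {I : Finset ℕ} {k i : ℕ} (h : k ≤ i) (hi : i ∉ I) : ee I k ≤ i :=
  Nat.find_min' (ex_not_mem I k) ⟨h, hi⟩

lemma ee_mem {I : Finset ℕ} {k i : ℕ} (h : k ≤ i) (hi : i < ee I k) : i ∈ I := by
  by_contra h1
  have := ee_min h h1
  omega

lemma ee_of_not {I : Finset ℕ} {k : ℕ} (h : k ∉ I) : ee I k = k :=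
  le_antisymm (ee_min le_rfl h) (ee_le I k)

lemma ee_of_mem {I : Finset ℕ} {k : ℕ} (h : k ∈ I) : ee I (k + 1) = ee I k := by
  refine le_antisymm (ee_min ?_ (ee_not I k)) (ee_min ?_ (ee_not I (k + 1)))
  · have h1 := ee_le I k
    have h2 : ee I k ≠ k := fun h' => ee_not I k (by rwa [h'])
    omega
  · have := ee_le I (k + 1)
    omega

/-- block sizes -/
def cc (I : Finset ℕ) (k : ℕ) : ℕ := if k ∈ I then 0 else ee I (k + 1) - k

lemma cc_good (I : Finset ℕ) (n : ℕ) : Good (lkI I) n (fun k => k) (cc I) := by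
  refine ⟨fun k hk q q' h1 h2 h3 => ?_, fun j k hj hk q q' h1 h2 h3 h4 => ?_⟩
  · simp only [lkI, decide_eq_true_eq]
    simp only at h1 h3
    intro i hi
    rw [Finset.mem_Icc] at hi
    unfold cc at h3
    split_ifs at h3 with hkI
    · omega
    · exact ee_mem (k := k + 1) (by omega) (by omega)
  · simp only at h1 h2 h3 h4
    unfold cc at h2 h4
    split_ifs at h2 with hjI
    · omega
    split_ifs at h4 with hkI
    · omega
    have h5 : ee I (j + 1) ≤ k := ee_min (by omega) hkI
    refine ⟨by omega, ?_⟩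
    simp only [lkI, decide_eq_false_iff_not]
    intro hs
    exact hkI (hs (by rw [Finset.mem_Icc]; omega))

lemma cc_sum (I : Finset ℕ) (h0 : 0 ∉ I) (k : ℕ) : ∑ j ∈ Finset.range k, cc I j = ee I k := by
  induction k with
  | zero => simp [ee_of_not h0]
  | succ k ih =>
    rw [Finset.sum_range_succ, ih]
    unfold cc
    split_ifs with h
    · rw [ee_of_mem h, add_zero]
    · have := ee_le I (k + 1)
      rw [ee_of_not h]
      omega

lemma cc_Bset (I : Finset ℕ) (h0 : 0 ∉ I) (n : ℕ) (hn : n ∉ I) :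
    Bset (fun k => k) (cc I) n = Finset.range n := by
  apply Finset.eq_of_subset_of_card_le
  · intro q hq
    obtain ⟨k, hk, h1, h2⟩ := mem_Bset.1 hq
    unfold cc at h2
    rw [Finset.mem_range]
    split_ifs at h2
    · omega
    · have : ee I (k + 1) ≤ n := ee_min (by omega) hn
      omega
  · unfold Bset
    rw [Finset.card_biUnion fun j hj k hk hjk => (cc_good I n).disj (by simpa using hj) (by simpa using hk) hjk]
    simp [cc_sum I h0, ee_of_not hn]

/-- normal form of the prefix products -/
noncomputable def Std (x : ℝ) (N m : ℕ) : Mt :=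
  if N % 2 = 1 then !![0, 1; 0, 0] else !![1, 0; 0, if N = 2 * m then x ^ m else 0]

lemma Std_mul (x : ℝ) (k m c : ℕ) (h : 2 * m ≤ k) :
    Std x k m * Mb x k c = (dd x (c / 2))⁻¹ • Std x (k + c) (m + c / 2) := by
  have z : (0 : Fin 2 → ℝ) = ![0, 0] := by ext i; fin_cases i <;> rfl
  obtain ⟨t, rfl | rfl⟩ : ∃ t, c = 2 * t ∨ c = 2 * t + 1 := ⟨c / 2, by omega⟩
  · rw [Mb_even, show 2 * t / 2 = t by omega, Matrix.mul_smul]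
    congr 1
    unfold Std
    by_cases hk : k % 2 = 0
    · have e : (k + 2 * t = 2 * (m + t)) ↔ k = 2 * m := by omega
      simp only [hk, if_pos, show (k + 2 * t) % 2 = 0 by omega, e]
      by_cases h2 : k = 2 * m <;> simp [h2, pow_add, z]
    · simp [show k % 2 = 1 by omega, show (k + 2 * t) % 2 = 1 by omega, z]
  · rw [Mb_odd, show (2 * t + 1) / 2 = t by omega, Matrix.mul_smul]
    congr 1
    unfold Std
    by_cases hk : k % 2 = 0
    · simp [hk, show (k + (2 * t + 1)) % 2 = 1 by omega, z]
    · have e : ¬ (k + (2 * t + 1) = 2 * (m + t)) := by omega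
      simp [show k % 2 = 1 by omega, show (k + (2 * t + 1)) % 2 = 0 by omega, e, z]

lemma Std_zero (x : ℝ) : Std x 0 0 = 1 := by
  simp [Std, Matrix.one_fin_two]

lemma Mb_zero (x : ℝ) (k : ℕ) : Mb x k 0 = 1 := by
  have := Mb_even x k 0
  rw [mul_zero] at this
  rw [this]
  simp [dd, Matrix.one_fin_two]

lemma pref_eval (x : ℝ) (I : Finset ℕ) (h0 : 0 ∉ I) (k : ℕ) :
    2 * (∑ j ∈ Finset.range k, cc I j / 2) ≤ ee I k ∧
    pref (fun k => Mb x k (cc I k)) k = (∏ j ∈ Finset.range k, dd x (cc I j / 2))⁻¹ •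
      Std x (ee I k) (∑ j ∈ Finset.range k, cc I j / 2) := by
  induction k with
  | zero => simp [ee_of_not h0, Std_zero, pref]
  | succ k ih =>
    obtain ⟨ih1, ih2⟩ := ih
    by_cases hk : k ∈ I
    · have hc : cc I k = 0 := by simp [cc, hk]
      rw [Finset.sum_range_succ, Finset.prod_range_succ, pref, ih2, hc, ee_of_mem hk, Mb_zero]
      simpa [dd] using ih1
    · have hc : ee I (k + 1) = k + cc I k := by
        have := ee_le I (k + 1)
        simp [cc, hk]
        omega
      rw [ee_of_not hk] at ih1 ih2
      rw [Finset.sum_range_succ, Finset.prod_range_succ, pref, ih2, hc]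
      refine ⟨by omega, ?_⟩
      rw [Matrix.smul_mul, Std_mul x k _ _ ih1, smul_smul, mul_inv]

lemma genD_phi (n : ℕ) (I : Finset ℕ) (hI : ∀ i ∈ I, 1 ≤ i ∧ i + 1 ≤ n) (x : ℝ) (hx : 1 < x)
    (hn : 0 < n) : 2 * ((genD n I).map (Int.castRingHom ℝ)).eval x =
      (∏ j ∈ Finset.range n, dd x (cc I j / 2))⁻¹ *
        phi x n (Std x n (∑ j ∈ Finset.range n, cc I j / 2)) ∧
      2 * (∑ j ∈ Finset.range n, cc I j / 2) ≤ n := by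
  have h0 : 0 ∉ I := fun h => by have := hI 0 h; omega
  have hn1 : n ∉ I := fun h => by have := hI n h; omega
  have hp := pref_eval x I h0 n
  rw [ee_of_not hn1] at hp
  refine ⟨?_, hp.1⟩
  rw [genD_eval n I hI x hn]
  have hb := cc_Bset I h0 n hn1
  nth_rewrite 1 [← hb]
  rw [FT_block hx (lkI I) n n _ _ (cc_good I n) (by rw [cc_sum I h0, ee_of_not hn1]), hp.2, phi_smul]

/-- factors of the product formula -/
def ff (x : ℝ) (i : ℕ) : ℝ := 1 + (-1) ^ (i - 1) * x ^ (i / 2)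

lemma En_eq (x : ℝ) (n : ℕ) : En x (n + 1) = 2 * ∏ i ∈ Finset.Icc 2 (n + 1), ff x i := by
  induction n with
  | zero => simp [En]; norm_num
  | succ n ih =>
    have : En x (n + 1 + 1) = En x (n + 1) * (1 + (-1) ^ (n + 1) * x ^ ((n + 1 + 1) / 2)) := by
      rw [En, Finset.prod_range_succ, En]
    rw [this, ih, Finset.prod_Icc_succ_top (b := n + 1) (by omega), ff]
    simp [mul_assoc]

lemma QQ_odd (x : ℝ) (m d : ℕ) :
    dd x m * ∏ i ∈ Finset.Icc (2 * m + 2) (2 * (m + d) + 1), ff x i = dd x (m + d) := by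
  induction d with
  | zero => simp
  | succ d ih =>
    rw [show 2 * (m + (d + 1)) + 1 = 2 * (m + d) + 1 + 1 + 1 by ring,
      Finset.prod_Icc_succ_top (by omega), Finset.prod_Icc_succ_top (by omega),
      ← mul_assoc, ← mul_assoc, ih, ← add_assoc, dd_succ]
    unfold ff
    rw [show 2 * (m + d) + 1 + 1 - 1 = 2 * (m + d) + 1 by omega,
      show 2 * (m + d) + 1 + 1 + 1 - 1 = 2 * (m + d + 1) by omega,
      show (2 * (m + d) + 1 + 1) / 2 = m + d + 1 by omega,
      show (2 * (m + d) + 1 + 1 + 1) / 2 = m + d + 1 by omega, pow_succ, pow_mul, pow_mul,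
      pow_mul' x]
    norm_num
    ring

lemma phi_Std {x : ℝ} (hx : 1 < x) (n m : ℕ) (h : 2 * m ≤ n) :
    phi x n (Std x n m) = En x n * dd x m * ∏ i ∈ Finset.Icc (2 * m + 2) n, ff x i := by
  unfold phi Std
  rw [mul_assoc]
  congr 1
  have hpos : ∀ k, (1 + x ^ k) ≠ 0 := fun k => by positivity
  obtain ⟨k, rfl | rfl⟩ : ∃ t, n = 2 * t ∨ n = 2 * t + 1 := ⟨n / 2, by omega⟩
  · obtain ⟨d, rfl⟩ : ∃ d, k = m + d := ⟨k - m, by omega⟩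
    have e := QQ_odd x m d
    rw [if_pos (by omega), if_neg (by omega), show 2 * (m + d) / 2 = m + d by omega]
    rcases d with _ | d
    · have := hpos m
      simp
      field_simp
    · rw [Finset.prod_Icc_succ_top (by omega)] at e
      have e2 : ff x (2 * (m + (d + 1)) + 1) = 1 + x ^ (m + (d + 1)) := by
        unfold ff
        rw [show 2 * (m + (d + 1)) + 1 - 1 = 2 * (m + (d + 1)) by omega,
          show (2 * (m + (d + 1)) + 1) / 2 = m + (d + 1) by omega, pow_mul]
        norm_num
      rw [e2] at e
      rw [if_neg (by omega), ← e]
      have := hpos (m + (d + 1))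
      simp
      field_simp
  · obtain ⟨d, rfl⟩ : ∃ d, k = m + d := ⟨k - m, by omega⟩
    rw [if_neg (by omega), if_pos (by omega), QQ_odd, show (2 * (m + d) + 1) / 2 = m + d by omega]
    simp

lemma comp_data (n s : ℕ) (a b : ℕ → ℕ) (I : Finset ℕ)
    (hab : ∀ k ∈ Finset.Icc 1 s, a k ≤ b k)
    (ha1 : ∀ k ∈ Finset.Icc 1 s, 1 ≤ a k)
    (hbn : ∀ k ∈ Finset.Icc 1 s, b k ≤ n - 1)
    (hsep : ∀ k ∈ Finset.Icc 1 (s - 1), b k + 1 < a (k + 1))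
    (hI : I = (Finset.Icc 1 s).biUnion (fun k => Finset.Icc (a k) (b k))) :
    ∃ A : Finset ℕ, A = (Finset.Icc 1 s).image (fun k => a k - 1) ∧ A ⊆ Finset.range n ∧
      Set.InjOn (fun k => a k - 1) (Finset.Icc 1 s : Finset ℕ) ∧
      (∀ k ∈ Finset.Icc 1 s, cc I (a k - 1) = b k - a k + 2) ∧
      ∀ j, j ∉ A → cc I j / 2 = 0 := by
  simp only [Finset.mem_Icc] at hab ha1 hbn hsep
  have hmem : ∀ i, i ∈ I ↔ ∃ k, (1 ≤ k ∧ k ≤ s) ∧ a k ≤ i ∧ i ≤ b k := by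
    intro i; rw [hI]; simp
  have sep : ∀ j d, 1 ≤ j → j + d + 1 ≤ s → b j + 1 < a (j + d + 1) := by
    intro j d hj
    induction d with
    | zero => intro h; exact hsep j ⟨hj, by omega⟩
    | succ d ih =>
      intro h
      have h1 := ih (by omega)
      have h2 := hsep (j + d + 1) ⟨by omega, by omega⟩
      have h3 := hab (j + d + 1) ⟨by omega, by omega⟩
      rw [show j + (d + 1) + 1 = j + d + 1 + 1 by ring]
      omega
  have sep2 : ∀ j k, 1 ≤ j → j < k → k ≤ s → b j + 1 < a k := by
    intro j k h1 h2 h3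
    have := sep j (k - j - 1) h1 (by omega)
    rwa [show j + (k - j - 1) + 1 = k by omega] at this
  have nota : ∀ k, 1 ≤ k → k ≤ s → a k - 1 ∉ I := by
    intro k h1 h2 h
    obtain ⟨j, hj, h3, h4⟩ := (hmem _).1 h
    have := ha1 k ⟨h1, h2⟩
    have := hab j hj
    have := hab k ⟨h1, h2⟩
    rcases lt_trichotomy j k with h5 | h5 | h5
    · have := sep2 j k hj.1 h5 h2; omega
    · subst h5; omega
    · have := sep2 k j h1 h5 hj.2; omega
  have notb : ∀ k, 1 ≤ k → k ≤ s → b k + 1 ∉ I := by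
    intro k h1 h2 h
    obtain ⟨j, hj, h3, h4⟩ := (hmem _).1 h
    have := hab j hj
    have := hab k ⟨h1, h2⟩
    rcases lt_trichotomy j k with h5 | h5 | h5
    · have := sep2 j k hj.1 h5 h2; omega
    · subst h5; omega
    · have := sep2 k j h1 h5 hj.2; omega
  refine ⟨_, rfl, ?_, ?_, ?_, ?_⟩
  · intro i hi
    simp only [Finset.mem_image, Finset.mem_Icc] at hi
    obtain ⟨k, hk, rfl⟩ := hi
    have := ha1 k hk
    have := hab k hk
    have := hbn k hk
    rw [Finset.mem_range]
    omega
  · intro j hj k hk h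
    simp only [Finset.coe_Icc, Set.mem_Icc] at hj hk h
    have := ha1 k hk
    have := hab k hk
    have := ha1 j hj
    have := hab j hj
    rcases lt_trichotomy j k with h5 | h5 | h5
    · have := sep2 j k hj.1 h5 hk.2; omega
    · exact h5
    · have := sep2 k j hk.1 h5 hj.2; omega
  · intro k hk
    rw [Finset.mem_Icc] at hk
    have h1 := ha1 k hk
    have h2 := hab k hk
    rw [cc, if_neg (nota k hk.1 hk.2), show a k - 1 + 1 = a k by omega]
    have h3 : ee I (a k) ≤ b k + 1 := ee_min (by omega) (notb k hk.1 hk.2)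
    have h4 : ¬ ee I (a k) < b k + 1 := fun h =>
      ee_not I (a k) ((hmem _).2 ⟨k, hk, ee_le I (a k), by omega⟩)
    omega
  · intro j hj
    unfold cc
    split_ifs with h
    · rfl
    · have h1 : j + 1 ∉ I := by
        intro h2
        obtain ⟨k, hk, h3, h4⟩ := (hmem _).1 h2
        have h5 : ¬ a k ≤ j := fun h5 => h ((hmem _).2 ⟨k, hk, h5, by omega⟩)
        apply hj
        simp only [Finset.mem_image, Finset.mem_Icc]
        exact ⟨k, hk, by omega⟩
      rw [ee_of_not h1]
      omega

lemma qfact_eval (x : ℝ) (k : ℕ) :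
    (1 - x ^ 2) ^ k * ((qfact (X ^ 2) k).map (Int.castRingHom ℝ)).eval x = dd x k := by
  induction k with
  | zero => simp [qfact, dd]
  | succ k ih =>
    have e : qfact (X ^ 2) (k + 1) = qfact (X ^ 2) k * ∑ j ∈ Finset.range (k + 1), (X ^ 2) ^ j := by
      unfold qfact
      rw [Finset.prod_Icc_succ_top (by omega)]
    have g : (1 - x ^ 2) * ∑ j ∈ Finset.range (k + 1), (x ^ 2) ^ j = 1 - x ^ (2 * (k + 1)) := by
      rw [mul_neg_geom_sum, pow_mul]
    rw [e, dd_succ, ← ih, ← g, Polynomial.map_mul, Polynomial.eval_mul, Polynomial.map_sum,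
      Polynomial.eval_finsetSum]
    simp only [Polynomial.map_pow, Polynomial.map_X, Polynomial.eval_pow, Polynomial.eval_X]
    ring

lemma prod_qfact_eval (x : ℝ) (s : Finset ℕ) (t : ℕ → ℕ) :
    (1 - x ^ 2) ^ (∑ k ∈ s, t k) *
      ((∏ k ∈ s, qfact (X ^ 2) (t k)).map (Int.castRingHom ℝ)).eval x = ∏ k ∈ s, dd x (t k) := by
  rw [Polynomial.map_prod, Polynomial.eval_prod, ← Finset.prod_pow_eq_pow_sum,
    ← Finset.prod_mul_distrib]
  exact Finset.prod_congr rfl fun k _ => qfact_eval x (t k)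

lemma ff_eval (x : ℝ) (u v : ℕ) :
    ((∏ i ∈ Finset.Icc u v, (1 + (-1 : Polynomial ℤ) ^ (i - 1) * X ^ (i / 2))).map
      (Int.castRingHom ℝ)).eval x = ∏ i ∈ Finset.Icc u v, ff x i := by
  rw [Polynomial.map_prod, Polynomial.eval_prod]
  refine Finset.prod_congr rfl fun i _ => ?_
  simp [ff]

lemma main_eval (n s : ℕ) (a b : ℕ → ℕ) (I : Finset ℕ)
    (hab : ∀ k ∈ Finset.Icc 1 s, a k ≤ b k)
    (ha1 : ∀ k ∈ Finset.Icc 1 s, 1 ≤ a k)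
    (hbn : ∀ k ∈ Finset.Icc 1 s, b k ≤ n - 1)
    (hsep : ∀ k ∈ Finset.Icc 1 (s - 1), b k + 1 < a (k + 1))
    (hI : I = (Finset.Icc 1 s).biUnion (fun k => Finset.Icc (a k) (b k)))
    (m : ℕ) (hm : m = ∑ k ∈ Finset.Icc 1 s, (b k - a k + 2) / 2) (hn : 0 < n)
    (x : ℝ) (hx : 1 < x) :
    (((∏ k ∈ Finset.Icc 1 s, qfact (X ^ 2) ((b k - a k + 2) / 2)) * genD n I).map
      (Int.castRingHom ℝ)).eval x =
      ((qfact (X ^ 2) m *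
        (∏ i ∈ Finset.Icc 2 n, (1 + (-1 : Polynomial ℤ) ^ (i - 1) * X ^ (i / 2))) *
        (∏ i ∈ Finset.Icc (2 * m + 2) n,
          (1 + (-1 : Polynomial ℤ) ^ (i - 1) * X ^ (i / 2)))).map (Int.castRingHom ℝ)).eval x := by
  obtain ⟨A, hA, hAn, hinj, hcA, hcn⟩ := comp_data n s a b I hab ha1 hbn hsep hI
  have hIb : ∀ i ∈ I, 1 ≤ i ∧ i + 1 ≤ n := by
    intro i hi
    rw [hI] at hi
    simp only [Finset.mem_biUnion, Finset.mem_Icc] at hi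
    obtain ⟨k, hk, h1, h2⟩ := hi
    have := ha1 k (Finset.mem_Icc.2 hk)
    have := hbn k (Finset.mem_Icc.2 hk)
    omega
  have hsum : ∑ j ∈ Finset.range n, cc I j / 2 = m := by
    rw [← Finset.sum_subset hAn fun j _ hj => hcn j hj, hA, Finset.sum_image hinj, hm]
    exact Finset.sum_congr rfl fun k hk => by rw [hcA k hk]
  have hprod : ∏ j ∈ Finset.range n, dd x (cc I j / 2) =
      ∏ k ∈ Finset.Icc 1 s, dd x ((b k - a k + 2) / 2) := by
    rw [← Finset.prod_subset hAn fun j _ hj => by rw [hcn j hj]; simp [dd], hA,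
      Finset.prod_image hinj]
    exact Finset.prod_congr rfl fun k hk => by rw [hcA k hk]
  obtain ⟨h1, h2⟩ := genD_phi n I hIb x hx hn
  rw [hsum] at h1 h2
  rw [hprod, phi_Std hx n m h2] at h1
  have hq := qfact_eval x m
  have hp := prod_qfact_eval x (Finset.Icc 1 s) (fun k => (b k - a k + 2) / 2)
  rw [← hm] at hp
  have hne : (1 - x ^ 2) ^ m ≠ 0 := pow_ne_zero _ (by nlinarith)
  have hdn : ∏ k ∈ Finset.Icc 1 s, dd x ((b k - a k + 2) / 2) ≠ 0 :=
    Finset.prod_ne_zero_iff.2 fun k _ => dd_ne hx _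
  obtain ⟨n', rfl⟩ : ∃ k, n = k + 1 := ⟨n - 1, by omega⟩
  rw [En_eq] at h1
  rw [Polynomial.map_mul, Polynomial.eval_mul, Polynomial.map_mul, Polynomial.eval_mul,
    Polynomial.map_mul, Polynomial.eval_mul, ff_eval, ff_eval]
  apply mul_left_cancel₀ hne
  rw [← mul_assoc, hp, ← mul_assoc, ← mul_assoc, hq]
  apply mul_left_cancel₀ (two_ne_zero (α := ℝ))
  rw [mul_left_comm, h1, mul_inv_cancel_left₀ hdn]
  ring

/-- Theorem (type `D`, `0 ∉ I`): for `I ⊆ [n-1]` with connected components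
`[a k, b k]` for `k ∈ [1,s]`, writing `m = Σ_k ⌊(|I_k|+1)/2⌋`,
`D_n^I(x) = C_I · ∏_{i=2}^{n}(1+(-1)^{i-1}x^{⌊i/2⌋}) · ∏_{i=2m+2}^{n}(1+(-1)^{i-1}x^{⌊i/2⌋})`,
where `C_I` is the `x²`-multinomial coefficient; the identity is stated multiplied
through by the `q`-factorials so that both sides are polynomials. -/
theorem stmt17 (n s : ℕ) (a b : ℕ → ℕ) (I : Finset ℕ)
    (hab : ∀ k ∈ Finset.Icc 1 s, a k ≤ b k)
    (ha1 : ∀ k ∈ Finset.Icc 1 s, 1 ≤ a k)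
    (hbn : ∀ k ∈ Finset.Icc 1 s, b k ≤ n - 1)
    (hsep : ∀ k ∈ Finset.Icc 1 (s - 1), b k + 1 < a (k + 1))
    (hI : I = (Finset.Icc 1 s).biUnion (fun k => Finset.Icc (a k) (b k)))
    (m : ℕ) (hm : m = ∑ k ∈ Finset.Icc 1 s, (b k - a k + 2) / 2) :
    (∏ k ∈ Finset.Icc 1 s, qfact (X ^ 2) ((b k - a k + 2) / 2)) * genD n I =
      qfact (X ^ 2) m *
        (∏ i ∈ Finset.Icc 2 n, (1 + (-1 : Polynomial ℤ) ^ (i - 1) * X ^ (i / 2))) *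
        (∏ i ∈ Finset.Icc (2 * m + 2) n,
          (1 + (-1 : Polynomial ℤ) ^ (i - 1) * X ^ (i / 2))) := by


  rcases Nat.eq_zero_or_pos n with hn | hn
  · subst hn
    have hs : s = 0 := by
      by_contra hs
      have h1 : (1 : ℕ) ∈ Finset.Icc 1 s := by rw [Finset.mem_Icc]; omega
      have := hab 1 h1
      have := ha1 1 h1
      have := hbn 1 h1
      omega
    subst hs
    have hI0 : I = ∅ := by simp [hI]
    have hm0 : m = 0 := by simp [hm]
    subst hI0 hm0
    simp [genD, qfact, InQuot, IsEvenSP, ellD, LD, invSP, nspSP, oinvSP, onspSP, pairs]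
  · apply Polynomial.map_injective (Int.castRingHom ℝ) Int.cast_injective
    apply Polynomial.eq_of_infinite_eval_eq
    refine Set.Infinite.mono ?_ (Set.Ioi_infinite (1 : ℝ))
    intro x hx
    exact main_eval n s a b I hab ha1 hbn hsep hI m hm hn x hx

end OddLength
end

section
/- Let n be even and I ⊆ {0,…,n-1} a proper subset containing 0 and all odd numbers in [n-1]. Write the connected component of I containing 0 as [0,a_0-1]. Then Σ_{σ ∈ D_n^I} (-1)^{ℓ(σ)} x^{L(σ)} = C_I · (1 + x^{a_0} + 2x^{n/2})/(1 + x^{n/2}) · ∏_{i=a_0+2}^{n} (1 + (-1)^{i-1} x^{⌊i/2⌋}), and in particular this polynomial is not a product of cyclotomic polynomials. -/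
open Polynomial Finset

namespace OddLength

/-- `f` is a product of cyclotomic polynomials `Φ_k` for positive integers `k`. -/
def IsCyclotomicProduct (f : Polynomial ℤ) : Prop :=
  ∃ s : Multiset ℕ, (∀ k ∈ s, 0 < k) ∧
    f = (s.map (fun k => Polynomial.cyclotomic k ℤ)).prod

/-- signed value at a position in `Fin n` -/
def fv {n : ℕ} (σ : SP n) (i : Fin n) : ℤ :=
  (if σ.2 i then (-1 : ℤ) else 1) * (((σ.1 i : Fin n) : ℕ) + 1 : ℤ)

lemma sval_eq {n : ℕ} (σ : SP n) (i : Fin n) : sval σ (i.1 + 1) = fv σ i := by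
  have h : 1 ≤ i.1 + 1 ∧ i.1 + 1 ≤ n := ⟨by omega, by omega⟩
  unfold sval fv
  rw [dif_pos h]
  rfl

lemma pairs_card (n : ℕ) (P : ℕ × ℕ → Prop) [DecidablePred P] :
    ((pairs n).filter P).card =
      ((univ : Finset (Fin n × Fin n)).filter
        (fun p => p.1 < p.2 ∧ P (p.1.1 + 1, p.2.1 + 1))).card := by
  symm
  apply Finset.card_bij (fun p _ => (p.1.1 + 1, p.2.1 + 1))
  · intro p hp
    simp only [mem_filter, mem_univ, true_and, pairs, mem_product, mem_Icc] at hp ⊢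
    have := hp.1
    refine ⟨⟨⟨⟨by omega, by omega⟩, ⟨by omega, by omega⟩⟩, ?_⟩, hp.2⟩
    have : p.1.1 < p.2.1 := hp.1
    omega
  · intro p _ p' _ h
    simp only [Prod.mk.injEq] at h
    exact Prod.ext (Fin.ext (by omega)) (Fin.ext (by omega))
  · rintro ⟨i, j⟩ hp
    simp only [mem_filter, pairs, mem_product, mem_Icc] at hp
    obtain ⟨⟨⟨⟨h1, h2⟩, h3, h4⟩, h5⟩, h6⟩ := hp
    refine ⟨(⟨i - 1, by omega⟩, ⟨j - 1, by omega⟩), ?_, ?_⟩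
    · simp only [mem_filter, mem_univ, true_and]
      have e1 : i - 1 + 1 = i := by omega
      have e2 : j - 1 + 1 = j := by omega
      rw [e1, e2]
      exact ⟨by simp [Fin.lt_def]; omega, h6⟩
    · simp only [Prod.mk.injEq]; omega

lemma card_pair_sum {n : ℕ} (P : Fin n → Fin n → Prop) [∀ i j, Decidable (P i j)] :
    ((univ : Finset (Fin n × Fin n)).filter (fun p => p.1 < p.2 ∧ P p.1 p.2)).card
      = ∑ i : Fin n, ∑ j ∈ Ioi i, if P i j then 1 else 0 := by
  rw [Finset.card_filter, Fintype.sum_prod_type]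
  refine Finset.sum_congr rfl fun i _ => ?_
  rw [← Finset.filter_lt_eq_Ioi, Finset.sum_filter]
  refine Finset.sum_congr rfl fun j _ => ?_
  by_cases h : i < j <;> simp [h]

lemma fv_abs {n : ℕ} (σ : SP n) (i : Fin n) :
    (σ.2 i = true ∧ fv σ i = -((σ.1 i : ℕ) + 1 : ℤ)) ∨
    (σ.2 i = false ∧ fv σ i = ((σ.1 i : ℕ) + 1 : ℤ)) := by
  unfold fv
  cases h : σ.2 i <;> simp

lemma neg_one_pow_ell {n : ℕ} (σ : SP n) :
    (-1 : Polynomial ℤ) ^ ellD σ = ((Equiv.Perm.sign σ.1 : ℤ) : Polynomial ℤ) := by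
  have e1 : ellD σ = ∑ i : Fin n, ∑ j ∈ Ioi i,
      ((if fv σ j < fv σ i then 1 else 0) + (if fv σ i + fv σ j < 0 then 1 else 0)) := by
    simp only [sum_add_distrib]
    unfold ellD invSP nspSP
    rw [pairs_card, pairs_card]
    simp only [sval_eq]
    rw [card_pair_sum (fun i j => fv σ j < fv σ i), card_pair_sum (fun i j => fv σ i + fv σ j < 0)]
  rw [e1, Equiv.Perm.sign_eq_prod_prod_Ioi, ← Finset.prod_pow_eq_pow_sum]
  push_cast
  refine Finset.prod_congr rfl fun i _ => ?_
  rw [← Finset.prod_pow_eq_pow_sum]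
  refine Finset.prod_congr rfl fun j hj => ?_
  have hij : i ≠ j := (mem_Ioi.1 hj).ne
  have hne : (σ.1 i).1 ≠ (σ.1 j).1 := fun h => hij (σ.1.injective (Fin.ext h))
  have hlt : (σ.1 i < σ.1 j) ↔ (σ.1 i).1 < (σ.1 j).1 := Iff.rfl
  rcases fv_abs σ i with ⟨_, h1⟩ | ⟨_, h1⟩ <;> rcases fv_abs σ j with ⟨_, h2⟩ | ⟨_, h2⟩ <;>
    rw [h1, h2] <;> by_cases hc : (σ.1 i).1 < (σ.1 j).1 <;> simp only [hlt, hc, if_true, if_false] <;>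
    split_ifs <;> first | (exfalso; omega) | simp

/-- odd inversions of a word -/
def oinvF {n : ℕ} {α : Type*} [LinearOrder α] (w : Fin n → α) : ℕ :=
  ((univ : Finset (Fin n × Fin n)).filter
    (fun p => p.1 < p.2 ∧ (w p.2 < w p.1 ∧ p.1.1 % 2 ≠ p.2.1 % 2))).card

/-- odd negative sum pairs of a word, ordered by parity -/
def onspF {n : ℕ} (w : Fin n → ℤ) : ℕ :=
  ((univ : Finset (Fin n × Fin n)).filter
    (fun p => p.1.1 % 2 = 0 ∧ p.2.1 % 2 = 1 ∧ w p.1 + w p.2 < 0)).card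

lemma onsp_aux {n : ℕ} (w : Fin n → ℤ) :
    ((univ : Finset (Fin n × Fin n)).filter
      (fun p => p.1 < p.2 ∧ (w p.1 + w p.2 < 0 ∧ p.1.1 % 2 ≠ p.2.1 % 2))).card = onspF w := by
  unfold onspF
  apply Finset.card_bij (fun p _ => if p.1.1 % 2 = 0 then p else (p.2, p.1))
  · rintro ⟨i, j⟩ hp
    simp only [mem_filter, mem_univ, true_and] at hp ⊢
    obtain ⟨h1, h2, h3⟩ := hp
    split_ifs with h
    · exact ⟨h, by simp only; omega, h2⟩
    · exact ⟨by simp only; omega, by simp only; omega, by simp only; omega⟩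
  · rintro ⟨i, j⟩ hp ⟨i', j'⟩ hp' h
    simp only [mem_filter, mem_univ, true_and, Fin.lt_def] at hp hp'
    simp only at h
    split_ifs at h <;> simp only [Prod.mk.injEq, Fin.ext_iff] at h ⊢ <;> omega
  · rintro ⟨i, j⟩ hp
    simp only [mem_filter, mem_univ, true_and] at hp
    obtain ⟨h1, h2, h3⟩ := hp
    rcases lt_or_ge i j with h | h
    · exact ⟨(i, j), by simp only [mem_filter, mem_univ, true_and]; exact ⟨h, h3, by omega⟩,
        by simp [h1]⟩
    · have : j < i := by
        rcases h.lt_or_eq with h | h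
        · exact h
        · subst h; omega
      exact ⟨(j, i), by simp only [mem_filter, mem_univ, true_and]; exact ⟨this, by omega, by omega⟩,
        by simp [h2]⟩

lemma LD_eq {n : ℕ} (σ : SP n) : LD σ = oinvF (fv σ) + onspF (fv σ) := by
  unfold LD oinvSP onspSP
  rw [pairs_card, pairs_card, ← onsp_aux]
  unfold oinvF
  simp only [sval_eq]
  congr 2 <;>
  · ext p
    simp only [mem_filter, mem_univ, true_and]
    refine and_congr_right fun _ => and_congr_right fun _ => ?_
    omega

lemma LD_eq_sum {n : ℕ} (σ : SP n) : LD σ = ∑ i : Fin n, ∑ j ∈ Ioi i,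
    ((if fv σ j < fv σ i ∧ (i.1 + 1) % 2 ≠ (j.1 + 1) % 2 then 1 else 0) +
      (if fv σ i + fv σ j < 0 ∧ (i.1 + 1) % 2 ≠ (j.1 + 1) % 2 then 1 else 0)) := by
  simp only [sum_add_distrib]
  unfold LD oinvSP onspSP
  rw [pairs_card, pairs_card]
  simp only [sval_eq]
  rw [card_pair_sum (fun i j : Fin n => fv σ j < fv σ i ∧ (i.1 + 1) % 2 ≠ (j.1 + 1) % 2),
    card_pair_sum (fun i j : Fin n => fv σ i + fv σ j < 0 ∧ (i.1 + 1) % 2 ≠ (j.1 + 1) % 2)]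

/-- flip the sign of the first entry -/
def flip0 {n : ℕ} (hn : 0 < n) (σ : SP n) : SP n :=
  (σ.1, Function.update σ.2 ⟨0, hn⟩ (!σ.2 ⟨0, hn⟩))

lemma flip0_flip0 {n : ℕ} (hn : 0 < n) (σ : SP n) : flip0 hn (flip0 hn σ) = σ := by
  unfold flip0
  ext <;> simp

lemma fv_flip0_zero {n : ℕ} (hn : 0 < n) (σ : SP n) :
    fv (flip0 hn σ) ⟨0, hn⟩ = - fv σ ⟨0, hn⟩ := by
  unfold fv flip0
  cases σ.2 ⟨0, hn⟩ <;> simp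

lemma fv_flip0_ne {n : ℕ} (hn : 0 < n) (σ : SP n) (i : Fin n) (hi : i ≠ ⟨0, hn⟩) :
    fv (flip0 hn σ) i = fv σ i := by
  unfold fv flip0
  simp [Function.update_of_ne hi]

lemma LD_flip0 {n : ℕ} (hn : 0 < n) (σ : SP n) : LD (flip0 hn σ) = LD σ := by
  rw [LD_eq_sum, LD_eq_sum]
  refine Finset.sum_congr rfl fun i _ => Finset.sum_congr rfl fun j hj => ?_
  have hij : i < j := mem_Ioi.1 hj
  have hj0 : j ≠ ⟨0, hn⟩ := by
    rintro rfl
    have : i.1 < 0 := hij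
    omega
  rw [fv_flip0_ne hn σ j hj0]
  by_cases hi : i = ⟨0, hn⟩
  · subst hi
    rw [fv_flip0_zero]
    have a1 : fv σ j < -fv σ ⟨0, hn⟩ ↔ fv σ ⟨0, hn⟩ + fv σ j < 0 := by constructor <;> intro <;> linarith
    have a2 : -fv σ ⟨0, hn⟩ + fv σ j < 0 ↔ fv σ j < fv σ ⟨0, hn⟩ := by constructor <;> intro <;> linarith
    simp only [a1, a2]
    rw [add_comm]
  · rw [fv_flip0_ne hn σ i hi]

lemma even_flip0 {n : ℕ} (hn : 0 < n) (σ : SP n) : IsEvenSP (flip0 hn σ) ↔ ¬ IsEvenSP σ := by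
  unfold IsEvenSP
  have key : ∀ s : Fin n → Bool, (univ.filter (fun i => s i = true)).card =
      (if s ⟨0, hn⟩ then 1 else 0) + ((univ.erase ⟨0, hn⟩).filter (fun i => s i = true)).card := by
    intro s
    rw [Finset.card_filter, Finset.card_filter, ← Finset.add_sum_erase univ _ (mem_univ ⟨0, hn⟩)]
  rw [key, key]
  have : ((univ.erase ⟨0, hn⟩).filter (fun i => (flip0 hn σ).2 i = true)) =
      ((univ.erase ⟨0, hn⟩).filter (fun i => σ.2 i = true)) := by
    apply Finset.filter_congr
    intro i hi
    simp [flip0, Function.update_of_ne (Finset.ne_of_mem_erase hi)]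
  rw [this]
  have h2 : (flip0 hn σ).2 ⟨0, hn⟩ = !σ.2 ⟨0, hn⟩ := by simp [flip0]
  rw [h2]
  cases σ.2 ⟨0, hn⟩ <;> simp [Nat.even_add_one, add_comm 1]

/-- ascending at all positive elements of `I` -/
def AscAt {n : ℕ} {α : Type*} [LT α] (I : Finset ℕ) (w : Fin n → α) : Prop :=
  ∀ i (h : i + 1 < n), i + 1 ∈ I → w ⟨i, by omega⟩ < w ⟨i + 1, h⟩

lemma inQuot_iff {n : ℕ} (σ : SP n) (I : Finset ℕ) (hI : I ⊆ Finset.range n) (hn : 1 < n)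
    (h0 : 0 ∈ I) :
    InQuot σ I ↔ (-fv σ ⟨1, hn⟩ < fv σ ⟨0, by omega⟩ ∧ AscAt I (fv σ)) := by
  have e1 : sval σ 1 = fv σ ⟨0, by omega⟩ := sval_eq σ ⟨0, by omega⟩
  have e2 : sval σ 2 = fv σ ⟨1, by omega⟩ := sval_eq σ ⟨1, by omega⟩
  constructor
  · intro h
    refine ⟨?_, ?_⟩
    · have := h 0 h0
      simpa [dval, e1, e2] using this
    · intro i hi hiI
      have := h (i + 1) hiI
      simp only [dval, Nat.add_eq_zero_iff, one_ne_zero, and_false, if_false] at this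
      rw [sval_eq σ ⟨i, by omega⟩, sval_eq σ ⟨i + 1, hi⟩] at this
      exact this
  · rintro ⟨h1, h2⟩ i hi
    rcases i with _ | i
    · simpa [dval, e1, e2] using h1
    · have hin : i + 1 < n := by simpa using hI hi
      have := h2 i hin hi
      simp only [dval, Nat.add_eq_zero_iff, one_ne_zero, and_false, if_false]
      rw [sval_eq σ ⟨i, by omega⟩, sval_eq σ ⟨i + 1, hin⟩]
      exact this

lemma inQuot_flip0 {n : ℕ} (σ : SP n) (I : Finset ℕ) (hI : I ⊆ Finset.range n) (hn : 1 < n)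
    (h0 : 0 ∈ I) (h1 : 1 ∈ I) (hq : InQuot σ I) : InQuot (flip0 (by omega) σ) I := by
  rw [inQuot_iff _ _ hI hn h0] at hq ⊢
  obtain ⟨ha, hb⟩ := hq
  have h01 := hb 0 hn h1
  have hne : ∀ i (h : i + 1 < n), (⟨i + 1, h⟩ : Fin n) ≠ ⟨0, by omega⟩ := by
    intro i h; simp
  refine ⟨?_, ?_⟩
  · rw [fv_flip0_zero, fv_flip0_ne _ _ _ (hne 0 hn)]
    simpa using h01
  · intro i hi hiI
    rw [fv_flip0_ne _ _ _ (hne i hi)]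
    rcases i with _ | i
    · rw [fv_flip0_zero]
      simp only [zero_add]
      linarith
    · rw [fv_flip0_ne _ _ _ (hne i (by omega))]
      exact hb (i + 1) hi hiI

open Classical in
lemma genD_eq_pos {n : ℕ} (I : Finset ℕ) (hI : I ⊆ Finset.range n) (hn : 1 < n)
    (h0 : 0 ∈ I) (h1 : 1 ∈ I) :
    genD n I = ∑ σ ∈ univ.filter (fun σ : SP n => 0 < fv σ ⟨0, by omega⟩ ∧ AscAt I (fv σ)),
      ((Equiv.Perm.sign σ.1 : ℤ) : Polynomial ℤ) * X ^ (oinvF (fv σ) + onspF (fv σ)) := by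
  have hn0 : 0 < n := by omega
  unfold genD
  simp only [neg_one_pow_ell, ← LD_eq]
  have e : ∀ σ : SP n, (0 < fv σ ⟨0, by omega⟩ ∧ AscAt I (fv σ)) ↔
      (InQuot σ I ∧ 0 < fv σ ⟨0, by omega⟩) := by
    intro σ
    rw [inQuot_iff _ _ hI hn h0]
    constructor
    · rintro ⟨ha, hb⟩
      have h01 : fv σ ⟨0, by omega⟩ < fv σ ⟨1, by omega⟩ := hb 0 hn h1
      exact ⟨⟨by linarith, hb⟩, ha⟩
    · rintro ⟨⟨ha, hb⟩, hc⟩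
      exact ⟨hc, hb⟩
  simp only [e]
  rw [← Finset.sum_filter_add_sum_filter_not (univ.filter (fun σ : SP n => IsEvenSP σ ∧ InQuot σ I))
      (fun σ => 0 < fv σ ⟨0, by omega⟩),
    ← Finset.sum_filter_add_sum_filter_not (univ.filter (fun σ : SP n => InQuot σ I ∧ _))
      (fun σ => IsEvenSP σ)]
  congr 1
  · apply Finset.sum_congr _ (fun _ _ => rfl)
    ext σ
    simp only [mem_filter, mem_univ, true_and]
    tauto
  · have fne : ∀ σ : SP n, fv σ ⟨0, hn0⟩ ≠ 0 := by
      intro σ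
      rcases fv_abs σ ⟨0, hn0⟩ with ⟨_, h⟩ | ⟨_, h⟩ <;> rw [h] <;> omega
    refine Finset.sum_bij' (fun σ _ => flip0 hn0 σ) (fun σ _ => flip0 hn0 σ) ?_ ?_ ?_ ?_ ?_
    · intro σ hσ
      simp only [mem_filter, mem_univ, true_and, even_flip0, fv_flip0_zero] at hσ ⊢
      have := fne σ
      exact ⟨⟨inQuot_flip0 σ I hI hn h0 h1 hσ.1.2, by omega⟩, fun h => h hσ.1.1⟩
    · intro σ hσ
      simp only [mem_filter, mem_univ, true_and, even_flip0, fv_flip0_zero] at hσ ⊢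
      exact ⟨⟨hσ.2, inQuot_flip0 σ I hI hn h0 h1 hσ.1.1⟩, by omega⟩
    · intro σ _; exact flip0_flip0 hn0 σ
    · intro σ _; exact flip0_flip0 hn0 σ
    · intro σ _
      rw [LD_flip0]
      rfl

/-- signed value, with signs indexed by values -/
def sgnv {n : ℕ} (N : Fin n → Bool) (k : Fin n) : ℤ :=
  if N k then -((k : ℕ) + 1 : ℤ) else ((k : ℕ) + 1 : ℤ)

/-- the permutation sorting the signed values -/
def pN {n : ℕ} (N : Fin n → Bool) : Equiv.Perm (Fin n) := Tuple.sort (sgnv N)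

/-- sorted signed values -/
def yN {n : ℕ} (N : Fin n → Bool) (r : Fin n) : ℤ := sgnv N (pN N r)

lemma sgnv_inj {n : ℕ} (N : Fin n → Bool) : Function.Injective (sgnv N) := by
  intro a b h
  unfold sgnv at h
  apply Fin.ext
  split_ifs at h <;> omega

lemma yN_strictMono {n : ℕ} (N : Fin n → Bool) : StrictMono (yN N) :=
  (Tuple.monotone_sort (sgnv N)).strictMono_of_injective
    ((sgnv_inj N).comp (pN N).injective)

/-- signed permutations as pairs (sign set, arrangement) -/
def spEquiv (n : ℕ) : (Fin n → Bool) × Equiv.Perm (Fin n) ≃ SP n where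
  toFun a := (pN a.1 * a.2, fun i => a.1 ((pN a.1 * a.2) i))
  invFun σ := (fun k => σ.2 (σ.1.symm k), (pN (fun k => σ.2 (σ.1.symm k)))⁻¹ * σ.1)
  left_inv := by
    rintro ⟨N, v⟩
    have : (fun k => N ((pN N * v) ((pN N * v).symm k))) = N := by
      funext k; simp
    simp only [this]
    simp
  right_inv := by
    rintro ⟨p, s⟩
    ext <;> simp

lemma fv_spEquiv {n : ℕ} (N : Fin n → Bool) (v : Equiv.Perm (Fin n)) :
    fv (spEquiv n (N, v)) = fun i => yN N (v i) := by
  funext i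
  simp only [fv, spEquiv, yN, sgnv, Equiv.coe_fn_mk, Equiv.Perm.mul_apply]
  split_ifs with h <;> simp [h]

/-- parity preserving permutation -/
def PP {n : ℕ} (v : Equiv.Perm (Fin n)) : Prop := ∀ i, (v i).1 % 2 = i.1 % 2

open Classical in
lemma sum_SP_eq {n : ℕ} (I : Finset ℕ) (hn : 0 < n) :
    ∑ σ ∈ univ.filter (fun σ : SP n => 0 < fv σ ⟨0, hn⟩ ∧ AscAt I (fv σ)),
      ((Equiv.Perm.sign σ.1 : ℤ) : Polynomial ℤ) * X ^ (oinvF (fv σ) + onspF (fv σ)) =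
    ∑ N : Fin n → Bool, ((Equiv.Perm.sign (pN N) : ℤ) : Polynomial ℤ) *
      ∑ v ∈ univ.filter (fun v : Equiv.Perm (Fin n) => 0 < yN N (v ⟨0, hn⟩) ∧ AscAt I v),
        ((Equiv.Perm.sign v : ℤ) : Polynomial ℤ) *
          X ^ (oinvF v + onspF (fun i => yN N (v i))) := by
  rw [Finset.sum_filter, ← (spEquiv n).sum_comp, Fintype.sum_prod_type]
  refine Finset.sum_congr rfl fun N _ => ?_
  rw [Finset.sum_filter, Finset.mul_sum]
  refine Finset.sum_congr rfl fun v _ => ?_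
  rw [fv_spEquiv]
  have e1 : AscAt I (fun i => yN N (v i)) ↔ AscAt I v := by
    unfold AscAt
    simp only [(yN_strictMono N).lt_iff_lt]
  have e2 : oinvF (fun i => yN N (v i)) = oinvF v := by
    unfold oinvF
    simp only [(yN_strictMono N).lt_iff_lt]
  rw [e1, e2]
  have e3 : (spEquiv n (N, v)).1 = pN N * v := rfl
  rw [e3, Equiv.Perm.sign_mul]
  split_ifs
  · push_cast; ring
  · simp

lemma onspF_comp {n : ℕ} (w : Fin n → ℤ) (v : Equiv.Perm (Fin n)) (hv : PP v) :
    onspF (fun i => w (v i)) = onspF w := by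
  unfold onspF
  apply Finset.card_bij (fun p _ => (v p.1, v p.2))
  · rintro ⟨i, j⟩ hp
    simp only [mem_filter, mem_univ, true_and] at hp ⊢
    rw [hv, hv]
    exact hp
  · rintro ⟨i, j⟩ _ ⟨i', j'⟩ _ h
    simpa using h
  · rintro ⟨i, j⟩ hp
    refine ⟨(v.symm i, v.symm j), ?_, by simp⟩
    have h1 := hv (v.symm i)
    have h2 := hv (v.symm j)
    simp only [Equiv.apply_symm_apply] at h1 h2
    simp only [mem_filter, mem_univ, true_and, Equiv.apply_symm_apply] at hp ⊢
    rw [← h1, ← h2]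
    exact hp

/-- adjacent transposition of ranks -/
def sw (n r : ℕ) : Equiv.Perm (Fin n) :=
  if h : r + 1 < n then Equiv.swap ⟨r, by omega⟩ ⟨r + 1, h⟩ else 1

/-- ranks `r`, `r+1` sit at positions of equal parity -/
def Bad {n : ℕ} (ν : ℕ) (v : Equiv.Perm (Fin n)) (r : ℕ) : Prop :=
  ∃ h : r + 1 < n, r + 1 ≠ ν ∧
    (v.symm ⟨r, by omega⟩).1 % 2 = (v.symm ⟨r + 1, h⟩).1 % 2

lemma exists_bad {n : ℕ} (hn : Even n) (I : Finset ℕ)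
    (hodd : ∀ j ∈ Finset.Icc 1 (n - 1), Odd j → j ∈ I) (ν : ℕ) (v : Equiv.Perm (Fin n))
    (ha : AscAt I v) (hp : ¬ PP v) : ∃ r, Bad ν v r := by
  by_contra hcon
  push Not at hcon
  have step : ∀ r (h : r + 1 < n), r + 1 ≠ ν →
      (v.symm ⟨r, by omega⟩).1 % 2 ≠ (v.symm ⟨r + 1, h⟩).1 % 2 := by
    intro r h h1 h2
    exact hcon r ⟨h, h1, h2⟩
  have low : ∀ r (h : r < n), r < ν → (v.symm ⟨r, h⟩).1 % 2 = r % 2 := by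
    intro r
    induction r with
    | zero =>
      intro h _
      by_contra hne
      obtain ⟨i, hi⟩ : ∃ i, (v.symm ⟨0, h⟩).1 = i + 1 :=
        Nat.exists_eq_succ_of_ne_zero (by rintro h0; simp [h0] at hne)
      have hin : i + 1 < n := hi ▸ (v.symm ⟨0, h⟩).2
      have h1 := ha i hin (hodd (i + 1) (by simp; omega) (by rw [Nat.odd_iff]; omega))
      have h2 : (⟨i + 1, hin⟩ : Fin n) = v.symm ⟨0, h⟩ := Fin.ext hi.symm
      rw [h2, Equiv.apply_symm_apply] at h1
      exact absurd (Fin.lt_def.1 h1) (by simp)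
    | succ r ih =>
      intro h hr
      have := ih (by omega) (by omega)
      have := step r h (by omega)
      omega
  have high : ∀ d r (h : r < n), r + d + 1 = n → ν ≤ r → (v.symm ⟨r, h⟩).1 % 2 = r % 2 := by
    intro d
    induction d with
    | zero =>
      intro r h hr _
      by_contra hne
      rw [Nat.even_iff] at hn
      have hlt := (v.symm ⟨r, h⟩).2
      obtain ⟨i, hi⟩ : ∃ i, (v.symm ⟨r, h⟩).1 = i := ⟨_, rfl⟩
      have hin : i + 1 < n := by omega
      have h1 := ha i hin (hodd (i + 1) (by simp; omega) (by rw [Nat.odd_iff]; omega))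
      have h2 : (⟨i, by omega⟩ : Fin n) = v.symm ⟨r, h⟩ := Fin.ext hi.symm
      rw [h2, Equiv.apply_symm_apply, Fin.lt_def] at h1
      have := (v ⟨i + 1, hin⟩).2
      simp only at h1
      omega
    | succ d ih =>
      intro r h hr hν
      have := ih (r + 1) (by omega) (by omega) (by omega)
      have := step r (by omega) (by omega)
      omega
  apply hp
  intro i
  have key : ∀ r : Fin n, (v.symm r).1 % 2 = r.1 % 2 := by
    rintro ⟨r, h⟩
    rcases lt_or_ge r ν with h1 | h1
    · exact low r h h1
    · exact high (n - 1 - r) r h (by omega) h1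
  have := key (v i)
  simp only [Equiv.symm_apply_apply] at this
  exact this.symm

lemma parity_sw {n : ℕ} {ν : ℕ} {v : Equiv.Perm (Fin n)} {r : ℕ} (hb : Bad ν v r) (k : Fin n) :
    ((sw n r * v).symm k).1 % 2 = (v.symm k).1 % 2 := by
  obtain ⟨h, h1, h2⟩ := hb
  have e : (sw n r * v).symm k = v.symm ((sw n r).symm k) := rfl
  rw [e, sw, dif_pos h, Equiv.symm_swap]
  rw [Equiv.swap_apply_def]
  split_ifs with h3 h4
  · rw [h3, h2]
  · rw [h4, h2]
  · rfl

lemma bad_sw {n : ℕ} {ν : ℕ} {v : Equiv.Perm (Fin n)} {r : ℕ} (hb : Bad ν v r) (k : ℕ) :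
    Bad ν (sw n r * v) k ↔ Bad ν v k := by
  unfold Bad
  simp only [parity_sw hb]

lemma sw_lt_iff {n r : ℕ} (a b : Fin n) (h : r + 1 < n)
    (hne : ¬ ((a.1 = r ∧ b.1 = r + 1) ∨ (a.1 = r + 1 ∧ b.1 = r))) :
    sw n r a < sw n r b ↔ a < b := by
  have val : ∀ c : Fin n, (sw n r c).1 = if c.1 = r then r + 1 else if c.1 = r + 1 then r else c.1 := by
    intro c
    rw [sw, dif_pos h, Equiv.swap_apply_def]
    simp only [Fin.ext_iff]
    split_ifs <;> rfl
  rw [Fin.lt_def, Fin.lt_def, val, val]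
  split_ifs <;> omega

lemma bad_pos {n : ℕ} {ν : ℕ} {v : Equiv.Perm (Fin n)} {r : ℕ} (hb : Bad ν v r) (i j : Fin n)
    (hij : i.1 % 2 ≠ j.1 % 2) :
    ¬ (((v i).1 = r ∧ (v j).1 = r + 1) ∨ ((v i).1 = r + 1 ∧ (v j).1 = r)) := by
  obtain ⟨h, h1, h2⟩ := hb
  rintro (⟨h3, h4⟩ | ⟨h3, h4⟩)
  · have e1 : v i = ⟨r, by omega⟩ := Fin.ext h3
    have e2 : v j = ⟨r + 1, h⟩ := Fin.ext h4
    rw [← e1, ← e2] at h2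
    simp only [Equiv.symm_apply_apply] at h2
    exact hij h2
  · have e1 : v i = ⟨r + 1, h⟩ := Fin.ext h3
    have e2 : v j = ⟨r, by omega⟩ := Fin.ext h4
    rw [← e1, ← e2] at h2
    simp only [Equiv.symm_apply_apply] at h2
    exact hij h2.symm

lemma oinvF_sw {n : ℕ} {ν : ℕ} {v : Equiv.Perm (Fin n)} {r : ℕ} (hb : Bad ν v r) :
    oinvF (sw n r * v) = oinvF v := by
  unfold oinvF
  congr 1
  apply Finset.filter_congr
  rintro ⟨i, j⟩ _
  refine and_congr_right fun _ => ?_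
  constructor
  · rintro ⟨h1, h2⟩
    refine ⟨?_, h2⟩
    exact (sw_lt_iff (v j) (v i) hb.1 (bad_pos hb j i (Ne.symm h2))).1 h1
  · rintro ⟨h1, h2⟩
    refine ⟨?_, h2⟩
    exact (sw_lt_iff (v j) (v i) hb.1 (bad_pos hb j i (Ne.symm h2))).2 h1

lemma ascAt_sw {n : ℕ} {ν : ℕ} {v : Equiv.Perm (Fin n)} {r : ℕ} (hb : Bad ν v r) (I : Finset ℕ)
    (h : AscAt I v) : AscAt I (sw n r * v) := by
  intro i hi hI
  exact (sw_lt_iff _ _ hb.1 (bad_pos hb _ _ (by simp only; omega))).2 (h i hi hI)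

lemma nu_sw {n : ℕ} {ν : ℕ} {v : Equiv.Perm (Fin n)} {r : ℕ} (hb : Bad ν v r) (i : Fin n)
    (h : ν ≤ (v i).1) : ν ≤ ((sw n r * v) i).1 := by
  obtain ⟨h0, h1, h2⟩ := hb
  rw [Equiv.Perm.mul_apply, sw, dif_pos h0, Equiv.swap_apply_def]
  split_ifs with h3 h4
  · simp [h3] at h ⊢; omega
  · simp [h4] at h ⊢; omega
  · exact h

lemma sw_sw (n r : ℕ) (v : Equiv.Perm (Fin n)) : sw n r * (sw n r * v) = v := by
  unfold sw
  split_ifs <;> simp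

lemma onspF_sw {n : ℕ} {ν : ℕ} {v : Equiv.Perm (Fin n)} {r : ℕ} (hb : Bad ν v r)
    (y : Fin n → ℤ) :
    onspF (fun i => y ((sw n r * v) i)) = onspF (fun i => y (v i)) := by
  have hP : PP (v⁻¹ * (sw n r * v)) := by
    intro i
    have h := parity_sw hb ((sw n r * v) i)
    simp only [Equiv.symm_apply_apply] at h
    rw [h]
    rfl
  rw [← onspF_comp (fun i => y (v i)) _ hP]
  simp

open Classical in
lemma invol {n : ℕ} (hn : Even n) (I : Finset ℕ)
    (hodd : ∀ j ∈ Finset.Icc 1 (n - 1), Odd j → j ∈ I) (ν : ℕ) (hn0 : 0 < n) (y : Fin n → ℤ) :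
    ∑ v ∈ univ.filter (fun v : Equiv.Perm (Fin n) => ν ≤ (v ⟨0, hn0⟩).1 ∧ AscAt I v),
      ((Equiv.Perm.sign v : ℤ) : Polynomial ℤ) * X ^ (oinvF v + onspF (fun i => y (v i))) =
    ∑ v ∈ univ.filter (fun v : Equiv.Perm (Fin n) => (ν ≤ (v ⟨0, hn0⟩).1 ∧ AscAt I v) ∧ PP v),
      ((Equiv.Perm.sign v : ℤ) : Polynomial ℤ) * X ^ (oinvF v + onspF (fun i => y (v i))) := by
  rw [← Finset.sum_filter_add_sum_filter_not _ (fun v => PP v), Finset.filter_filter]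
  rw [add_eq_left]
  have hex : ∀ v ∈ (univ.filter (fun v : Equiv.Perm (Fin n) =>
      ν ≤ (v ⟨0, hn0⟩).1 ∧ AscAt I v)).filter (fun v => ¬ PP v), ∃ r, Bad ν v r := by
    intro v hv
    simp only [mem_filter, mem_univ, true_and] at hv
    exact exists_bad hn I hodd ν v hv.1.2 hv.2
  have hmem : ∀ v (hv : v ∈ (univ.filter (fun v : Equiv.Perm (Fin n) =>
      ν ≤ (v ⟨0, hn0⟩).1 ∧ AscAt I v)).filter (fun v => ¬ PP v)),
      sw n (Nat.find (hex v hv)) * v ∈ (univ.filter (fun v : Equiv.Perm (Fin n) =>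
      ν ≤ (v ⟨0, hn0⟩).1 ∧ AscAt I v)).filter (fun v => ¬ PP v) := by
    intro v hv
    have hb := Nat.find_spec (hex v hv)
    simp only [mem_filter, mem_univ, true_and] at hv ⊢
    refine ⟨⟨nu_sw hb _ hv.1.1, ascAt_sw hb I hv.1.2⟩, ?_⟩
    intro hP
    apply hv.2
    intro i
    have h1 := parity_sw hb (v i)
    simp only [Equiv.symm_apply_apply] at h1
    have h2 := hP ((sw n (Nat.find (hex v (by simpa using hv))) * v).symm (v i))
    simp only [Equiv.apply_symm_apply] at h2
    rw [h2, h1]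
  refine Finset.sum_involution (fun v hv => sw n (Nat.find (hex v hv)) * v) ?_ ?_ hmem ?_
  · intro v hv
    have hb := Nat.find_spec (hex v hv)
    rw [oinvF_sw hb, onspF_sw hb, Equiv.Perm.sign_mul]
    have : Equiv.Perm.sign (sw n (Nat.find (hex v hv))) = -1 := by
      rw [sw, dif_pos hb.1]
      apply Equiv.Perm.sign_swap
      simp
    rw [this]
    push_cast
    ring
  · intro v hv _ heq
    have hb := Nat.find_spec (hex v hv)
    have h1 : sw n (Nat.find (hex v hv)) = 1 := by simpa using heq
    rw [sw, dif_pos hb.1] at h1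
    simp at h1
  · intro v hv
    have hb := Nat.find_spec (hex v hv)
    have e : Nat.find (hex _ (hmem v hv)) = Nat.find (hex v hv) := by
      apply le_antisymm
      · exact Nat.find_min' _ ((bad_sw hb _).2 hb)
      · exact Nat.find_min' _ ((bad_sw hb _).1 (Nat.find_spec (hex _ (hmem v hv))))
    simp only [e]
    exact sw_sw _ _ _

/-- number of negative entries -/
def nuN {n : ℕ} (N : Fin n → Bool) : ℕ := (univ.filter (fun k => N k = true)).card

lemma yN_neg_iff {n : ℕ} (N : Fin n → Bool) (r : Fin n) : yN N r < 0 ↔ N (pN N r) = true := by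
  unfold yN sgnv
  split_ifs with h <;> simp [h] <;> omega

lemma yN_pos_iff {n : ℕ} (N : Fin n → Bool) (r : Fin n) : 0 < yN N r ↔ nuN N ≤ r.1 := by
  have h0 : yN N r ≠ 0 := by
    unfold yN sgnv
    split_ifs <;> omega
  have h1 := Tuple.lt_card_lt_iff_apply_lt_of_monotone (a := (0 : ℤ)) (j := r) (yN_strictMono N).monotone
  have h2 : (univ.filter (fun i => yN N i < 0)).card = nuN N := by
    unfold nuN
    apply Finset.card_bij (fun i _ => pN N i)
    · intro i hi
      simpa [yN_neg_iff] using hi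
    · intro i _ j _ h
      exact (pN N).injective h
    · intro k hk
      exact ⟨(pN N).symm k, by simpa [yN_neg_iff] using hk, by simp⟩
  rw [h2] at h1
  omega

lemma count_ioc (i k : ℕ) :
    ((Finset.Ioc i (i + k)).filter (fun j => i % 2 ≠ j % 2)).card = (k + 1) / 2 := by
  induction k with
  | zero => simp
  | succ k ih =>
    have : Finset.Ioc i (i + (k + 1)) = insert (i + k + 1) (Finset.Ioc i (i + k)) := by
      ext j; simp; omega
    rw [this, Finset.filter_insert]
    split_ifs with h
    · rw [Finset.card_insert_of_notMem (by simp), ih]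
      omega
    · rw [ih]; omega

lemma yN_val {n : ℕ} (N : Fin n → Bool) (i : Fin n) :
    (N (pN N i) = true ∧ yN N i = -((pN N i : ℕ) + 1 : ℤ)) ∨
    (N (pN N i) = false ∧ yN N i = ((pN N i : ℕ) + 1 : ℤ)) := by
  unfold yN sgnv
  split_ifs with h <;> simp [h]

lemma after_set {n : ℕ} (N : Fin n → Bool) (i : Fin n) (hi : N (pN N i) = true) :
    ((Ioi i).filter (fun j => pN N j < pN N i)).map Fin.valEmbedding =
      Finset.Ioc i.1 (i.1 + (pN N i).1) := by
  have hy : yN N i = -((pN N i : ℕ) + 1 : ℤ) := by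
    rcases yN_val N i with h | h
    · exact h.2
    · simp [hi] at h
  have e1 : (Ioi i).filter (fun j => pN N j < pN N i) = univ.filter (fun j => pN N j < pN N i) := by
    ext j
    simp only [mem_filter, mem_Ioi, mem_univ, true_and, and_iff_right_iff_imp]
    intro h
    rw [← (yN_strictMono N).lt_iff_lt]
    rw [Fin.lt_def] at h
    rcases yN_val N j with h' | h' <;> omega
  have card : (((Ioi i).filter (fun j => pN N j < pN N i)).map Fin.valEmbedding).card = (pN N i).1 := by
    rw [Finset.card_map, e1]
    have : (univ.filter (fun j => pN N j < pN N i)).card = (Finset.Iio (pN N i)).card := by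
      apply Finset.card_bij (fun j _ => pN N j)
      · intro j hj; simpa using hj
      · intro a _ b _ h; exact (pN N).injective h
      · intro k hk; exact ⟨(pN N).symm k, by simpa using hk, by simp⟩
    rw [this, Fin.card_Iio]
  apply Finset.eq_of_subset_of_card_le
  · intro j hj
    simp only [mem_map, mem_filter, mem_Ioi, Fin.valEmbedding_apply] at hj
    obtain ⟨j, ⟨hij, hlt⟩, rfl⟩ := hj
    have hij' : i.1 < j.1 := hij
    simp only [Finset.mem_Ioc]
    refine ⟨hij', ?_⟩
    have hsub : Finset.Ioc i j ⊆ (Ioi i).filter (fun j => pN N j < pN N i) := by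
      intro l hl
      simp only [mem_filter, mem_Ioi, Finset.mem_Ioc] at hl ⊢
      refine ⟨hl.1, ?_⟩
      have h1 := yN_strictMono N hl.1
      have h2 := (yN_strictMono N).monotone hl.2
      rw [Fin.lt_def] at hlt ⊢
      rcases yN_val N j with h' | h' <;> rcases yN_val N l with h'' | h'' <;> omega
    have := Finset.card_le_card hsub
    rw [Fin.card_Ioc] at this
    rw [Finset.card_map] at card
    omega
  · rw [card]; simp

lemma onspF_yN {n : ℕ} (N : Fin n → Bool) :
    onspF (yN N) = ∑ k : Fin n, if N k then (k.1 + 1) / 2 else 0 := by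
  rw [← onsp_aux, card_pair_sum (fun i j : Fin n => yN N i + yN N j < 0 ∧ i.1 % 2 ≠ j.1 % 2)]
  rw [← Equiv.sum_comp (pN N) (fun k : Fin n => if N k then (k.1 + 1) / 2 else 0)]
  refine Finset.sum_congr rfl fun i _ => ?_
  split_ifs with hi
  · rw [← count_ioc i.1, ← after_set N i hi, Finset.filter_map, Finset.card_map, Finset.filter_filter,
      Finset.card_filter]
    refine Finset.sum_congr rfl fun j hj => ?_
    have hij := yN_strictMono N (mem_Ioi.1 hj)
    have hne : (pN N i).1 ≠ (pN N j).1 := fun h => (mem_Ioi.1 hj).ne ((pN N).injective (Fin.ext h))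
    congr 1
    simp only [Function.comp, Fin.valEmbedding_apply, eq_iff_iff, Fin.lt_def]
    refine and_congr_left fun _ => ?_
    rcases yN_val N i with h' | h'
    · rcases yN_val N j with h'' | h'' <;> omega
    · simp [hi] at h'
  · apply Finset.sum_eq_zero
    intro j hj
    have hij := yN_strictMono N (mem_Ioi.1 hj)
    rw [if_neg]
    rintro ⟨h, _⟩
    rcases yN_val N i with h' | h'
    · exact hi h'.1
    · omega

lemma sign_pN {n : ℕ} (N : Fin n → Bool) :
    Equiv.Perm.sign (pN N) = ∏ k : Fin n, if N k then (-1 : ℤˣ) ^ k.1 else 1 := by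
  rw [Equiv.Perm.sign_eq_prod_prod_Ioi,
    ← Equiv.prod_comp (pN N) (fun k : Fin n => if N k then (-1 : ℤˣ) ^ k.1 else 1)]
  refine Finset.prod_congr rfl fun i _ => ?_
  split_ifs with hi
  · have hc : ((Ioi i).filter (fun j => pN N j < pN N i)).card = (pN N i).1 := by
      rw [← Finset.card_map Fin.valEmbedding, after_set N i hi]; simp
    conv_rhs => rw [← hc, Finset.card_filter, ← Finset.prod_pow_eq_pow_sum]
    refine Finset.prod_congr rfl fun j hj => ?_
    have hne : pN N i ≠ pN N j := fun h => (mem_Ioi.1 hj).ne ((pN N).injective h)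
    rcases lt_or_gt_of_ne hne with h | h
    · simp [h, h.not_gt]
    · simp [h, h.not_gt]
  · apply Finset.prod_eq_one
    intro j hj
    have hij := yN_strictMono N (mem_Ioi.1 hj)
    rw [if_pos]
    rw [Fin.lt_def]
    rcases yN_val N i with h' | h'
    · exact absurd h'.1 hi
    · rcases yN_val N j with h'' | h'' <;> omega

lemma wt_eq {n : ℕ} (N : Fin n → Bool) :
    ((Equiv.Perm.sign (pN N) : ℤ) : Polynomial ℤ) * X ^ onspF (yN N) =
      ∏ k : Fin n, if N k then (-1 : Polynomial ℤ) ^ k.1 * X ^ ((k.1 + 1) / 2) else 1 := by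
  rw [sign_pN, onspF_yN, ← Finset.prod_pow_eq_pow_sum]
  push_cast
  rw [← Finset.prod_mul_distrib]
  refine Finset.prod_congr rfl fun k _ => ?_
  split_ifs <;> simp

/-- the permutation of pairs induced by `π` -/
def pp {m : ℕ} (π : Equiv.Perm (Fin m)) : Equiv.Perm (Fin (m * 2)) :=
  (finProdFinEquiv (m := m) (n := 2)).permCongr (Equiv.prodCongrLeft (fun _ => π))

lemma pp_val {m : ℕ} (π : Equiv.Perm (Fin m)) (i : Fin (m * 2)) :
    (pp π i).1 = i.1 % 2 + 2 * (π ⟨i.1 / 2, by omega⟩).1 := rfl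

lemma sign_pp {m : ℕ} (π : Equiv.Perm (Fin m)) : Equiv.Perm.sign (pp π) = 1 := by
  unfold pp
  rw [Equiv.Perm.sign_permCongr, Equiv.Perm.sign_prodCongrLeft]
  simp

lemma pp_inj {m : ℕ} : Function.Injective (pp (m := m)) := by
  intro π ρ h
  ext j
  have h1 := pp_val π ⟨2 * j.1, by omega⟩
  have h2 := pp_val ρ ⟨2 * j.1, by omega⟩
  rw [h, h2] at h1
  simp at h1
  rw [h1]

lemma PP_pp {m : ℕ} (π : Equiv.Perm (Fin m)) : PP (pp π) := by
  intro i
  rw [pp_val]; omega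

/-- inversions of a permutation -/
def invF {m : ℕ} (π : Equiv.Perm (Fin m)) : ℕ :=
  ((univ : Finset (Fin m × Fin m)).filter (fun p => p.1 < p.2 ∧ π p.2 < π p.1)).card

lemma oinvF_pp {m : ℕ} (π : Equiv.Perm (Fin m)) : oinvF (pp π) = 2 * invF π := by
  unfold oinvF invF
  have h2 : ∀ N : ℕ, 2 * N = N * (univ : Finset Bool).card := by intro N; simp [mul_comm]
  rw [h2, ← Finset.card_product]
  symm
  apply Finset.card_bij (fun (p : (Fin m × Fin m) × Bool) _ =>
    ((⟨2 * p.1.1.1 + (if p.2 then 1 else 0), by have := p.1.1.2; split_ifs <;> omega⟩,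
      ⟨2 * p.1.2.1 + (if p.2 then 0 else 1), by have := p.1.2.2; split_ifs <;> omega⟩) :
        Fin (m * 2) × Fin (m * 2)))
  · rintro ⟨⟨a, b⟩, e⟩ hp
    simp only [mem_product, mem_filter, mem_univ, true_and, and_true, Fin.lt_def, pp_val] at hp ⊢
    have e1 : ∀ t : ℕ, t < 2 → ∀ h, (⟨(2 * a.1 + t) / 2, h⟩ : Fin m) = a := by
      intro t ht h; ext; simp; omega
    have e2 : ∀ t : ℕ, t < 2 → ∀ h, (⟨(2 * b.1 + t) / 2, h⟩ : Fin m) = b := by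
      intro t ht h; ext; simp; omega
    rw [e1 _ (by split_ifs <;> omega), e2 _ (by split_ifs <;> omega)]
    split_ifs <;> omega
  · rintro ⟨⟨a, b⟩, e⟩ _ ⟨⟨a', b'⟩, e'⟩ _ h
    simp only [Prod.mk.injEq, Fin.mk.injEq] at h ⊢
    rw [Fin.ext_iff, Fin.ext_iff]
    cases e <;> cases e' <;> simp at h ⊢ <;> omega
  · rintro ⟨i, j⟩ hp
    simp only [mem_filter, mem_univ, true_and, Fin.lt_def, pp_val] at hp
    have hne : i.1 / 2 ≠ j.1 / 2 := by
      intro h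
      simp only [h] at hp
      omega
    refine ⟨((⟨i.1 / 2, by omega⟩, ⟨j.1 / 2, by omega⟩), decide (i.1 % 2 = 1)), ?_, ?_⟩
    · simp only [mem_product, mem_filter, mem_univ, true_and, and_true, Fin.lt_def]
      have hpne : (π ⟨i.1 / 2, by omega⟩).1 ≠ (π ⟨j.1 / 2, by omega⟩).1 := by
        intro h
        have h3 := π.injective (Fin.ext h)
        simp only [Fin.mk.injEq] at h3
        exact hne h3
      omega
    · simp only [Prod.mk.injEq, Fin.ext_iff, decide_eq_true_eq]
      split_ifs <;> omega

lemma exists_pp {m : ℕ} (I : Finset ℕ)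
    (hodd : ∀ j ∈ Finset.Icc 1 (m * 2 - 1), Odd j → j ∈ I)
    (v : Equiv.Perm (Fin (m * 2))) (hv : PP v) (ha : AscAt I v) : ∃ π, pp π = v := by
  have hve : ∀ j : Fin m, (v ⟨2 * j.1, by omega⟩).1 % 2 = 0 := by
    intro j; rw [hv]; simp
  have hvo : ∀ j : Fin m, (v ⟨2 * j.1 + 1, by omega⟩).1 % 2 = 1 := by
    intro j; rw [hv]; simp
  let A : Fin m → Fin m := fun j => ⟨(v ⟨2 * j.1, by omega⟩).1 / 2, by omega⟩
  let B : Fin m → Fin m := fun j => ⟨(v ⟨2 * j.1 + 1, by omega⟩).1 / 2, by omega⟩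
  have hA : Function.Injective A := by
    intro j k h
    simp only [A, Fin.mk.injEq] at h
    have : (v ⟨2 * j.1, by omega⟩) = v ⟨2 * k.1, by omega⟩ := by
      ext
      have := hve j; have := hve k; omega
    have := v.injective this
    simp only [Fin.mk.injEq] at this
    ext; omega
  have hB : Function.Injective B := by
    intro j k h
    simp only [B, Fin.mk.injEq] at h
    have : (v ⟨2 * j.1 + 1, by omega⟩) = v ⟨2 * k.1 + 1, by omega⟩ := by
      ext
      have := hvo j; have := hvo k; omega
    have := v.injective this
    simp only [Fin.mk.injEq] at this
    ext; omega
  have hAB : ∀ j, (A j).1 ≤ (B j).1 := by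
    intro j
    have h := ha (2 * j.1) (by omega) (hodd _ (by simp; omega) ⟨j.1, rfl⟩)
    rw [Fin.lt_def] at h
    simp only [A, B]
    omega
  let πA : Equiv.Perm (Fin m) := Equiv.ofBijective A (Finite.injective_iff_bijective.1 hA)
  let πB : Equiv.Perm (Fin m) := Equiv.ofBijective B (Finite.injective_iff_bijective.1 hB)
  have hsum : ∑ j, (A j).1 = ∑ j, (B j).1 := by
    have h1 := Equiv.sum_comp πA (fun j : Fin m => j.1)
    have h2 := Equiv.sum_comp πB (fun j : Fin m => j.1)
    exact h1.trans h2.symm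
  have hEq := (Finset.sum_eq_sum_iff_of_le (fun j _ => hAB j)).1 hsum
  refine ⟨πA, ?_⟩
  ext i
  rw [pp_val]
  have hpi := hv i
  show i.1 % 2 + 2 * (A ⟨i.1 / 2, _⟩).1 = _
  rcases Nat.mod_two_eq_zero_or_one i.1 with h | h
  · simp only [A]
    have : (⟨2 * (i.1 / 2), by omega⟩ : Fin (m * 2)) = i := by ext; simp; omega
    rw [this]; omega
  · rw [hEq _ (mem_univ _)]
    simp only [B]
    have : (⟨2 * (i.1 / 2) + 1, by omega⟩ : Fin (m * 2)) = i := by ext; simp; omega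
    rw [this]; omega

/-- condition for the reduced sum -/
def okP (A : ℕ → Prop) (p c : ℕ) {len : ℕ} (π : Equiv.Perm (Fin len)) : Prop :=
  (∀ i (h : i + 1 < len), A (p + i) → π ⟨i, by omega⟩ < π ⟨i + 1, h⟩) ∧
    ∀ h : 0 < len, c ≤ (π ⟨0, h⟩).1

open Classical in
/-- reduced generating function -/
noncomputable def G (A : ℕ → Prop) (len p c : ℕ) : Polynomial ℤ :=
  ∑ π ∈ univ.filter (fun π : Equiv.Perm (Fin len) => okP A p c π), (X ^ 2) ^ invF π

lemma ascAt_pp {m : ℕ} (I : Finset ℕ) (π : Equiv.Perm (Fin m)) (ν : ℕ) (hm : 0 < m * 2) :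
    (ν ≤ (pp π ⟨0, hm⟩).1 ∧ AscAt I (pp π)) ↔
      okP (fun j => 2 * (j + 1) ∈ I) 0 ((ν + 1) / 2) π := by
  unfold okP AscAt
  rw [and_comm]
  refine and_congr ⟨fun h i hi hA => ?_, fun h i hi hA => ?_⟩ ?_
  · have := h (2 * i + 1) (by omega) (by convert hA using 1; omega)
    rw [Fin.lt_def, pp_val, pp_val] at this
    have e1 : ∀ h, (⟨(2 * i + 1) / 2, h⟩ : Fin m) = ⟨i, by omega⟩ := by intro h; ext; simp; omega
    have e2 : ∀ h, (⟨(2 * i + 1 + 1) / 2, h⟩ : Fin m) = ⟨i + 1, by omega⟩ := by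
      intro h; ext; simp; omega
    simp only [e1, e2] at this
    rw [Fin.lt_def]
    omega
  · rw [Fin.lt_def, pp_val, pp_val]
    rcases Nat.even_or_odd' i with ⟨k, rfl | rfl⟩
    · have e1 : ∀ h, (⟨(2 * k) / 2, h⟩ : Fin m) = ⟨k, by omega⟩ := by intro h; ext; simp
      have e2 : ∀ h, (⟨(2 * k + 1) / 2, h⟩ : Fin m) = ⟨k, by omega⟩ := by
        intro h; ext; simp; omega
      simp only [e1, e2]
      omega
    · have := h k (by omega) (by convert hA using 1; omega)
      rw [Fin.lt_def] at this
      have e1 : ∀ h, (⟨(2 * k + 1) / 2, h⟩ : Fin m) = ⟨k, by omega⟩ := by intro h; ext; simp; omega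
      have e2 : ∀ h, (⟨(2 * k + 1 + 1) / 2, h⟩ : Fin m) = ⟨k + 1, by omega⟩ := by
        intro h; ext; simp; omega
      simp only [e1, e2]
      omega
  · rw [pp_val]
    have e1 : ∀ h, (⟨0 / 2, h⟩ : Fin m) = ⟨0, by omega⟩ := by intro h; ext; simp
    simp only [e1]
    constructor
    · intro h _; omega
    · intro h; have := h (by omega); omega

lemma genD_eq_G {m : ℕ} (I : Finset ℕ) (hm : 0 < m) (hI : I ⊆ Finset.range (m * 2))
    (h0 : 0 ∈ I) (hodd : ∀ j ∈ Finset.Icc 1 (m * 2 - 1), Odd j → j ∈ I) :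
    genD (m * 2) I = ∑ N : Fin (m * 2) → Bool,
      (∏ k : Fin (m * 2), if N k then (-1 : Polynomial ℤ) ^ k.1 * X ^ ((k.1 + 1) / 2) else 1) *
        G (fun j => 2 * (j + 1) ∈ I) m 0 ((nuN N + 1) / 2) := by
  classical
  rw [genD_eq_pos I hI (by omega) h0 (hodd 1 (by simp; omega) (by decide)), sum_SP_eq]
  refine Finset.sum_congr rfl fun N _ => ?_
  rw [← wt_eq, mul_assoc]
  congr 1
  simp only [yN_pos_iff]
  rw [invol ⟨m, by omega⟩ I hodd (nuN N) (by omega) (yN N)]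
  unfold G
  rw [Finset.mul_sum]
  symm
  apply Finset.sum_bij (fun π _ => pp π)
  · intro π hπ
    simp only [mem_filter, mem_univ, true_and] at hπ ⊢
    exact ⟨(ascAt_pp I π _ _).2 hπ, PP_pp π⟩
  · intro π _ ρ _ h
    exact pp_inj h
  · intro v hv
    simp only [mem_filter, mem_univ, true_and] at hv
    obtain ⟨π, rfl⟩ := exists_pp I hodd v hv.2 hv.1.2
    exact ⟨π, by simpa using (ascAt_pp I π _ _).1 hv.1, rfl⟩
  · intro π _
    rw [sign_pp, onspF_comp _ _ (PP_pp π), oinvF_pp]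
    simp
    ring

lemma consP_inj {l : ℕ} (k : Fin (l + 1)) (ρ : Equiv.Perm (Fin l)) :
    Function.Injective (Fin.cons k (fun i => k.succAbove (ρ i)) : Fin (l + 1) → Fin (l + 1)) := by
  rw [Fin.cons_injective_iff]
  refine ⟨?_, fun i j h => ρ.injective (Fin.succAbove_right_injective h)⟩
  rintro ⟨i, hi⟩
  exact Fin.succAbove_ne _ _ hi

/-- prepend the value `k` to the permutation `ρ` -/
noncomputable def consP {l : ℕ} (k : Fin (l + 1)) (ρ : Equiv.Perm (Fin l)) :
    Equiv.Perm (Fin (l + 1)) :=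
  Equiv.ofBijective _ (Finite.injective_iff_bijective.1 (consP_inj k ρ))

lemma consP_zero {l : ℕ} (k : Fin (l + 1)) (ρ : Equiv.Perm (Fin l)) : consP k ρ 0 = k := rfl

lemma consP_succ {l : ℕ} (k : Fin (l + 1)) (ρ : Equiv.Perm (Fin l)) (i : Fin l) :
    consP k ρ i.succ = k.succAbove (ρ i) := rfl

lemma consP_bij (l : ℕ) : Function.Bijective
    (fun x : Fin (l + 1) × Equiv.Perm (Fin l) => consP x.1 x.2) := by
  rw [Fintype.bijective_iff_injective_and_card]
  constructor
  · rintro ⟨k, ρ⟩ ⟨k', ρ'⟩ h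
    simp only at h
    have hk : k = k' := by rw [← consP_zero k ρ, h, consP_zero]
    subst hk
    simp only [Prod.mk.injEq, true_and]
    ext i
    have := consP_succ k ρ i
    rw [h, consP_succ] at this
    rw [Fin.succAbove_right_injective this]
  · simp [Fintype.card_perm, Nat.factorial_succ]

lemma invF_sum {m : ℕ} (π : Equiv.Perm (Fin m)) :
    invF π = ∑ i : Fin m, ∑ j ∈ Ioi i, if π j < π i then 1 else 0 :=
  card_pair_sum (fun i j => π j < π i)

lemma invF_consP {l : ℕ} (k : Fin (l + 1)) (ρ : Equiv.Perm (Fin l)) :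
    invF (consP k ρ) = k.1 + invF ρ := by
  rw [invF_sum, invF_sum, Fin.sum_univ_succ]
  congr 1
  · rw [Fin.Ioi_zero_eq_map, Finset.sum_map]
    simp only [Fin.coe_succEmb, consP_succ, consP_zero, Fin.succAbove_lt_iff_castSucc_lt]
    rw [Equiv.sum_comp ρ (fun r : Fin l => if r.castSucc < k then 1 else 0), ← Finset.card_filter]
    have : (univ.filter (fun r : Fin l => r.castSucc < k)).map Fin.valEmbedding = range k.1 := by
      ext r
      simp only [mem_map, mem_filter, mem_univ, true_and, Fin.valEmbedding_apply, mem_range,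
        Fin.lt_def]
      constructor
      · rintro ⟨a, h, rfl⟩; exact h
      · intro h; exact ⟨⟨r, by omega⟩, h, rfl⟩
    rw [← Finset.card_map Fin.valEmbedding, this, card_range]
  · refine Finset.sum_congr rfl fun i _ => ?_
    rw [Fin.Ioi_succ, Finset.sum_map]
    simp only [Fin.coe_succEmb, consP_succ, Fin.succAbove_lt_succAbove_iff]

open Classical in
lemma okP_consP (A : ℕ → Prop) (p c : ℕ) {l : ℕ} (k : Fin (l + 1)) (ρ : Equiv.Perm (Fin l)) :
    okP A p c (consP k ρ) ↔ c ≤ k.1 ∧ okP A (p + 1) (if A p then k.1 else 0) ρ := by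
  unfold okP
  constructor
  · rintro ⟨h1, h2⟩
    have h3 : c ≤ (consP k ρ 0).1 := h2 (by omega)
    rw [consP_zero] at h3
    refine ⟨h3, fun i hi hA => ?_, fun hl => ?_⟩
    · have := h1 (i + 1) (by omega) (by convert hA using 1; omega)
      have e1 := consP_succ k ρ ⟨i, by omega⟩
      have e2 := consP_succ k ρ ⟨i + 1, by omega⟩
      simp only [Fin.succ_mk] at e1 e2
      rw [e1, e2, Fin.succAbove_lt_succAbove_iff] at this
      exact this
    · split_ifs with hA
      · have := h1 0 (by omega) hA
        have e1 := consP_succ k ρ ⟨0, by omega⟩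
        simp only [Fin.succ_mk] at e1
        have e2 : consP k ρ ⟨0, by omega⟩ = k := consP_zero k ρ
        rw [e1, e2, Fin.lt_succAbove_iff_le_castSucc] at this
        exact this
      · omega
  · rintro ⟨h0, h1, h2⟩
    refine ⟨fun i hi hA => ?_, fun _ => h0⟩
    cases i with
    | zero =>
      have hA' : A p := hA
      have e1 := consP_succ k ρ ⟨0, by omega⟩
      simp only [Fin.succ_mk] at e1
      have e2 : consP k ρ ⟨0, by omega⟩ = k := consP_zero k ρ
      rw [e1, e2, Fin.lt_succAbove_iff_le_castSucc]
      have := h2 (by omega)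
      rw [if_pos hA'] at this
      exact this
    | succ i =>
      have := h1 i (by omega) (by convert hA using 1; omega)
      have e1 := consP_succ k ρ ⟨i, by omega⟩
      have e2 := consP_succ k ρ ⟨i + 1, by omega⟩
      simp only [Fin.succ_mk] at e1 e2
      rw [e1, e2, Fin.succAbove_lt_succAbove_iff]
      exact this

lemma G_zero (A : ℕ → Prop) (p c : ℕ) : G A 0 p c = 1 := by
  classical
  unfold G
  rw [Finset.filter_true_of_mem]
  · simp [invF]
  · intro π _
    exact ⟨fun i h => by omega, fun h => by omega⟩

open Classical in
lemma G_succ (A : ℕ → Prop) (l p c : ℕ) : G A (l + 1) p c =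
    ∑ k ∈ Finset.Ico c (l + 1), (X ^ 2) ^ k * G A l (p + 1) (if A p then k else 0) := by
  unfold G
  rw [Finset.sum_filter, ← (consP_bij l).sum_comp, Fintype.sum_prod_type]
  simp only [okP_consP, invF_consP]
  have : ∀ f : ℕ → Polynomial ℤ, ∑ k ∈ Finset.Ico c (l + 1), f k =
      ∑ k : Fin (l + 1), if c ≤ k.1 then f k.1 else 0 := by
    intro f
    rw [Fin.sum_univ_eq_sum_range (fun k => if c ≤ k then f k else 0) (l + 1),
      ← Finset.sum_filter]
    apply Finset.sum_congr _ fun _ _ => rfl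
    ext k; simp; omega
  rw [this]
  refine Finset.sum_congr rfl fun k _ => ?_
  by_cases hc : c ≤ k.1
  · simp only [hc, true_and, if_true]
    rw [Finset.mul_sum, ← Finset.sum_filter]
    refine Finset.sum_congr rfl fun ρ _ => ?_
    rw [pow_add]
  · simp [hc]

/-- telescoping step -/
lemma tele (q : Polynomial ℤ) (t l c : ℕ) (ht : t ≤ l) :
    ∏ i ∈ range (t + 1), (q ^ c - q ^ (l + 1 - i)) -
      ∏ i ∈ range (t + 1), (q ^ (c + 1) - q ^ (l + 1 - i)) =
    q ^ c * (1 - q ^ (t + 1)) * ∏ i ∈ range t, (q ^ c - q ^ (l - i)) := by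
  have e1 : ∏ i ∈ range (t + 1), (q ^ c - q ^ (l + 1 - i)) =
      (∏ i ∈ range t, (q ^ c - q ^ (l - i))) * (q ^ c - q ^ (l + 1)) := by
    rw [Finset.prod_range_succ']
    simp
  have e2 : ∏ i ∈ range (t + 1), (q ^ (c + 1) - q ^ (l + 1 - i)) =
      q ^ t * (∏ i ∈ range t, (q ^ c - q ^ (l - i))) * (q ^ (c + 1) - q ^ (l + 1 - t)) := by
    rw [Finset.prod_range_succ]
    congr 1
    have : q ^ t = ∏ i ∈ range t, q := by simp
    rw [this, ← Finset.prod_mul_distrib]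
    refine Finset.prod_congr rfl fun i hi => ?_
    have := mem_range.1 hi
    rw [show l + 1 - i = (l - i) + 1 by omega]
    ring
  rw [e1, e2]
  have : q ^ (l + 1) = q ^ t * q ^ (l + 1 - t) := by
    rw [← pow_add]; congr 1; omega
  rw [this]
  ring

lemma sum_tele (q : Polynomial ℤ) (t l c : ℕ) (ht : t ≤ l) (hc : c ≤ l + 1) :
    ∑ k ∈ Finset.Ico c (l + 1), q ^ k * (1 - q ^ (t + 1)) * ∏ i ∈ range t, (q ^ k - q ^ (l - i)) =
      ∏ i ∈ range (t + 1), (q ^ c - q ^ (l + 1 - i)) := by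
  have h1 : ∀ k ∈ Finset.Ico c (l + 1),
      q ^ k * (1 - q ^ (t + 1)) * ∏ i ∈ range t, (q ^ k - q ^ (l - i)) =
      -(∏ i ∈ range (t + 1), (q ^ (k + 1) - q ^ (l + 1 - i)) -
        ∏ i ∈ range (t + 1), (q ^ k - q ^ (l + 1 - i))) := by
    intro k _
    rw [← tele q t l k ht]; ring
  rw [Finset.sum_congr rfl h1, Finset.sum_neg_distrib, 
    Finset.sum_Ico_sub (fun k => ∏ i ∈ range (t + 1), (q ^ k - q ^ (l + 1 - i))) hc]
  have : ∏ i ∈ range (t + 1), (q ^ (l + 1) - q ^ (l + 1 - i)) = 0 :=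
    Finset.prod_eq_zero (i := 0) (by simp) (by simp)
  rw [this]; ring

/-- product `(1-q)...(1-q^k)` -/
noncomputable def QQ (k : ℕ) : Polynomial ℤ := ∏ i ∈ Finset.Icc 1 k, (1 - (X ^ 2) ^ i)

lemma QQ_succ (k : ℕ) : QQ (k + 1) = QQ k * (1 - (X ^ 2) ^ (k + 1)) := by
  unfold QQ
  rw [Finset.prod_Icc_succ_top (by omega)]

lemma block (A : ℕ → Prop) (t : ℕ) : ∀ (l p c : ℕ), t + 1 ≤ l → c ≤ l →
    (∀ i, i < t → A (p + i)) → ¬ A (p + t) →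
    QQ (t + 1) * G A l p c =
      (∏ i ∈ range (t + 1), ((X ^ 2) ^ c - (X ^ 2) ^ (l - i))) * G A (l - (t + 1)) (p + (t + 1)) 0 := by
  classical
  induction t with
  | zero =>
    intro l p c hl hc hA hA'
    obtain ⟨l, rfl⟩ : ∃ l', l = l' + 1 := ⟨l - 1, by omega⟩
    rw [G_succ]
    simp only [if_neg (show ¬ A p by simpa using hA')]
    rw [← sum_tele (X ^ 2) 0 l c (by omega) hc, Finset.sum_mul,
      Finset.mul_sum]
    refine Finset.sum_congr rfl fun k _ => ?_
    simp [QQ]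
    ring
  | succ t ih =>
    intro l p c hl hc hA hA'
    obtain ⟨l, rfl⟩ : ∃ l', l = l' + 1 := ⟨l - 1, by omega⟩
    rw [G_succ]
    simp only [if_pos (show A p by simpa using hA 0 (by omega))]
    rw [← sum_tele (X ^ 2) (t + 1) l c (by omega) hc, Finset.sum_mul,
      Finset.mul_sum]
    refine Finset.sum_congr rfl fun k hk => ?_
    have hk' := Finset.mem_Ico.1 hk
    have h := ih l (p + 1) k (by omega) (by omega)
      (fun i hi => by have := hA (i + 1) (by omega); convert this using 1; omega)
      (by convert hA' using 2; omega)
    rw [QQ_succ]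
    rw [show l + 1 - (t + 1 + 1) = l - (t + 1) by omega, show p + (t + 1 + 1) = p + 1 + (t + 1) by omega]
    linear_combination ((X ^ 2) ^ k * (1 - (X ^ 2) ^ (t + 1 + 1))) * h

lemma QQ_split (t : ℕ) : ∀ l, t ≤ l →
    (∏ i ∈ range t, (1 - (X ^ 2 : Polynomial ℤ) ^ (l - i))) * QQ (l - t) = QQ l := by
  induction t with
  | zero => intro l _; simp
  | succ t ih =>
    intro l hl
    rw [Finset.prod_range_succ, ← ih l (by omega), show l - t = l - (t + 1) + 1 by omega, QQ_succ]
    ring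

lemma blocks_zero (A : ℕ → Prop) (s : ℕ) (t : ℕ → ℕ)
    (h1 : ∀ k ≤ s, 1 ≤ t k)
    (h2 : ∀ k ≤ s, ∀ i, i + 1 < t k → A ((∑ j ∈ range k, t j) + i))
    (h3 : ∀ k ≤ s, ¬ A ((∑ j ∈ range k, t j) + (t k - 1))) (e : ℕ) :
    ∀ d, d + e = s + 1 →
    (∏ k ∈ range e, QQ (t (d + k))) *
      G A (∑ k ∈ range e, t (d + k)) (∑ j ∈ range d, t j) 0 = QQ (∑ k ∈ range e, t (d + k)) := by
  induction e with
  | zero => intro d _; simp [G_zero, QQ]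
  | succ e ih =>
    intro d hd
    have hd' : d ≤ s := by omega
    have ih' := ih (d + 1) (by omega)
    have hb := block A (t d - 1) (∑ k ∈ range (e + 1), t (d + k)) (∑ j ∈ range d, t j) 0
      (by rw [Finset.sum_range_succ']; have := h1 d hd'; simp only [add_zero]; omega)
      (by omega) (fun i hi => h2 d hd' i (by omega)) (h3 d hd')
    have ht : t d - 1 + 1 = t d := by have := h1 d hd'; omega
    have hS : ∑ k ∈ range (e + 1), t (d + k) = ∑ k ∈ range e, t (d + 1 + k) + t d := by
      rw [Finset.sum_range_succ']
      simp only [add_zero]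
      congr 1
      refine Finset.sum_congr rfl fun k _ => ?_
      congr 1; omega
    have hP : ∏ k ∈ range (e + 1), QQ (t (d + k)) = (∏ k ∈ range e, QQ (t (d + 1 + k))) * QQ (t d) := by
      rw [Finset.prod_range_succ']
      simp only [add_zero]
      congr 1
      refine Finset.prod_congr rfl fun k _ => ?_
      congr 2; omega
    rw [ht] at hb
    rw [hP, mul_assoc, hb, ← QQ_split (t d) _ (by rw [hS]; omega)]
    rw [hS]
    rw [Finset.sum_range_succ] at ih'
    simp only [Nat.add_sub_cancel, pow_zero]
    rw [← ih']
    ring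

lemma blocks (A : ℕ → Prop) (s : ℕ) (t : ℕ → ℕ)
    (h1 : ∀ k ≤ s, 1 ≤ t k)
    (h2 : ∀ k ≤ s, ∀ i, i + 1 < t k → A ((∑ j ∈ range k, t j) + i))
    (h3 : ∀ k ≤ s, ¬ A ((∑ j ∈ range k, t j) + (t k - 1))) (m : ℕ)
    (hm : m = ∑ k ∈ range (s + 1), t k) (c : ℕ) (hc : c ≤ m) :
    (∏ k ∈ range (s + 1), QQ (t k)) * G A m 0 c =
      (∏ i ∈ range (t 0), ((X ^ 2) ^ c - (X ^ 2) ^ (m - i))) * QQ (m - t 0) := by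
  have hz := blocks_zero A s t h1 h2 h3 s 1 (by omega)
  have hS : m = ∑ k ∈ range s, t (1 + k) + t 0 := by
    rw [hm, Finset.sum_range_succ']
    simp only [add_comm]
  have hP : ∏ k ∈ range (s + 1), QQ (t k) = (∏ k ∈ range s, QQ (t (1 + k))) * QQ (t 0) := by
    rw [Finset.prod_range_succ']
    simp only [add_comm]
  have hb := block A (t 0 - 1) m 0 c (by have := h1 0 (by omega); omega) hc
    (fun i hi => by simpa using h2 0 (by omega) i (by omega)) (by simpa using h3 0 (by omega))
  have ht : t 0 - 1 + 1 = t 0 := by have := h1 0 (by omega); omega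
  rw [ht] at hb
  rw [hP, mul_assoc, hb]
  have e : m - t 0 = ∑ k ∈ range s, t (1 + k) := by omega
  simp only [Finset.sum_range_one] at hz
  rw [e, zero_add, ← hz]
  ring

/-- weighted sum over sign sets -/
noncomputable def SS (n : ℕ) (g : ℕ → Polynomial ℤ) : Polynomial ℤ :=
  ∑ N : Fin n → Bool,
    (∏ k : Fin n, if N k then (-1 : Polynomial ℤ) ^ k.1 * X ^ ((k.1 + 1) / 2) else 1) * g (nuN N)

lemma nuN_snoc {n : ℕ} (N : Fin n → Bool) (e : Bool) :
    nuN (Fin.snoc N e : Fin (n + 1) → Bool) = nuN N + if e then 1 else 0 := by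
  unfold nuN
  rw [Finset.card_filter, Finset.card_filter, Fin.sum_univ_castSucc]
  simp

lemma SS_succ (n : ℕ) (g : ℕ → Polynomial ℤ) :
    SS (n + 1) g = SS n g + (-1) ^ n * X ^ ((n + 1) / 2) * SS n (fun ν => g (ν + 1)) := by
  unfold SS
  rw [← Equiv.sum_comp (Fin.snocEquiv (fun _ : Fin (n + 1) => Bool)), Fintype.sum_prod_type]
  simp only [Fintype.sum_bool, Fin.snocEquiv_apply]
  rw [add_comm, Finset.mul_sum]
  congr 1
  · refine Finset.sum_congr rfl fun N _ => ?_
    have hN := nuN_snoc N false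
    change _ * g (nuN (Fin.snoc N false : Fin (n + 1) → Bool)) = _
    rw [Fin.prod_univ_castSucc, hN]
    simp
  · refine Finset.sum_congr rfl fun N _ => ?_
    have hN := nuN_snoc N true
    change _ * g (nuN (Fin.snoc N true : Fin (n + 1) → Bool)) = _
    rw [Fin.prod_univ_castSucc, hN]
    simp
    ring

lemma SS_zero (g : ℕ → Polynomial ℤ) : SS 0 g = g 0 := by
  simp [SS, nuN]

lemma SS_mul (n : ℕ) (c : Polynomial ℤ) (g : ℕ → Polynomial ℤ) :
    SS n (fun ν => c * g ν) = c * SS n g := by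
  unfold SS
  rw [Finset.mul_sum]
  refine Finset.sum_congr rfl fun N _ => by ring

lemma SS_sub (n : ℕ) (f g : ℕ → Polynomial ℤ) :
    SS n (fun ν => f ν - g ν) = SS n f - SS n g := by
  unfold SS
  rw [← Finset.sum_sub_distrib]
  refine Finset.sum_congr rfl fun N _ => by ring

lemma SS_odd (z : Polynomial ℤ) (g : ℕ → Polynomial ℤ) (hg : ∀ ν, g (ν + 2) = z * g ν) (k : ℕ) :
    SS (2 * k + 1) g = (g 0 + g 1) * ∏ j ∈ range k, (1 - (X ^ 2) ^ (j + 1) * z) := by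
  induction k with
  | zero => simp [SS_succ, SS_zero]
  | succ k ih =>
    rw [show 2 * (k + 1) + 1 = 2 * k + 2 + 1 by ring, SS_succ (2 * k + 2),
      show 2 * k + 2 = 2 * k + 1 + 1 by ring, SS_succ (2 * k + 1), SS_succ (2 * k + 1)]
    have hgg : (fun ν => g (ν + 1 + 1)) = fun ν => z * g ν := by funext ν; exact hg ν
    simp only [hgg, SS_mul]
    rw [Finset.prod_range_succ, ← mul_assoc (g 0 + g 1), ← ih]
    have e1 : (2 * k + 1 + 1) / 2 = k + 1 := by omega
    have e2 : (2 * k + 1 + 1 + 1) / 2 = k + 1 := by omega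
    have e3 : (-1 : Polynomial ℤ) ^ (2 * k + 1) = -1 := Odd.neg_one_pow ⟨k, rfl⟩
    have e4 : (-1 : Polynomial ℤ) ^ (2 * k + 1 + 1) = 1 := Even.neg_one_pow ⟨k + 1, by ring⟩
    rw [e1, e2, e3, e4]
    ring

lemma SS_even (z : Polynomial ℤ) (k : ℕ) :
    SS (2 * k + 2) (fun ν => z ^ ((ν + 1) / 2)) =
      (1 + z - 2 * X ^ (k + 1) * z) * ∏ j ∈ range k, (1 - (X ^ 2) ^ (j + 1) * z) := by
  rw [show 2 * k + 2 = 2 * k + 1 + 1 by ring, SS_succ,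
    SS_odd z (fun ν => z ^ ((ν + 1) / 2)) (fun ν => by
      rw [show (ν + 2 + 1) / 2 = (ν + 1) / 2 + 1 by omega]; ring),
    SS_odd z (fun ν => z ^ ((ν + 1 + 1) / 2)) (fun ν => by
      rw [show (ν + 2 + 1 + 1) / 2 = (ν + 1 + 1) / 2 + 1 by omega]; ring)]
  have e1 : (2 * k + 1 + 1) / 2 = k + 1 := by omega
  have e3 : (-1 : Polynomial ℤ) ^ (2 * k + 1) = -1 := Odd.neg_one_pow ⟨k, rfl⟩
  rw [e1, e3]
  norm_num
  ring

/-- shifted factorial -/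
noncomputable def PR (r : ℕ) (y : Polynomial ℤ) : Polynomial ℤ := ∏ j ∈ range r, (1 - (X ^ 2) ^ j * y)

lemma PR_top (r : ℕ) (y : Polynomial ℤ) : PR (r + 1) y = PR r y * (1 - (X ^ 2) ^ r * y) := by
  unfold PR; rw [Finset.prod_range_succ]

lemma PR_bot (r : ℕ) (y : Polynomial ℤ) : PR (r + 1) y = PR r (X ^ 2 * y) * (1 - y) := by
  unfold PR; rw [Finset.prod_range_succ']
  simp only [pow_zero, one_mul]
  congr 1
  refine Finset.prod_congr rfl fun j _ => ?_
  ring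

lemma FF (m α : ℕ) (hα : α < m) : ∀ z : Polynomial ℤ,
    SS (2 * m) (fun ν => (∏ i ∈ range α, ((X ^ 2) ^ ((ν + 1) / 2) - (X ^ 2) ^ (m - i))) *
      z ^ ((ν + 1) / 2)) =
    (∏ i ∈ range α, (1 - (X ^ 2) ^ (m - i))) * PR (m - α) ((X ^ 2) ^ α * z) +
      2 * (1 - X ^ m) * z * (X ^ 2) ^ α * (∏ i ∈ range α, (1 - (X ^ 2) ^ (m - 1 - i))) *
        PR (m - 1 - α) ((X ^ 2) ^ (α + 1) * z) := by
  induction α with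
  | zero =>
    intro z
    obtain ⟨k, rfl⟩ : ∃ k, m = k + 1 := ⟨m - 1, by omega⟩
    simp only [range_zero, prod_empty, one_mul, pow_zero, mul_one, Nat.sub_zero, zero_add, pow_one,
      Nat.add_sub_cancel]
    rw [show 2 * (k + 1) = 2 * k + 2 by ring, SS_even, PR_bot]
    have : PR k (X ^ 2 * z) = ∏ j ∈ range k, (1 - (X ^ 2) ^ (j + 1) * z) := by
      unfold PR
      refine Finset.prod_congr rfl fun j _ => by ring
    rw [this]; ring
  | succ α ih =>
    intro z
    have h1 := ih (by omega) (X ^ 2 * z)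
    have h2 := ih (by omega) z
    have e : (fun ν => (∏ i ∈ range (α + 1), ((X ^ 2 : Polynomial ℤ) ^ ((ν + 1) / 2) - (X ^ 2) ^ (m - i))) *
        z ^ ((ν + 1) / 2)) = fun ν =>
        (∏ i ∈ range α, ((X ^ 2) ^ ((ν + 1) / 2) - (X ^ 2) ^ (m - i))) * (X ^ 2 * z) ^ ((ν + 1) / 2) -
        (X ^ 2) ^ (m - α) * ((∏ i ∈ range α, ((X ^ 2) ^ ((ν + 1) / 2) - (X ^ 2) ^ (m - i))) *
          z ^ ((ν + 1) / 2)) := by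
      funext ν
      rw [Finset.prod_range_succ, mul_pow]
      ring
    rw [e, SS_sub, SS_mul, h1, h2]
    obtain ⟨r, rfl⟩ : ∃ r, m = α + r + 2 := ⟨m - α - 2, by omega⟩
    rw [Finset.prod_range_succ, Finset.prod_range_succ]
    rw [show α + r + 2 - α = r + 1 + 1 by omega, show α + r + 2 - 1 - α = r + 1 by omega,
      show α + r + 2 - (α + 1) = r + 1 by omega, show α + r + 2 - 1 - (α + 1) = r by omega]
    rw [PR_top (r + 1), PR_bot (r + 1) ((X ^ 2) ^ α * z), PR_top r ((X ^ 2) ^ (α + 1) * (X ^ 2 * z)),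
      PR_bot r ((X ^ 2) ^ (α + 1) * z)]
    have g1 : (X ^ 2 : Polynomial ℤ) ^ α * (X ^ 2 * z) = (X ^ 2) ^ (α + 1) * z := by ring
    have g2 : (X ^ 2 : Polynomial ℤ) * ((X ^ 2) ^ α * z) = (X ^ 2) ^ (α + 1) * z := by ring
    have g3 : (X ^ 2 : Polynomial ℤ) ^ (α + 1) * (X ^ 2 * z) = (X ^ 2) ^ (α + 1 + 1) * z := by ring
    have g4 : (X ^ 2 : Polynomial ℤ) * ((X ^ 2) ^ (α + 1) * z) = (X ^ 2) ^ (α + 1 + 1) * z := by ring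
    rw [g1, g2, g3, g4, PR_bot r ((X ^ 2) ^ (α + 1) * z), g4]
    ring

lemma KK (m α : ℕ) (hα : α < m) :
    (1 + X ^ m) *
    SS (2 * m) (fun ν => (∏ i ∈ range α, ((X ^ 2) ^ ((ν + 1) / 2) - (X ^ 2) ^ (m - i)))) =
    (∏ i ∈ range α, (1 - (X ^ 2) ^ (m - i))) * (1 - X ^ m) * (1 + X ^ (2 * α) + 2 * X ^ m) *
      ∏ j ∈ range (m - 1 - α), (1 - (X ^ 2) ^ (α + 1 + j)) := by
  have h := FF m α hα 1
  simp only [one_pow, mul_one] at h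
  rw [h]
  have hd : (∏ i ∈ range α, (1 - (X ^ 2 : Polynomial ℤ) ^ (m - 1 - i))) * (1 - (X ^ 2) ^ m) =
      (∏ i ∈ range α, (1 - (X ^ 2) ^ (m - i))) * (1 - (X ^ 2) ^ (m - α)) := by
    rw [← Finset.prod_range_succ, Finset.prod_range_succ']
    simp only [Nat.sub_zero]
    congr 1
    refine Finset.prod_congr rfl fun i _ => ?_
    rw [Nat.sub_sub, add_comm 1 i]
  have hP : PR (m - 1 - α) ((X ^ 2) ^ (α + 1)) =
      ∏ j ∈ range (m - 1 - α), (1 - (X ^ 2) ^ (α + 1 + j)) := by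
    unfold PR
    refine Finset.prod_congr rfl fun j _ => by ring
  rw [← hP]
  rw [show m - α = m - 1 - α + 1 by omega] at hd ⊢
  rw [PR_bot]
  have g2 : (X ^ 2 : Polynomial ℤ) * ((X ^ 2) ^ α) = (X ^ 2) ^ (α + 1) := by ring
  have g5 : (X ^ 2 : Polynomial ℤ) ^ α * (X ^ 2) ^ (m - 1 - α + 1) = (X ^ 2) ^ m := by
    rw [← pow_add]; congr 1; omega
  rw [g2]
  have hx : (X ^ 2 : Polynomial ℤ) ^ m = X ^ m * X ^ m := by rw [← pow_mul, ← pow_add]; congr 1; omega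
  have hy : (X : Polynomial ℤ) ^ (2 * α) = (X ^ 2) ^ α := by rw [pow_mul]
  rw [hx] at hd g5
  rw [hy]
  linear_combination (2 * (X ^ 2) ^ α * PR (m - 1 - α) ((X ^ 2) ^ (α + 1))) * hd -
    2 * (∏ i ∈ range α, (1 - (X ^ 2) ^ (m - i))) * PR (m - 1 - α) ((X ^ 2) ^ (α + 1)) * g5

lemma last_prod (α : ℕ) (d : ℕ) :
    ∏ i ∈ Finset.Icc (2 * α + 2) (2 * (α + d + 1)), (1 + (-1 : Polynomial ℤ) ^ (i - 1) * X ^ (i / 2)) =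
      (1 - X ^ (α + d + 1)) * ∏ j ∈ range d, (1 - (X ^ 2) ^ (α + 1 + j)) := by
  induction d with
  | zero =>
    have e : (-1 : Polynomial ℤ) ^ (2 * α + 1) = -1 := Odd.neg_one_pow ⟨α, rfl⟩
    have e1 : (2 * α + 2) / 2 = α + 1 := by omega
    rw [show 2 * (α + 0 + 1) = 2 * α + 2 by ring, Finset.Icc_self]
    simp [e, e1]
    ring
  | succ d ih =>
    rw [show 2 * (α + (d + 1) + 1) = 2 * (α + d + 1) + 1 + 1 by ring,
      Finset.prod_Icc_succ_top (by omega), Finset.prod_Icc_succ_top (by omega), ih,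
      Finset.prod_range_succ]
    have e1 : (2 * (α + d + 1) + 1) / 2 = α + d + 1 := by omega
    have e2 : (2 * (α + d + 1) + 1 + 1) / 2 = α + d + 2 := by omega
    have e3 : (-1 : Polynomial ℤ) ^ (2 * (α + d + 1) + 1 - 1) = 1 :=
      Even.neg_one_pow ⟨α + d + 1, by omega⟩
    have e4 : (-1 : Polynomial ℤ) ^ (2 * (α + d + 1) + 1 + 1 - 1) = -1 :=
      Odd.neg_one_pow ⟨α + d + 1, by omega⟩
    rw [e1, e2, e3, e4]
    ring

lemma QQ_qfact (k : ℕ) : QQ k = (1 - X ^ 2) ^ k * qfact (X ^ 2) k := by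
  unfold QQ qfact
  have : (1 - X ^ 2 : Polynomial ℤ) ^ k = ∏ i ∈ Finset.Icc 1 k, (1 - X ^ 2) := by simp
  rw [this, ← Finset.prod_mul_distrib]
  refine Finset.prod_congr rfl fun i _ => ?_
  rw [mul_neg_geom_sum]

lemma nuN_le {n : ℕ} (N : Fin n → Bool) : nuN N ≤ n := by
  unfold nuN
  exact (Finset.card_le_univ _).trans (by simp)

lemma main_formula (m s : ℕ) (t : ℕ → ℕ) (I : Finset ℕ)
    (hI : I ⊆ Finset.range (m * 2)) (h0 : 0 ∈ I)
    (hodd : ∀ j ∈ Finset.Icc 1 (m * 2 - 1), Odd j → j ∈ I)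
    (h1 : ∀ k ≤ s, 1 ≤ t k)
    (h2 : ∀ k ≤ s, ∀ i, i + 1 < t k → 2 * ((∑ j ∈ range k, t j) + i + 1) ∈ I)
    (h3 : ∀ k ≤ s, 2 * ((∑ j ∈ range k, t j) + (t k - 1) + 1) ∉ I)
    (hm : m = ∑ k ∈ range (s + 1), t k) (ht : t 0 < m) :
    (1 + X ^ m) * (∏ k ∈ range (s + 1), qfact (X ^ 2) (t k)) * genD (m * 2) I =
      qfact (X ^ 2) m * (1 + X ^ (2 * t 0) + 2 * X ^ m) *
        ∏ i ∈ Finset.Icc (2 * t 0 + 2) (m * 2),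
          (1 + (-1 : Polynomial ℤ) ^ (i - 1) * X ^ (i / 2)) := by
  have hq : (1 - X ^ 2 : Polynomial ℤ) ^ m ≠ 0 := by
    apply pow_ne_zero
    intro h
    have := congrArg (fun f => Polynomial.eval 2 f) h
    simp at this
  apply mul_left_cancel₀ hq
  have e1 : (1 - X ^ 2 : Polynomial ℤ) ^ m * ∏ k ∈ range (s + 1), qfact (X ^ 2) (t k) =
      ∏ k ∈ range (s + 1), QQ (t k) := by
    conv_lhs => rw [hm]
    rw [← Finset.prod_pow_eq_pow_sum, ← Finset.prod_mul_distrib]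
    exact Finset.prod_congr rfl fun k _ => (QQ_qfact _).symm
  have e2 : (∏ k ∈ range (s + 1), QQ (t k)) * genD (m * 2) I =
      SS (2 * m) (fun ν => (∏ i ∈ range (t 0), ((X ^ 2) ^ ((ν + 1) / 2) - (X ^ 2) ^ (m - i)))) *
        QQ (m - t 0) := by
    rw [genD_eq_G I (by omega) hI h0 hodd, mul_comm 2 m, SS, Finset.mul_sum, Finset.sum_mul]
    refine Finset.sum_congr rfl fun N _ => ?_
    have hb := blocks (fun j => 2 * (j + 1) ∈ I) s t h1 h2 h3 m hm ((nuN N + 1) / 2)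
      (by have := nuN_le N; omega)
    linear_combination
      (∏ k : Fin (m * 2), if N k then (-1 : Polynomial ℤ) ^ k.1 * X ^ ((k.1 + 1) / 2) else 1) * hb
  have e3 := KK m (t 0) ht
  have e4 := last_prod (t 0) (m - 1 - t 0)
  rw [show t 0 + (m - 1 - t 0) + 1 = m by omega, mul_comm 2 m] at e4
  rw [e4]
  have e5 := QQ_split (t 0) m ht.le
  have e6 := QQ_qfact m
  linear_combination (1 + X ^ m) * genD (m * 2) I * e1 + (1 + X ^ m) * e2 + QQ (m - t 0) * e3 +
    (1 + X ^ (2 * t 0) + 2 * X ^ m) * (1 - X ^ m) *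
      (∏ j ∈ range (m - 1 - t 0), (1 - (X ^ 2) ^ (t 0 + 1 + j))) * (e5 + e6)

lemma structure_facts (n s : ℕ) (hn : 0 < n) (hneven : Even n)
    (a b : ℕ → ℕ) (I : Finset ℕ) (ha0 : a 0 = 0)
    (hab : ∀ k ∈ Finset.range (s + 1), a k ≤ b k)
    (hbn : ∀ k ∈ Finset.range (s + 1), b k ≤ n - 1)
    (hsep : ∀ k ∈ Finset.range s, b k + 1 < a (k + 1))
    (hI : I = (Finset.range (s + 1)).biUnion (fun k => Finset.Icc (a k) (b k)))
    (hodd : ∀ j ∈ Finset.Icc 1 (n - 1), Odd j → j ∈ I) :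
    (∀ k ≤ s, b k + 1 = 2 * ∑ j ∈ range (k + 1), (b j - a j + 2) / 2) ∧
    (∀ k ≤ s, a k ≤ 2 * (∑ j ∈ range k, (b j - a j + 2) / 2) + 1) ∧
    (∀ k ≤ s, b k + 1 ∉ I) ∧ b s + 1 = n := by
  have hmem : ∀ x, x ∈ I ↔ ∃ k ≤ s, a k ≤ x ∧ x ≤ b k := by
    intro x; rw [hI]; simp
  have hab' : ∀ k ≤ s, a k ≤ b k := fun k hk => hab k (by simp; omega)
  have hbn' : ∀ k ≤ s, b k ≤ n - 1 := fun k hk => hbn k (by simp; omega)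
  have hsep' : ∀ k < s, b k + 1 < a (k + 1) := fun k hk => hsep k (by simp; omega)
  have mono : ∀ d k, k + d + 1 ≤ s → b k + 1 < a (k + d + 1) := by
    intro d
    induction d with
    | zero => intro k hk; exact hsep' k (by omega)
    | succ d ih =>
      intro k hk
      have h1 := ih k (by omega)
      have h2 := hab' (k + d + 1) (by omega)
      have h3 := hsep' (k + d + 1) (by omega)
      rw [show k + (d + 1) + 1 = k + d + 1 + 1 by omega]
      omega
  have mono' : ∀ j k, j < k → k ≤ s → b j + 1 < a k := by
    intro j k h hk
    have := mono (k - j - 1) j (by omega)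
    rwa [show j + (k - j - 1) + 1 = k by omega] at this
  have hnot : ∀ k ≤ s, b k + 1 ∉ I := by
    intro k hk h
    obtain ⟨j, hj, h1, h2⟩ := (hmem _).1 h
    rcases lt_trichotomy j k with h' | h' | h'
    · have := mono' j k h' hk; have := hab' k hk; omega
    · subst h'; omega
    · have := mono' k j h' hj; omega
  obtain ⟨r, hr⟩ := hneven
  have hbodd : ∀ k ≤ s, b k % 2 = 1 := by
    intro k hk
    by_contra hne
    have := hbn' k hk
    exact hnot k hk (hodd _ (by simp; omega) (by rw [Nat.odd_iff]; omega))
  have hanext : ∀ k < s, a (k + 1) = b k + 2 := by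
    intro k hk
    have h1 := hsep' k hk
    have h2 := hab' (k + 1) (by omega)
    have h3 := hbn' (k + 1) (by omega)
    have h4 := hbodd k (by omega)
    obtain ⟨j, hj, h5, h6⟩ := (hmem _).1 (hodd (b k + 2) (by simp; omega) (by rw [Nat.odd_iff]; omega))
    rcases lt_trichotomy j (k + 1) with h' | h' | h'
    · have : b j ≤ b k := by
        rcases Nat.lt_or_ge j k with h'' | h''
        · have := mono' j k h'' (by omega); have := hab' k (by omega); omega
        · have : j = k := by omega
          rw [this]
      omega
    · subst h'; omega
    · have := mono' (k + 1) j h' hj; omega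
  have hbs : b s + 1 = n := by
    by_contra hne
    have h3 := hbn' s le_rfl
    have h4 := hbodd s le_rfl
    obtain ⟨j, hj, h5, h6⟩ := (hmem _).1 (hodd (b s + 2) (by simp; omega) (by rw [Nat.odd_iff]; omega))
    have : b j ≤ b s := by
      rcases Nat.lt_or_ge j s with h'' | h''
      · have := mono' j s h'' (by omega); have := hab' s (by omega); omega
      · have : j = s := by omega
        rw [this]
    omega
  have hT : ∀ k ≤ s, b k + 1 = 2 * ∑ j ∈ range (k + 1), (b j - a j + 2) / 2 := by
    intro k
    induction k with
    | zero =>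
      intro hk
      have := hbodd 0 hk
      simp [ha0]; omega
    | succ k ih =>
      intro hk
      have h1 := ih (by omega)
      have h2 := hanext k (by omega)
      have h3 := hab' (k + 1) hk
      have h4 := hbodd (k + 1) hk
      have h5 := hbodd k (by omega)
      rw [Finset.sum_range_succ]
      omega
  refine ⟨hT, ?_, hnot, hbs⟩
  intro k hk
  cases k with
  | zero => omega
  | succ k =>
    have h1 := hT k (by omega)
    have h2 := hanext k (by omega)
    omega

lemma stmt_part1 (n s : ℕ) (hn : 0 < n) (hneven : Even n)
    (a b : ℕ → ℕ) (I : Finset ℕ) (ha0 : a 0 = 0)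
    (hab : ∀ k ∈ Finset.range (s + 1), a k ≤ b k)
    (hbn : ∀ k ∈ Finset.range (s + 1), b k ≤ n - 1)
    (hsep : ∀ k ∈ Finset.range s, b k + 1 < a (k + 1))
    (hI : I = (Finset.range (s + 1)).biUnion (fun k => Finset.Icc (a k) (b k)))
    (hproper : I ≠ Finset.range n)
    (hodd : ∀ j ∈ Finset.Icc 1 (n - 1), Odd j → j ∈ I)
    (m : ℕ) (hm : m = ∑ k ∈ Finset.range (s + 1), (b k - a k + 2) / 2) :
    ((1 + X ^ (n / 2)) *
        (∏ k ∈ Finset.range (s + 1), qfact (X ^ 2) ((b k - a k + 2) / 2)) *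
        genD n I =
      qfact (X ^ 2) m * (1 + X ^ (b 0 + 1) + 2 * X ^ (n / 2)) *
        ∏ i ∈ Finset.Icc (b 0 + 3) n,
          (1 + (-1 : Polynomial ℤ) ^ (i - 1) * X ^ (i / 2))) ∧
      n = m * 2 ∧ b 0 + 1 < n := by
  obtain ⟨f1, f2, f3, f4⟩ := structure_facts n s hn hneven a b I ha0 hab hbn hsep hI hodd
  have hmem : ∀ x, x ∈ I ↔ ∃ k ≤ s, a k ≤ x ∧ x ≤ b k := by
    intro x; rw [hI]; simp
  have hn2 : n = m * 2 := by
    have := f1 s le_rfl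
    rw [← hm] at this
    omega
  have hs : 0 < s := by
    rcases Nat.eq_zero_or_pos s with h | h
    · exfalso
      subst h
      apply hproper
      ext x
      rw [hmem]
      simp only [mem_range]
      constructor
      · rintro ⟨k, hk, h1, h2⟩
        have : k = 0 := by omega
        subst this; omega
      · intro h; exact ⟨0, le_rfl, by omega, by omega⟩
    · exact h
  have hb0 : b 0 + 1 < n := by
    have h1 := hsep 0 (by simp; omega)
    have h2 := hab 1 (by simp; omega)
    have h3 := hbn 1 (by simp; omega)
    simp only [zero_add] at h1
    omega
  have ht0 : b 0 + 1 = 2 * ((b 0 - a 0 + 2) / 2) := by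
    have := f1 0 (by omega)
    simpa using this
  refine ⟨?_, hn2, hb0⟩
  subst hn2
  have key := main_formula m s (fun k => (b k - a k + 2) / 2) I
    (by
      intro x hx
      obtain ⟨k, hk, h1, h2⟩ := (hmem x).1 hx
      have := hbn k (by simp; omega)
      simp; omega)
    ((hmem 0).2 ⟨0, by omega, by omega, by omega⟩) hodd
    (by intro k _; omega)
    (by
      intro k hk i hi
      have h1 := f1 k hk
      have h2 := f2 k hk
      rw [Finset.sum_range_succ] at h1
      exact (hmem _).2 ⟨k, hk, by omega, by omega⟩)
    (by
      intro k hk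
      have h1 := f1 k hk
      rw [Finset.sum_range_succ] at h1
      have h3 := f3 k hk
      convert h3 using 2
      omega)
    hm (by omega)
  rw [← ht0] at key
  rw [show m * 2 / 2 = m by omega]
  exact key

/-- self-reciprocal up to sign -/
def SR (f : Polynomial ℤ) : Prop := f.reverse = f ∨ f.reverse = -f

lemma SR_mul {f g : Polynomial ℤ} (hf : SR f) (hg : SR g) : SR (f * g) := by
  unfold SR at *
  rw [reverse_mul_of_domain]
  rcases hf with h | h <;> rcases hg with h' | h' <;> rw [h, h'] <;> simp

lemma SR_cancel {f g : Polynomial ℤ} (h0 : f ≠ 0) (hf : SR f) (hfg : SR (f * g)) : SR g := by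
  unfold SR at *
  rw [reverse_mul_of_domain] at hfg
  rcases hf with h | h <;> rcases hfg with h' | h' <;> rw [h] at h'
  · left; exact mul_left_cancel₀ h0 h'
  · right; apply mul_left_cancel₀ h0; rw [h']; ring
  · right; apply mul_left_cancel₀ h0; linear_combination -h'
  · left; apply mul_left_cancel₀ h0; linear_combination -h'

lemma SR_one : SR 1 := by
  left; simpa using reverse_C (1 : ℤ)

lemma SR_prod {ι : Type*} (s : Finset ι) (f : ι → Polynomial ℤ) (h : ∀ i ∈ s, SR (f i)) :
    SR (∏ i ∈ s, f i) := by
  classical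
  induction s using Finset.induction_on with
  | empty => simpa using SR_one
  | insert a s ha ih =>
    rw [Finset.prod_insert ha]
    exact SR_mul (h a (by simp)) (ih fun i hi => h i (by simp [hi]))

lemma natDegree_binom (c : ℤ) (hc : c ≠ 0) (k : ℕ) (hk : 0 < k) :
    (1 + C c * X ^ k : Polynomial ℤ).natDegree = k := by
  rw [natDegree_add_eq_right_of_natDegree_lt, natDegree_C_mul_X_pow _ _ hc]
  rw [natDegree_C_mul_X_pow _ _ hc]; simpa using hk

lemma SR_binom (c : ℤ) (hc : c = 1 ∨ c = -1) (k : ℕ) (hk : 0 < k) :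
    SR (1 + C c * X ^ k : Polynomial ℤ) := by
  unfold SR
  have hr : (1 + C c * X ^ k : Polynomial ℤ).reverse = X ^ k + C c := by
    unfold reverse
    rw [natDegree_binom c (by rcases hc with h | h <;> rw [h] <;> norm_num) k hk, reflect_add,
      reflect_C_mul_X_pow, reflect_one]
    simp [revAt_le le_rfl]
  rw [hr]
  rcases hc with rfl | rfl
  · left; simp; ring
  · right; simp

lemma SR_one_add (k : ℕ) (hk : 0 < k) : SR (1 + X ^ k : Polynomial ℤ) := by
  have := SR_binom 1 (Or.inl rfl) k hk
  simpa using this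

lemma SR_neg {f : Polynomial ℤ} (h : SR f) : SR (-f) := by
  unfold SR at *
  rw [reverse_neg]
  rcases h with h | h <;> rw [h] <;> simp

lemma SR_pow_sub (k : ℕ) (hk : 0 < k) : SR (X ^ k - 1 : Polynomial ℤ) := by
  have := SR_neg (SR_binom (-1) (Or.inr rfl) k hk)
  have e : (X ^ k - 1 : Polynomial ℤ) = -(1 + C (-1) * X ^ k) := by simp; ring
  rw [e]; exact this

lemma SR_cyclotomic (k : ℕ) (hk : 0 < k) : SR (cyclotomic k ℤ) := by
  induction k using Nat.strong_induction_on with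
  | _ k ih =>
    have h := prod_cyclotomic_eq_X_pow_sub_one hk ℤ
    rw [← Nat.cons_self_properDivisors hk.ne', Finset.prod_cons, mul_comm] at h
    apply SR_cancel (f := ∏ x ∈ k.properDivisors, cyclotomic x ℤ)
    · exact Finset.prod_ne_zero_iff.2 fun i _ => cyclotomic_ne_zero i ℤ
    · apply SR_prod
      intro i hi
      rw [Nat.mem_properDivisors] at hi
      exact ih i hi.2 (Nat.pos_of_dvd_of_pos hi.1 hk)
    · rw [h]; exact SR_pow_sub k hk

lemma SR_cycprod {f : Polynomial ℤ} (h : IsCyclotomicProduct f) : SR f := by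
  obtain ⟨s, hs, rfl⟩ := h
  induction s using Multiset.induction_on with
  | empty => simpa using SR_one
  | cons a s ih =>
    rw [Multiset.map_cons, Multiset.prod_cons]
    exact SR_mul (SR_cyclotomic a (hs a (by simp))) (ih fun k hk => hs k (by simp [hk]))

lemma X_pow_sub_ne (k : ℕ) (hk : 0 < k) : (X ^ k - 1 : Polynomial ℤ) ≠ 0 := by
  simpa using X_pow_sub_C_ne_zero hk (1 : ℤ)

lemma SR_geom (i : ℕ) (hi : 0 < i) :
    SR (∑ j ∈ range i, (X ^ 2) ^ j : Polynomial ℤ) ∧ (∑ j ∈ range i, (X ^ 2) ^ j : Polynomial ℤ) ≠ 0 := by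
  have h : (X ^ 2 - 1 : Polynomial ℤ) * ∑ j ∈ range i, (X ^ 2) ^ j = X ^ (2 * i) - 1 := by
    rw [mul_geom_sum, pow_mul]
  constructor
  · apply SR_cancel (X_pow_sub_ne 2 (by norm_num)) (SR_pow_sub 2 (by norm_num))
    rw [h]; exact SR_pow_sub _ (by omega)
  · intro h0
    rw [h0, mul_zero] at h
    exact X_pow_sub_ne (2 * i) (by omega) h.symm

lemma SR_qfact (k : ℕ) : SR (qfact (X ^ 2) k) ∧ qfact (X ^ 2) k ≠ 0 := by
  unfold qfact
  constructor
  · exact SR_prod _ _ fun i hi => (SR_geom i (Finset.mem_Icc.1 hi).1).1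
  · exact Finset.prod_ne_zero_iff.2 fun i hi => (SR_geom i (Finset.mem_Icc.1 hi).1).2

lemma SR_last (u n : ℕ) (hu : 2 ≤ u) :
    SR (∏ i ∈ Finset.Icc u n, (1 + (-1 : Polynomial ℤ) ^ (i - 1) * X ^ (i / 2))) ∧
    (∏ i ∈ Finset.Icc u n, (1 + (-1 : Polynomial ℤ) ^ (i - 1) * X ^ (i / 2))) ≠ 0 := by
  have key : ∀ i ∈ Finset.Icc u n, SR (1 + (-1 : Polynomial ℤ) ^ (i - 1) * X ^ (i / 2)) ∧
      (1 + (-1 : Polynomial ℤ) ^ (i - 1) * X ^ (i / 2)) ≠ 0 := by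
    intro i hi
    have hi' := Finset.mem_Icc.1 hi
    have hc : (-1 : ℤ) ^ (i - 1) = 1 ∨ (-1 : ℤ) ^ (i - 1) = -1 := neg_one_pow_eq_or ℤ _
    have e : (1 + (-1 : Polynomial ℤ) ^ (i - 1) * X ^ (i / 2)) = 1 + C ((-1 : ℤ) ^ (i - 1)) * X ^ (i / 2) := by
      simp
    rw [e]
    refine ⟨SR_binom _ hc _ (by omega), ?_⟩
    intro h
    have := natDegree_binom ((-1 : ℤ) ^ (i - 1)) (by simp) (i / 2) (by omega)
    rw [h] at this
    simp at this
    omega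
  exact ⟨SR_prod _ _ fun i hi => (key i hi).1, Finset.prod_ne_zero_iff.2 fun i hi => (key i hi).2⟩

lemma not_SR (a m : ℕ) (ha : 0 < a) (hm : 0 < m) (h2 : a < 2 * m) :
    ¬ SR (1 + X ^ a + 2 * X ^ m : Polynomial ℤ) := by
  intro h
  have hcoef : ∀ j, (1 + X ^ a + 2 * X ^ m : Polynomial ℤ).coeff j =
      (if j = 0 then 1 else 0) + (if j = a then 1 else 0) + 2 * (if j = m then 1 else 0) := by
    intro j
    rw [show (2 : Polynomial ℤ) = C 2 by rfl]
    simp only [coeff_add, coeff_one, coeff_X_pow, coeff_C_mul]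
  have hd : (1 + X ^ a + 2 * X ^ m : Polynomial ℤ).natDegree = max a m := by
    apply natDegree_eq_of_le_of_coeff_ne_zero
    · rw [natDegree_le_iff_coeff_eq_zero]
      intro j hj
      rw [hcoef]
      have : a < j ∧ m < j := by simpa using hj
      rw [if_neg (by omega), if_neg (by omega), if_neg (by omega)]; norm_num
    · rw [hcoef]
      split_ifs <;> omega
  have hrev : ∀ j ≤ max a m, (1 + X ^ a + 2 * X ^ m : Polynomial ℤ).reverse.coeff j =
      (1 + X ^ a + 2 * X ^ m : Polynomial ℤ).coeff (max a m - j) := by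
    intro j hj
    rw [coeff_reverse, hd, revAt_le hj]
  have hc : ∀ j ≤ max a m, (1 + X ^ a + 2 * X ^ m : Polynomial ℤ).coeff (max a m - j) =
      (1 + X ^ a + 2 * X ^ m : Polynomial ℤ).coeff j ∨
      (1 + X ^ a + 2 * X ^ m : Polynomial ℤ).coeff (max a m - j) =
      -(1 + X ^ a + 2 * X ^ m : Polynomial ℤ).coeff j := by
    intro j hj
    rw [← hrev j hj]
    rcases h with h | h
    · left; rw [h]
    · right; rw [h, coeff_neg]
  simp only [hcoef] at hc
  rcases Nat.lt_or_ge m a with h' | h'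
  · have := hc m (by omega)
    rw [show max a m - m = a - m by omega] at this
    split_ifs at this <;> omega
  · have := hc 0 (by omega)
    rw [show max a m - 0 = m by omega] at this
    split_ifs at this <;> omega

/-- Theorem 6.2: for `n` even and `I ⊊ [0,n-1]` containing `0` and all odd numbers of
`[n-1]`, with connected components `[a k, b k]`, `k ∈ [0,s]`, `a 0 = 0` (so the
component of `0` is `[0, b 0]` of cardinality `a₀ = b 0 + 1`),
`D_n^I(x) = C_I (1 + x^{a₀} + 2x^{n/2})/(1 + x^{n/2}) ∏_{i=a₀+2}^{n}(1+(-1)^{i-1}x^{⌊i/2⌋})`,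
stated multiplied through by the denominators; in particular `D_n^I(x)` is not a
product of cyclotomic polynomials. -/
theorem stmt18 (n s : ℕ) (hn : 0 < n) (hneven : Even n)
    (a b : ℕ → ℕ) (I : Finset ℕ) (ha0 : a 0 = 0)
    (hab : ∀ k ∈ Finset.range (s + 1), a k ≤ b k)
    (hbn : ∀ k ∈ Finset.range (s + 1), b k ≤ n - 1)
    (hsep : ∀ k ∈ Finset.range s, b k + 1 < a (k + 1))
    (hI : I = (Finset.range (s + 1)).biUnion (fun k => Finset.Icc (a k) (b k)))
    (hproper : I ≠ Finset.range n)
    (hodd : ∀ j ∈ Finset.Icc 1 (n - 1), Odd j → j ∈ I)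
    (m : ℕ) (hm : m = ∑ k ∈ Finset.range (s + 1), (b k - a k + 2) / 2) :
    ((1 + X ^ (n / 2)) *
        (∏ k ∈ Finset.range (s + 1), qfact (X ^ 2) ((b k - a k + 2) / 2)) *
        genD n I =
      qfact (X ^ 2) m * (1 + X ^ (b 0 + 1) + 2 * X ^ (n / 2)) *
        ∏ i ∈ Finset.Icc (b 0 + 3) n,
          (1 + (-1 : Polynomial ℤ) ^ (i - 1) * X ^ (i / 2))) ∧
    ¬ IsCyclotomicProduct (genD n I) := by
  obtain ⟨h1, h2, h3⟩ := stmt_part1 n s hn hneven a b I ha0 hab hbn hsep hI hproper hodd m hm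
  refine ⟨h1, fun hcyc => ?_⟩
  have hS : SR (qfact (X ^ 2) m * (∏ i ∈ Finset.Icc (b 0 + 3) n,
      (1 + (-1 : Polynomial ℤ) ^ (i - 1) * X ^ (i / 2))) *
        (1 + X ^ (b 0 + 1) + 2 * X ^ (n / 2))) := by
    have hL : SR ((1 + X ^ (n / 2)) *
        (∏ k ∈ Finset.range (s + 1), qfact (X ^ 2) ((b k - a k + 2) / 2)) * genD n I) :=
      SR_mul (SR_mul (SR_one_add _ (by omega)) (SR_prod _ _ fun k _ => (SR_qfact _).1))
        (SR_cycprod hcyc)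
    rw [h1] at hL
    convert hL using 1
    ring
  have hq := SR_qfact m
  have hl := SR_last (b 0 + 3) n (by omega)
  exact not_SR (b 0 + 1) (n / 2) (by omega) (by omega) (by omega)
    (SR_cancel (mul_ne_zero hq.2 hl.2) (SR_mul hq.1 hl.1) hS)


end OddLength
end
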